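/- arXiv:2202.11293 — 3 statements merged into one kernel-verified Lean document; each statement's English description precedes it below -/
import Mathlib

section
/- If α is a Liouville number, then e^α is transcendental (over ℚ, equivalently over ℤ). -/
open Finset in
/-- iterated convolution of `(exp x - 1)^m`. -/
noncomputable def convF (m : ℕ) : ℕ → ℝ → ℝ
  | 0 => fun x => (Real.exp x - 1) ^ m
  | r + 1 => fun x => ∫ t in (0 : ℝ)..x, (Real.exp (x - t) - 1) ^ m * convF m r t

theorem convF_cont (m r : ℕ) : Continuous (convF m r) := by
  induction r with
  | zero => unfold convF; fun_prop
  | succ r ih =>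
    unfold convF
    apply intervalIntegral.continuous_parametric_intervalIntegral_of_continuous
    · simp only [Function.uncurry_def]
      fun_prop
    · fun_prop

theorem amgm_aux (n : ℕ) (y : ℝ) (hy : 0 ≤ y) : (n + 1 - n * y) * y ^ n ≤ 1 := by
  induction n with
  | zero => simp
  | succ n ih =>
    have h1 : 0 ≤ (y - 1) * (y ^ (n + 1) - 1) := by
      rcases le_total 1 y with h | h
      · exact mul_nonneg (by linarith) (by linarith [one_le_pow₀ h (n := n + 1)])
      · exact mul_nonneg_of_nonpos_of_nonpos (by linarith)
          (by linarith [pow_le_one₀ hy h (n := n + 1)])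
    have h2 := mul_le_mul_of_nonneg_left ih hy
    push_cast
    ring_nf at *
    nlinarith

theorem amgm (n : ℕ) (hn : 0 < n) (x t : ℝ) (hx : 0 < x) (ht : 0 ≤ t) :
    (x - t) * (t / n) ^ n ≤ (x / (n + 1)) ^ (n + 1) := by
  have hs : 0 < x / (n + 1) := by positivity
  have hn' : (0 : ℝ) < n := by exact_mod_cast hn
  obtain ⟨y, hy⟩ : ∃ y, y = t / n / (x / (n + 1)) := ⟨_, rfl⟩
  have hy0 : 0 ≤ y := by rw [hy]; positivity
  have e1 : t / n = x / (n + 1) * y := by rw [hy]; field_simp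
  have e2 : x - t = x / (n + 1) * (n + 1 - n * y) := by
    rw [hy]; field_simp
  rw [e1, e2, mul_pow, pow_succ]
  have := mul_le_mul_of_nonneg_left (amgm_aux n y hy0)
    (mul_nonneg (pow_nonneg hs.le n) hs.le)
  linarith

theorem exp_sub_one_le (x : ℝ) : Real.exp x - 1 ≤ x * Real.exp x := by
  have h := Real.add_one_le_exp (-x)
  have h2 := mul_le_mul_of_nonneg_right h (Real.exp_pos x).le
  rw [← Real.exp_add] at h2
  simp at h2
  linarith

theorem convF_nonneg (m r : ℕ) (x : ℝ) (hx : 0 ≤ x) : 0 ≤ convF m r x := by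
  induction r generalizing x with
  | zero => unfold convF; exact pow_nonneg (by linarith [Real.add_one_le_exp x]) _
  | succ r ih =>
    unfold convF
    apply intervalIntegral.integral_nonneg hx
    intro t ht
    exact mul_nonneg (pow_nonneg (by linarith [Real.add_one_le_exp (x - t), ht.2]) _) (ih t ht.1)

theorem convF_upper (m r : ℕ) (x : ℝ) (hx : 0 < x) :
    convF m r x ≤ Real.exp x ^ m * ((x / (r + 1)) ^ (r + 1)) ^ m * x ^ r := by
  induction r generalizing x with
  | zero =>
    unfold convF
    simp only [CharP.cast_eq_zero, zero_add, div_one, pow_one, pow_zero, mul_one]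
    rw [← mul_pow]
    exact pow_le_pow_left₀ (by linarith [Real.add_one_le_exp x])
      (by linarith [exp_sub_one_le x]) _
  | succ r ih =>
    have hb : ∀ t ∈ Set.Ioo (0 : ℝ) x, (Real.exp (x - t) - 1) ^ m * convF m r t ≤
        Real.exp x ^ m * ((x / ((r + 1 : ℕ) + 1)) ^ (r + 1 + 1)) ^ m * x ^ r := by
      intro t ht
      have hxt : 0 < x - t := by linarith [ht.2]
      have ht0 := ht.1
      calc (Real.exp (x - t) - 1) ^ m * convF m r t
          ≤ ((x - t) * Real.exp (x - t)) ^ m *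
            (Real.exp t ^ m * ((t / (r + 1)) ^ (r + 1)) ^ m * t ^ r) := by
            apply mul_le_mul
            · exact pow_le_pow_left₀ (by linarith [Real.add_one_le_exp (x - t)])
                (exp_sub_one_le _) _
            · exact ih t ht0
            · exact convF_nonneg _ _ _ ht0.le
            · positivity
        _ = Real.exp x ^ m * ((x - t) * (t / ((r + 1 : ℕ) : ℝ)) ^ (r + 1)) ^ m * t ^ r := by
            have : Real.exp x = Real.exp (x - t) * Real.exp t := by
              rw [← Real.exp_add]; ring_nf
            rw [this]
            push_cast
            simp only [mul_pow]
            ring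
        _ ≤ _ := by
            gcongr
            · exact amgm (r + 1) (by omega) x t hx ht0.le
            · exact ht.2.le
    have hc := convF_cont m r
    calc convF m (r + 1) x = ∫ t in (0 : ℝ)..x, (Real.exp (x - t) - 1) ^ m * convF m r t := by
          rw [convF]
      _ ≤ ∫ t in (0 : ℝ)..x, 
        Real.exp x ^ m * ((x / ((r + 1 : ℕ) + 1)) ^ (r + 1 + 1)) ^ m * x ^ r := by
          apply intervalIntegral.integral_mono_on_of_le_Ioo hx.le
          · apply Continuous.intervalIntegrable; fun_prop
          · exact intervalIntegrable_const
          · exact hb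
      _ = _ := by
          rw [intervalIntegral.integral_const]
          simp only [smul_eq_mul, sub_zero]
          ring

theorem convF_lower (m r : ℕ) (x : ℝ) (hx : 0 < x) :
    (x / 3 ^ r) ^ (m + r * (m + 1)) ≤ convF m r x := by
  induction r generalizing x with
  | zero =>
    unfold convF
    simp
    exact pow_le_pow_left₀ hx.le (by linarith [Real.add_one_le_exp x]) _
  | succ r ih =>
    have hc := convF_cont m r
    have hint : ∀ a b : ℝ, IntervalIntegrable
      (fun t => (Real.exp (x - t) - 1) ^ m * convF m r t) MeasureTheory.volume a b := by
      intro a b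
      apply Continuous.intervalIntegrable; fun_prop
    have hnn : ∀ a b : ℝ, 0 ≤ a → a ≤ b → b ≤ x → 
      0 ≤ ∫ t in a..b, (Real.exp (x - t) - 1) ^ m * convF m r t := by
      intro a b ha hab hb
      apply intervalIntegral.integral_nonneg hab
      intro t ht
      exact mul_nonneg (pow_nonneg (by linarith [Real.add_one_le_exp (x - t), ht.2]) _) 
        (convF_nonneg _ _ _ (ha.trans ht.1))
    have hmid : (x / 3 ^ (r + 1)) ^ (m + (r + 1) * (m + 1)) ≤
        ∫ t in (x / 3)..(2 * x / 3), (Real.exp (x - t) - 1) ^ m * convF m r t := by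
      calc (x / 3 ^ (r + 1)) ^ (m + (r + 1) * (m + 1)) 
          = (x / 3 ^ (r + 1)) * (x / 3 ^ (r + 1)) ^ m * 
             (x / 3 / 3 ^ r) ^ (m + r * (m + 1)) := by
            have : x / 3 / 3 ^ r = x / 3 ^ (r + 1) := by rw [pow_succ]; field_simp
            rw [this]; ring
        _ ≤ (x / 3) * (x / 3) ^ m * (x / 3 / 3 ^ r) ^ (m + r * (m + 1)) := by
            have : x / 3 ^ (r + 1) ≤ x / 3 := by
              apply div_le_div_of_nonneg_left hx.le (by norm_num)
              rw [pow_succ]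
              have : (1 : ℝ) ≤ 3 ^ r := one_le_pow₀ (by norm_num)
              linarith
            gcongr
        _ = ∫ t in (x / 3)..(2 * x / 3), (x / 3) ^ m * (x / 3 / 3 ^ r) ^ (m + r * (m + 1)) := by
            rw [intervalIntegral.integral_const]
            simp only [smul_eq_mul]
            ring
        _ ≤ _ := by
          apply intervalIntegral.integral_mono_on (by linarith)
          · exact intervalIntegrable_const
          · exact hint _ _
          · intro t ht
            have h1 := ht.1
            have h2 := ht.2
            have ht0 : 0 < t := by linarith
            refine mul_le_mul ?_ (le_trans ?_ (ih t ht0)) (by positivity) ?_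
            · exact pow_le_pow_left₀ (by positivity) 
                (by linarith [Real.add_one_le_exp (x - t)]) _
            · gcongr
            · exact pow_nonneg (by linarith [Real.add_one_le_exp (x - t)]) _
    rw [convF]
    beta_reduce
    rw [← intervalIntegral.integral_add_adjacent_intervals (hint 0 (x / 3)) (hint (x / 3) x),
      ← intervalIntegral.integral_add_adjacent_intervals (hint (x / 3) (2 * x / 3)) 
        (hint (2 * x / 3) x)]
    have := hnn 0 (x / 3) le_rfl (by linarith) (by linarith)
    have := hnn (2 * x / 3) x (by linarith) (by linarith) le_rfl
    linarith

/-- exponential monomials. -/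
noncomputable def eMon (k a : ℕ) (x : ℝ) : ℝ := x ^ a / a.factorial * Real.exp (k * x)

/-- exponential polynomials with controlled coefficients. -/
def GoodEP (m N : ℕ) (L : ℝ) (r : ℕ) (H : ℝ) (f : ℝ → ℝ) : Prop :=
  ∃ c : ℕ → ℕ → ℝ,
    (∀ x, f x = ∑ k ∈ Finset.range (m + 1), ∑ a ∈ Finset.range N, c k a * eMon k a x) ∧
    (∀ k a, r < a → c k a = 0) ∧
    (∀ k a, ∃ z : ℤ, c k a * L ^ r = z * L ^ a) ∧
    ∑ k ∈ Finset.range (m + 1), ∑ a ∈ Finset.range N, |c k a| ≤ H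

theorem GoodEP.mono {m N : ℕ} {L : ℝ} {r : ℕ} {H H' : ℝ} {f : ℝ → ℝ} (h : GoodEP m N L r H f)
    (hH : H ≤ H') : GoodEP m N L r H' f := by
  obtain ⟨c, h1, h2, h3, h4⟩ := h
  exact ⟨c, h1, h2, h3, h4.trans hH⟩

theorem GoodEP.zero {m N : ℕ} {L : ℝ} {r : ℕ} : GoodEP m N L r 0 (fun _ => 0) := by
  refine ⟨fun _ _ => 0, by simp, by simp, fun k a => ⟨0, by simp⟩, by simp⟩

theorem GoodEP.single {m N : ℕ} {L : ℝ} {k a : ℕ} (hk : k ≤ m) (ha : a < N) :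
    GoodEP m N L a 1 (eMon k a) := by
  refine ⟨fun k' a' => if k' = k then (if a' = a then 1 else 0) else 0, ?_, ?_, ?_, ?_⟩
  · intro x
    rw [Finset.sum_eq_single k, Finset.sum_eq_single a]
    · simp
    · intro b _ hb; simp [hb]
    · intro h; simp at h; omega
    · intro b _ hb; simp [hb]
    · intro h; simp at h; omega
  · intro k' a' h
    have : a' ≠ a := by omega
    simp [this]
  · intro k' a'
    by_cases h : k' = k
    · by_cases h' : a' = a
      · exact ⟨1, by simp [h, h']⟩
      · exact ⟨0, by simp [h']⟩
    · exact ⟨0, by simp [h]⟩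
  · rw [Finset.sum_eq_single k, Finset.sum_eq_single a]
    · simp
    · intro b _ hb; simp [hb]
    · intro h; simp at h; omega
    · intro b _ hb; simp [hb]
    · intro h; simp at h; omega

theorem GoodEP.add {m N : ℕ} {L : ℝ} {r : ℕ} {H H' : ℝ} {f g : ℝ → ℝ} (h : GoodEP m N L r H f)
    (h' : GoodEP m N L r H' g) : GoodEP m N L r (H + H') (fun x => f x + g x) := by
  obtain ⟨c, h1, h2, h3, h4⟩ := h
  obtain ⟨c', h1', h2', h3', h4'⟩ := h'
  refine ⟨fun k a => c k a + c' k a, ?_, ?_, ?_, ?_⟩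
  · intro x
    simp only [h1, h1', add_mul, Finset.sum_add_distrib]
  · intro k a h
    simp only [h2 k a h, h2' k a h, add_zero]
  · intro k a
    obtain ⟨z, hz⟩ := h3 k a
    obtain ⟨z', hz'⟩ := h3' k a
    exact ⟨z + z', by push_cast; rw [add_mul, add_mul, hz, hz']⟩
  · refine le_trans ?_ (add_le_add h4 h4')
    rw [← Finset.sum_add_distrib]
    refine Finset.sum_le_sum fun k _ => ?_
    rw [← Finset.sum_add_distrib]
    exact Finset.sum_le_sum fun a _ => abs_add_le _ _

theorem GoodEP.smul {m N : ℕ} {L : ℝ} {r : ℕ} {H : ℝ} {f : ℝ → ℝ} (h : GoodEP m N L r H f)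
    (s : ℝ) (j : ℕ) (hs : ∃ z : ℤ, s * L ^ j = z) :
    GoodEP m N L (r + j) (|s| * H) (fun x => s * f x) := by
  obtain ⟨c, h1, h2, h3, h4⟩ := h
  obtain ⟨w, hw⟩ := hs
  refine ⟨fun k a => s * c k a, ?_, ?_, ?_, ?_⟩
  · intro x
    simp only [h1, Finset.mul_sum, mul_assoc]
  · intro k a h
    simp only [h2 k a (by omega), mul_zero]
  · intro k a
    obtain ⟨z, hz⟩ := h3 k a
    refine ⟨w * z, ?_⟩
    push_cast
    rw [← hw, pow_add, mul_assoc (s * L ^ j), ← hz]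
    ring
  · simp only [abs_mul, ← Finset.mul_sum]
    gcongr

theorem GoodEP.sum {ι : Type*} (s : Finset ι) {m N : ℕ} {L : ℝ} {r : ℕ} {H : ι → ℝ}
    {f : ι → ℝ → ℝ} (h : ∀ i ∈ s, GoodEP m N L r (H i) (f i)) :
    GoodEP m N L r (∑ i ∈ s, H i) (fun x => ∑ i ∈ s, f i x) := by
  classical
  induction s using Finset.induction_on with
  | empty => simpa using GoodEP.zero
  | insert i s hi ih =>
    simp only [Finset.sum_insert hi]
    exact (h i (by simp)).add (ih fun j hj => h j (by simp [hj]))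

/-- convolution of `exp (l x)` with a monomial. -/
noncomputable def convJ (l k a : ℕ) (x : ℝ) : ℝ :=
  ∫ t in (0 : ℝ)..x, Real.exp (l * (x - t)) * eMon k a t

theorem eMon_cont (k a : ℕ) : Continuous (eMon k a) := by
  unfold eMon; fun_prop

theorem convJ_self (k a : ℕ) : convJ k k a = eMon k (a + 1) := by
  funext x
  unfold convJ eMon
  have : ∀ t : ℝ, Real.exp (k * (x - t)) * (t ^ a / a.factorial * Real.exp (k * t)) =
      (Real.exp (k * x) / a.factorial) * t ^ a := by
    intro t
    have : Real.exp (k * x) = Real.exp (k * (x - t)) * Real.exp (k * t) := by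
      rw [← Real.exp_add]; ring_nf
    rw [this]; ring
  simp only [this]
  rw [intervalIntegral.integral_const_mul, integral_pow, Nat.factorial_succ]
  push_cast
  have : (a.factorial : ℝ) ≠ 0 := by positivity
  field_simp
  simp

theorem convJ_zero (l k : ℕ) (h : k ≠ l) (x : ℝ) :
    convJ l k 0 x = ((k : ℝ) - l)⁻¹ * (eMon k 0 x + (-1) * eMon l 0 x) := by
  have hkl : (k : ℝ) - l ≠ 0 := sub_ne_zero.2 (by exact_mod_cast h)
  have hd : ∀ t : ℝ, HasDerivAt
      (fun t : ℝ => ((k : ℝ) - l)⁻¹ * (Real.exp (l * (x - t)) * Real.exp (k * t)))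
      (Real.exp (l * (x - t)) * eMon k 0 t) t := by
    intro t
    have h1 : HasDerivAt (fun t : ℝ => Real.exp (l * (x - t)))
      (Real.exp (l * (x - t)) * (l * (-1))) t := by
      have := (((hasDerivAt_id t).const_sub x).const_mul (l : ℝ)).exp
      simpa using this
    have h2 : HasDerivAt (fun t : ℝ => Real.exp (k * t))
      (Real.exp (k * t) * k) t := by
      have := ((hasDerivAt_id t).const_mul (k : ℝ)).exp
      simpa using this
    refine ((h1.mul h2).const_mul (((k : ℝ) - l)⁻¹)).congr_deriv ?_
    unfold eMon
    simp
    field_simp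
    ring
  unfold convJ
  have hc := eMon_cont k 0
  rw [intervalIntegral.integral_eq_sub_of_hasDerivAt (fun t _ => hd t)
    (by apply Continuous.intervalIntegrable; fun_prop)]
  simp [eMon]
  ring

theorem convJ_succ (l k a : ℕ) (h : k ≠ l) (x : ℝ) :
    convJ l k (a + 1) x = ((k : ℝ) - l)⁻¹ * (eMon k (a + 1) x + (-1) * convJ l k a x) := by
  have hkl : (k : ℝ) - l ≠ 0 := sub_ne_zero.2 (by exact_mod_cast h)
  have hd : ∀ t : ℝ, HasDerivAt
      (fun t : ℝ => ((k : ℝ) - l)⁻¹ * (Real.exp (l * (x - t)) * eMon k (a + 1) t))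
      (Real.exp (l * (x - t)) * eMon k (a + 1) t +
        ((k : ℝ) - l)⁻¹ * (Real.exp (l * (x - t)) * eMon k a t)) t := by
    intro t
    have h1 : HasDerivAt (fun t : ℝ => Real.exp (l * (x - t)))
      (Real.exp (l * (x - t)) * (l * (-1))) t := by
      have := (((hasDerivAt_id t).const_sub x).const_mul (l : ℝ)).exp
      simpa using this
    have h2 : HasDerivAt (fun t : ℝ => Real.exp (k * t))
      (Real.exp (k * t) * k) t := by
      have := ((hasDerivAt_id t).const_mul (k : ℝ)).exp
      simpa using this
    have h3 : HasDerivAt (fun t : ℝ => t ^ (a + 1) / ((a + 1).factorial : ℝ))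
      (t ^ a / a.factorial) t := by
      refine ((hasDerivAt_pow (a + 1) t).div_const ((a + 1).factorial : ℝ)).congr_deriv ?_
      rw [Nat.factorial_succ]
      push_cast
      have : (a.factorial : ℝ) ≠ 0 := by positivity
      field_simp
    refine ((h1.mul (h3.mul h2)).const_mul (((k : ℝ) - l)⁻¹)).congr_deriv ?_
    unfold eMon
    simp only [Pi.mul_apply]
    field_simp
    ring
  have hc := eMon_cont k a
  have hc' := eMon_cont k (a + 1)
  have hi : IntervalIntegrable (fun t => Real.exp (l * (x - t)) * eMon k (a + 1) t)
    MeasureTheory.volume 0 x := by apply Continuous.intervalIntegrable; fun_prop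
  have hi' : IntervalIntegrable (fun t => ((k : ℝ) - l)⁻¹ * (Real.exp (l * (x - t)) * eMon k a t))
    MeasureTheory.volume 0 x := by apply Continuous.intervalIntegrable; fun_prop
  have key := intervalIntegral.integral_eq_sub_of_hasDerivAt (fun t _ => hd t) (hi.add hi')
  rw [intervalIntegral.integral_add hi hi', intervalIntegral.integral_const_mul] at key
  have e0 : eMon k (a + 1) 0 = 0 := by simp [eMon]
  rw [e0] at key
  unfold convJ
  simp only [sub_self, mul_zero, Real.exp_zero, one_mul, sub_zero] at key
  linarith

theorem convJ_good (m N : ℕ) (L : ℕ) (hL : ∀ i, 1 ≤ i → i ≤ m → i ∣ L) (l k a : ℕ)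
    (hl : l ≤ m) (hk : k ≤ m) (ha : a + 1 < N) :
    GoodEP m N L (a + 1) (a + 2) (convJ l k a) := by
  by_cases h : k = l
  · subst h
    rw [convJ_self]
    exact (GoodEP.single hk ha).mono (by linarith [(Nat.cast_nonneg a : (0 : ℝ) ≤ a)])
  have hkl : (k : ℝ) - l ≠ 0 := sub_ne_zero.2 (by exact_mod_cast h)
  have hδ : ∃ z : ℤ, ((k : ℝ) - l)⁻¹ * (L : ℝ) ^ 1 = z := by
    have hd : ((k : ℤ) - l) ∣ (L : ℤ) := by
      have := hL ((k : ℤ) - l).natAbs (by omega) (by omega)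
      rw [← Int.natAbs_dvd]
      exact_mod_cast this
    obtain ⟨z, hz⟩ := hd
    refine ⟨z, ?_⟩
    have hz' : (L : ℝ) = ((k : ℝ) - l) * z := by exact_mod_cast hz
    rw [hz']; field_simp
  have hδ1 : |((k : ℝ) - l)⁻¹| ≤ 1 := by
    rw [abs_inv]
    apply inv_le_one_of_one_le₀
    have : (1 : ℤ) ≤ |(k : ℤ) - l| := Int.one_le_abs (by omega)
    exact_mod_cast this
  have hm1 : ∃ z : ℤ, (-1 : ℝ) * (L : ℝ) ^ 0 = z := ⟨-1, by simp⟩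
  induction a with
  | zero =>
    have e : convJ l k 0 = fun x => ((k : ℝ) - l)⁻¹ * (eMon k 0 x + (-1) * eMon l 0 x) := by
      funext x; exact convJ_zero l k h x
    rw [e]
    have g1 : GoodEP m N L 0 1 (eMon k 0) := GoodEP.single hk (by omega)
    have g2 : GoodEP m N L 0 1 (eMon l 0) := GoodEP.single hl (by omega)
    have := (g1.add (g2.smul (-1) 0 hm1)).smul _ 1 hδ
    refine this.mono ?_
    norm_num at *
    linarith
  | succ a ih =>
    have e : convJ l k (a + 1) =
        fun x => ((k : ℝ) - l)⁻¹ * (eMon k (a + 1) x + (-1) * convJ l k a x) := by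
      funext x; exact convJ_succ l k a h x
    rw [e]
    have g1 : GoodEP m N L (a + 1) 1 (eMon k (a + 1)) := GoodEP.single hk (by omega)
    have g2 := ih (by omega)
    have := (g1.add (g2.smul (-1) 0 hm1)).smul _ 1 hδ
    refine this.mono ?_
    have ha0 : (0 : ℝ) ≤ a := Nat.cast_nonneg a
    simp only [abs_neg, abs_one, one_mul]
    push_cast
    calc _ ≤ 1 * (1 + ((a : ℝ) + 2)) := by gcongr
      _ = _ := by ring

theorem pow_expand (m : ℕ) (x : ℝ) : (Real.exp x - 1) ^ m =
    ∑ l ∈ Finset.range (m + 1), ((-1) ^ (m - l) * (m.choose l : ℝ)) * Real.exp (l * x) := by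
  rw [sub_eq_add_neg, add_pow]
  refine Finset.sum_congr rfl fun l _ => ?_
  rw [Real.exp_nat_mul]; ring

theorem sum_abs_choose (m : ℕ) : 
    ∑ l ∈ Finset.range (m + 1), |((-1) ^ (m - l) * (m.choose l : ℝ))| = 2 ^ m := by
  simp only [abs_mul, abs_pow, abs_neg, abs_one, one_pow, one_mul, Nat.abs_cast]
  exact_mod_cast Nat.sum_range_choose m

theorem convF_good (m N : ℕ) (L : ℕ) (hL0 : 0 < L) (hL : ∀ i, 1 ≤ i → i ≤ m → i ∣ L) (r : ℕ)
    (hr : r < N) : 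
    GoodEP m N L r ((2 ^ m) ^ (r + 1) * (r + 1).factorial) (convF m r) := by
  induction r with
  | zero =>
    have e : convF m 0 = fun x => ∑ l ∈ Finset.range (m + 1), 
        ((-1) ^ (m - l) * (m.choose l : ℝ)) * eMon l 0 x := by
      funext x
      simp only [convF, pow_expand, eMon]
      simp
    rw [e]
    refine GoodEP.mono (GoodEP.sum _ (H := fun l => |((-1) ^ (m - l) * (m.choose l : ℝ))| * 1) 
      fun l hl => ?_) ?_
    · have hl' : l ≤ m := by have := Finset.mem_range.1 hl; omega
      exact (GoodEP.single hl' hr).smul _ 0 ⟨(-1) ^ (m - l) * (m.choose l : ℤ), by push_cast; ring⟩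
    · simp only [mul_one, sum_abs_choose]
      simp
  | succ r ih =>
    obtain ⟨c, h1, h2, h3, h4⟩ := ih (by omega)
    have e : convF m (r + 1) = fun x => ∑ l ∈ Finset.range (m + 1), 
        ((-1) ^ (m - l) * (m.choose l : ℝ)) * ∑ k ∈ Finset.range (m + 1), 
          ∑ a ∈ Finset.range N, c k a * convJ l k a x := by
      funext x
      rw [convF]
      have hc := eMon_cont
      simp only [convJ, ← intervalIntegral.integral_const_mul]
      have : ∀ t, (Real.exp (x - t) - 1) ^ m * convF m r t = 
        ∑ l ∈ Finset.range (m + 1), ∑ k ∈ Finset.range (m + 1), 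
          ∑ a ∈ Finset.range N, ((-1) ^ (m - l) * (m.choose l : ℝ)) * 
            (c k a * (Real.exp (l * (x - t)) * eMon k a t)) := by
        intro t
        rw [pow_expand, h1, Finset.sum_mul]
        refine Finset.sum_congr rfl fun l _ => ?_
        rw [Finset.mul_sum]
        refine Finset.sum_congr rfl fun k _ => ?_
        rw [Finset.mul_sum]
        refine Finset.sum_congr rfl fun a _ => ?_
        ring
      simp only [this, Finset.mul_sum]
      have hii : ∀ l k a, IntervalIntegrable (fun t => ((-1) ^ (m - l) * (m.choose l : ℝ)) * 
            (c k a * (Real.exp (l * (x - t)) * eMon k a t))) MeasureTheory.volume 0 x := by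
        intro l k a
        have := hc k a
        apply Continuous.intervalIntegrable; fun_prop
      rw [intervalIntegral.integral_finsetSum]
      · refine Finset.sum_congr rfl fun l _ => ?_
        rw [intervalIntegral.integral_finsetSum]
        · refine Finset.sum_congr rfl fun k _ => ?_
          rw [intervalIntegral.integral_finsetSum]
          · refine Finset.sum_congr rfl fun a _ => ?_
            rw [← intervalIntegral.integral_const_mul]
          · intro a _; exact hii l k a
        · intro k _
          apply Continuous.intervalIntegrable
          have := hc k
          fun_prop
      · intro l _
        apply Continuous.intervalIntegrable
        fun_prop
    rw [e]
    have hin : ∀ l ∈ Finset.range (m + 1), GoodEP m N L (r + 1) 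
      (∑ k ∈ Finset.range (m + 1), ∑ a ∈ Finset.range N, |c k a| * (r + 2))
      (fun x => ∑ k ∈ Finset.range (m + 1), 
          ∑ a ∈ Finset.range N, c k a * convJ l k a x) := by
      intro l hl
      refine GoodEP.sum _ fun k hk => ?_
      refine GoodEP.sum _ fun a ha => ?_
      by_cases har : r < a
      · simp only [h2 k a har, zero_mul, abs_zero]
        exact GoodEP.zero
      have hl' : l ≤ m := by have := Finset.mem_range.1 hl; omega
      have hk' : k ≤ m := by have := Finset.mem_range.1 hk; omega
      have hJ := convJ_good m N L hL l k a hl' hk' (by omega)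
      have hr' : r + 1 = (a + 1) + (r - a) := by omega
      rw [hr']
      refine (hJ.smul (c k a) (r - a) ?_).mono ?_
      · obtain ⟨z, hz⟩ := h3 k a
        refine ⟨z, ?_⟩
        have hLa : (L : ℝ) ^ a ≠ 0 := by positivity
        have : (L : ℝ) ^ r = L ^ (r - a) * L ^ a := by rw [← pow_add]; congr 1; omega
        rw [this, ← mul_assoc] at hz
        exact mul_right_cancel₀ hLa hz
      · have : (a : ℝ) ≤ r := by exact_mod_cast (by omega : a ≤ r)
        gcongr
    refine (GoodEP.sum _ fun l hl => 
      (hin l hl).smul ((-1) ^ (m - l) * (m.choose l : ℝ)) 0 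
        ⟨(-1) ^ (m - l) * (m.choose l : ℤ), by push_cast; ring⟩).mono ?_
    rw [← Finset.sum_mul, sum_abs_choose]
    simp only [← Finset.sum_mul]
    calc (2 : ℝ) ^ m * ((∑ k ∈ Finset.range (m + 1), ∑ a ∈ Finset.range N, |c k a|) * (r + 2))
        ≤ 2 ^ m * (((2 ^ m) ^ (r + 1) * (r + 1).factorial) * (r + 2)) := by gcongr
      _ = _ := by
        rw [Nat.factorial_succ (r + 1)]
        push_cast
        ring
open Finset in
theorem alg_lower (β : ℝ) (hβ : IsAlgebraic ℚ β) : ∃ (B : ℝ) (d : ℕ), 1 ≤ B ∧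
    ∀ (m : ℕ) (Q : ℕ → ℤ) (H : ℝ), 1 ≤ H → ∑ k ∈ range (m + 1), |(Q k : ℝ)| ≤ H →
      ∑ k ∈ range (m + 1), (Q k : ℝ) * β ^ k ≠ 0 →
      1 ≤ |∑ k ∈ range (m + 1), (Q k : ℝ) * β ^ k| * H ^ d * B ^ m := by
  classical
  have hβi : IsIntegral ℚ β := hβ.isIntegral
  let K := IntermediateField.adjoin ℚ {β}
  have : FiniteDimensional ℚ K := IntermediateField.adjoin.finiteDimensional hβi
  let g : K := IntermediateField.AdjoinSimple.gen ℚ β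
  have hg : (g : ℝ) = β := rfl
  have hgalg : IsAlgebraic ℤ g :=
    (IsFractionRing.isAlgebraic_iff ℤ ℚ K).2 (Algebra.IsAlgebraic.isAlgebraic g)
  obtain ⟨b, hb0, hbint⟩ := hgalg.exists_integral_multiple
  let σ₀ : K →ₐ[ℚ] ℂ := (Complex.ofRealAm.restrictScalars ℚ).comp K.val
  have hσ₀ : ∀ y : K, σ₀ y = ((y : ℝ) : ℂ) := fun y => rfl
  obtain ⟨C, hC1, hC⟩ : ∃ C : ℝ, 1 ≤ C ∧ ∀ σ : K →ₐ[ℚ] ℂ, ‖σ g‖ ≤ C := by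
    refine ⟨1 + ∑ σ : K →ₐ[ℚ] ℂ, ‖σ g‖, ?_, ?_⟩
    · have : 0 ≤ ∑ σ : K →ₐ[ℚ] ℂ, ‖σ g‖ := sum_nonneg (fun _ _ => norm_nonneg _)
      linarith
    · intro σ
      have := single_le_sum (f := fun σ : K →ₐ[ℚ] ℂ => ‖σ g‖) (fun _ _ => norm_nonneg _)
        (mem_univ σ)
      linarith
  have hb1 : (1 : ℝ) ≤ |(b : ℝ)| := by
    exact_mod_cast Int.one_le_abs hb0
  let d := (univ.erase σ₀).card
  refine ⟨|(b : ℝ)| * (|(b : ℝ)| * C) ^ d, d, ?_, ?_⟩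
  · exact one_le_mul_of_one_le_of_one_le hb1
      (one_le_pow₀ (one_le_mul_of_one_le_of_one_le hb1 hC1))
  intro m Q H hH hQ hξ
  let η : K := (b : K) ^ m * ∑ k ∈ range (m + 1), (Q k : K) * g ^ k
  have hηint : IsIntegral ℤ η := by
    have : η = ∑ k ∈ range (m + 1), (Q k : K) * (b : K) ^ (m - k) * (b • g) ^ k := by
      simp only [η, mul_sum]
      refine sum_congr rfl fun k hk => ?_
      have hk' : m = (m - k) + k := by have := mem_range.1 hk; omega
      rw [zsmul_eq_mul, mul_pow]
      nth_rewrite 1 [hk']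
      rw [pow_add]; ring
    rw [this]
    refine IsIntegral.sum _ fun k _ => ?_
    refine IsIntegral.mul (IsIntegral.mul ?_ (IsIntegral.pow ?_ _)) (IsIntegral.pow hbint _)
    · exact isIntegral_algebraMap (R := ℤ) (A := K) (x := Q k)
    · exact isIntegral_algebraMap (R := ℤ) (A := K) (x := b)
  have hηre : (η : ℝ) = (b : ℝ) ^ m * ∑ k ∈ range (m + 1), (Q k : ℝ) * β ^ k := by
    simp [η, hg]
  have hη0 : η ≠ 0 := by
    intro h
    have : (η : ℝ) = 0 := by rw [h]; rfl
    rw [hηre] at this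
    rcases mul_eq_zero.1 this with h | h
    · exact hb0 (by simpa using (pow_ne_zero m (Int.cast_ne_zero.2 hb0 : (b:ℝ) ≠ 0) h).elim)
    · exact hξ h
  have hN := Algebra.norm_eq_prod_embeddings ℚ ℂ η
  obtain ⟨z, hz⟩ := (IsIntegrallyClosed.isIntegral_iff (R := ℤ) (K := ℚ)).1
    (Algebra.isIntegral_norm ℚ hηint)
  have hz0 : z ≠ 0 := by
    rintro rfl
    have : Algebra.norm ℚ η = 0 := by rw [← hz]; simp
    exact hη0 (Algebra.norm_eq_zero_iff.1 this)
  have h1 : (1 : ℝ) ≤ ∏ σ : K →ₐ[ℚ] ℂ, ‖σ η‖ := by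
    rw [← norm_prod, ← hN, ← hz]
    simp only [eq_intCast, map_intCast, Complex.norm_intCast]
    exact_mod_cast Int.one_le_abs hz0
  have hbd : ∀ σ : K →ₐ[ℚ] ℂ, ‖σ η‖ ≤ (|(b : ℝ)| * C) ^ m * H := by
    intro σ
    have : σ η = (b : ℂ) ^ m * ∑ k ∈ range (m + 1), (Q k : ℂ) * (σ g) ^ k := by
      simp [η]
    rw [this, norm_mul, norm_pow, Complex.norm_intCast, mul_pow, mul_assoc]
    gcongr
    calc _ ≤ ∑ k ∈ range (m + 1), ‖(Q k : ℂ) * (σ g) ^ k‖ := norm_sum_le _ _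
      _ ≤ ∑ k ∈ range (m + 1), |(Q k : ℝ)| * C ^ m := by
        refine sum_le_sum fun k hk => ?_
        rw [norm_mul, norm_pow, Complex.norm_intCast]
        gcongr
        exact (pow_le_pow_left₀ (norm_nonneg _) (hC σ) k).trans
          (pow_le_pow_right₀ hC1 (by have := mem_range.1 hk; omega))
      _ = C ^ m * ∑ k ∈ range (m + 1), |(Q k : ℝ)| := by rw [← sum_mul, mul_comm]
      _ ≤ _ := by gcongr
  rw [← mul_prod_erase univ _ (mem_univ σ₀)] at h1
  have h2 : ∏ σ ∈ univ.erase σ₀, ‖σ η‖ ≤ ((|(b : ℝ)| * C) ^ m * H) ^ d := by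
    rw [← prod_const]
    exact prod_le_prod (fun _ _ => norm_nonneg _) fun σ _ => hbd σ
  have h3 : ‖σ₀ η‖ = |(b : ℝ)| ^ m * |∑ k ∈ range (m + 1), (Q k : ℝ) * β ^ k| := by
    rw [hσ₀, hηre, Complex.norm_real, norm_mul, norm_pow, Real.norm_eq_abs, Real.norm_eq_abs]
  calc (1 : ℝ) ≤ _ := h1
    _ ≤ ‖σ₀ η‖ * ((|(b : ℝ)| * C) ^ m * H) ^ d := by gcongr
    _ = _ := by
      rw [h3]
      simp only [mul_pow, ← pow_mul]
      ring

theorem pow_sub_pow_bound (M x y : ℝ) (hM : 1 ≤ M) (hx : |x| ≤ M) (hy : |y| ≤ M) (a : ℕ) :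
    |x ^ a - y ^ a| ≤ a * M ^ a * |x - y| := by
  induction a with
  | zero => simp
  | succ a ih =>
    have e : x ^ (a + 1) - y ^ (a + 1) = x * (x ^ a - y ^ a) + y ^ a * (x - y) := by ring
    rw [e]
    calc _ ≤ |x * (x ^ a - y ^ a)| + |y ^ a * (x - y)| := abs_add_le _ _
      _ = |x| * |x ^ a - y ^ a| + |y| ^ a * |x - y| := by rw [abs_mul, abs_mul, abs_pow]
      _ ≤ M * (a * M ^ a * |x - y|) + M ^ a * |x - y| := by gcongr
      _ ≤ M * (a * M ^ a * |x - y|) + M ^ (a + 1) * |x - y| := by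
        have : M ^ a ≤ M ^ (a + 1) := pow_le_pow_right₀ hM (Nat.le_succ a)
        linarith [mul_le_mul_of_nonneg_right this (abs_nonneg (x - y))]
      _ = _ := by push_cast; ring

theorem approx (α : ℝ) (hα : 0 < α) (D m L : ℕ) (hL0 : 0 < L)
    (hL : ∀ i, 1 ≤ i → i ≤ m → i ∣ L) (p q : ℤ) (hq : 1 < q) (ε : ℝ) (hε1 : ε ≤ 1)
    (hε : |α - p / q| ≤ ε) : ∃ Q : ℕ → ℤ,
    ∑ k ∈ Finset.range (m + 1), |(Q k : ℝ)| ≤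
      ((q : ℝ) ^ D * D.factorial * (L : ℝ) ^ D) *
        (((2 : ℝ) ^ m) ^ (D + 1) * (D + 1).factorial * (α + 2) ^ D) ∧
    |∑ k ∈ Finset.range (m + 1), (Q k : ℝ) * Real.exp α ^ k -
      ((q : ℝ) ^ D * D.factorial * (L : ℝ) ^ D) * convF m D α| ≤
      ((q : ℝ) ^ D * D.factorial * (L : ℝ) ^ D) *
        (((2 : ℝ) ^ m) ^ (D + 1) * (D + 1).factorial *
          (D * (α + 2) ^ D * ε * Real.exp α ^ m)) := by
  obtain ⟨c, h1, h2, h3, h4⟩ := convF_good m (D + 1) L hL0 hL D (by omega)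
  have hq0 : (0 : ℝ) < q := by exact_mod_cast (by omega : 0 < q)
  set T : ℝ := (q : ℝ) ^ D * D.factorial * (L : ℝ) ^ D with hT
  have hT0 : 0 < T := by positivity
  set y : ℝ := (p : ℝ) / q with hy
  have hyM : |y| ≤ α + 2 := by
    have := abs_le.1 (hε.trans hε1)
    rw [abs_le]; constructor <;> linarith
  have hαM : |α| ≤ α + 2 := by rw [abs_of_pos hα]; linarith
  have hM1 : 1 ≤ α + 2 := by linarith
  have hint : ∀ k a, ∃ z : ℤ, a ∈ Finset.range (D + 1) →
      T * (c k a * (y ^ a / a.factorial)) = z := by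
    intro k a
    by_cases ha : a ∈ Finset.range (D + 1)
    · have haD : a ≤ D := by have := Finset.mem_range.1 ha; omega
      obtain ⟨z, hz⟩ := h3 k a
      obtain ⟨w, hw⟩ := Nat.factorial_dvd_factorial haD
      refine ⟨z * L ^ a * p ^ a * q ^ (D - a) * w, fun _ => ?_⟩
      have hqD : (q : ℝ) ^ D = q ^ (D - a) * q ^ a := by rw [← pow_add]; congr 1; omega
      have hf : (a.factorial : ℝ) ≠ 0 := by positivity
      have e : T * (c k a * (y ^ a / a.factorial)) =
        (q : ℝ) ^ D * D.factorial * (c k a * L ^ D) * (y ^ a / a.factorial) := by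
        rw [hT]; ring
      rw [e, hz, hw, hqD, hy, div_pow]
      push_cast
      field_simp
    · exact ⟨0, fun h => absurd h ha⟩
  choose z hz using hint
  refine ⟨fun k => ∑ a ∈ Finset.range (D + 1), z k a, ?_, ?_⟩
  · have hb : ∀ k ∈ Finset.range (m + 1), |((∑ a ∈ Finset.range (D + 1), z k a : ℤ) : ℝ)| ≤
        ∑ a ∈ Finset.range (D + 1), |c k a| * (T * (α + 2) ^ D) := by
      intro k _
      push_cast
      refine (Finset.abs_sum_le_sum_abs _ _).trans (Finset.sum_le_sum fun a ha => ?_)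
      have haD : a ≤ D := by have := Finset.mem_range.1 ha; omega
      rw [← hz k a ha, abs_mul, abs_of_pos hT0, abs_mul, abs_div, abs_pow, Nat.abs_cast]
      have : |y| ^ a / (a.factorial : ℝ) ≤ (α + 2) ^ D := by
        calc |y| ^ a / (a.factorial : ℝ) ≤ |y| ^ a := by
              apply div_le_self (by positivity)
              exact_mod_cast Nat.succ_le_of_lt (Nat.factorial_pos a)
          _ ≤ (α + 2) ^ a := by gcongr
          _ ≤ _ := pow_le_pow_right₀ hM1 haD
      calc T * (|c k a| * (|y| ^ a / (a.factorial : ℝ))) ≤ T * (|c k a| * (α + 2) ^ D) := by gcongr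
        _ = _ := by ring
    refine (Finset.sum_le_sum hb).trans ?_
    simp only [← Finset.sum_mul]
    calc _ ≤ (((2 : ℝ) ^ m) ^ (D + 1) * (D + 1).factorial) * (T * (α + 2) ^ D) := by gcongr
      _ = _ := by ring
  · have e : ∑ k ∈ Finset.range (m + 1),
        ((∑ a ∈ Finset.range (D + 1), z k a : ℤ) : ℝ) * Real.exp α ^ k - T * convF m D α =
        ∑ k ∈ Finset.range (m + 1), ∑ a ∈ Finset.range (D + 1),
          T * (c k a * ((y ^ a - α ^ a) / a.factorial * Real.exp α ^ k)) := by
      rw [h1, Finset.mul_sum, ← Finset.sum_sub_distrib]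
      refine Finset.sum_congr rfl fun k _ => ?_
      push_cast
      rw [Finset.sum_mul, Finset.mul_sum, ← Finset.sum_sub_distrib]
      refine Finset.sum_congr rfl fun a ha => ?_
      rw [← hz k a ha, eMon, Real.exp_nat_mul]
      ring
    rw [e]
    have hE1 : 1 ≤ Real.exp α := Real.one_le_exp hα.le
    have hb : ∀ k ∈ Finset.range (m + 1), |∑ a ∈ Finset.range (D + 1),
          T * (c k a * ((y ^ a - α ^ a) / a.factorial * Real.exp α ^ k))| ≤
        ∑ a ∈ Finset.range (D + 1), |c k a| *
          (T * (D * (α + 2) ^ D * ε * Real.exp α ^ m)) := by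
      intro k hk
      have hkm : k ≤ m := by have := Finset.mem_range.1 hk; omega
      refine (Finset.abs_sum_le_sum_abs _ _).trans (Finset.sum_le_sum fun a ha => ?_)
      have haD : a ≤ D := by have := Finset.mem_range.1 ha; omega
      rw [abs_mul, abs_of_pos hT0, abs_mul, abs_mul, abs_div, Nat.abs_cast, abs_pow, Real.abs_exp]
      have h5 : |y ^ a - α ^ a| / (a.factorial : ℝ) ≤ D * (α + 2) ^ D * ε := by
        calc |y ^ a - α ^ a| / (a.factorial : ℝ) ≤ |y ^ a - α ^ a| := by
              apply div_le_self (by positivity)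
              exact_mod_cast Nat.succ_le_of_lt (Nat.factorial_pos a)
          _ ≤ a * (α + 2) ^ a * |y - α| := pow_sub_pow_bound _ _ _ hM1 hyM hαM a
          _ ≤ D * (α + 2) ^ D * ε := by
            rw [abs_sub_comm]
            gcongr
      have h6 : Real.exp α ^ k ≤ Real.exp α ^ m := pow_le_pow_right₀ hE1 hkm
      have hε0 : 0 ≤ ε := (abs_nonneg _).trans hε
      calc T * (|c k a| * (|y ^ a - α ^ a| / (a.factorial : ℝ) * Real.exp α ^ k))
          ≤ T * (|c k a| * (D * (α + 2) ^ D * ε * Real.exp α ^ m)) := by gcongr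
        _ = _ := by ring
    refine (Finset.abs_sum_le_sum_abs _ _).trans ((Finset.sum_le_sum hb).trans ?_)
    simp only [← Finset.sum_mul]
    have hε0 : 0 ≤ ε := (abs_nonneg _).trans hε
    calc _ ≤ (((2 : ℝ) ^ m) ^ (D + 1) * (D + 1).factorial) *
          (T * (D * (α + 2) ^ D * ε * Real.exp α ^ m)) := by gcongr
      _ = _ := by ring

theorem lcm_bound : ∃ lam : ℝ, 1 ≤ lam ∧ ∀ m : ℕ, ∃ L : ℕ, 0 < L ∧
    (∀ i, 1 ≤ i → i ≤ m → i ∣ L) ∧ (L : ℝ) ≤ lam ^ m := by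
  refine ⟨Real.exp (Real.log 4 + 4), Real.one_le_exp ?_, fun m => ?_⟩
  · have := Real.log_nonneg (by norm_num : (1 : ℝ) ≤ 4)
    linarith
  refine ⟨Nat.lcmUpto m, Nat.lcmUpto_pos m, ?_, ?_⟩
  · intro i h1 h2
    exact Finset.dvd_lcm (f := id) (Finset.mem_Icc.2 ⟨h1, h2⟩)
  · have h1 := Chebyshev.psi_le_const_mul_self (x := m) (Nat.cast_nonneg m)
    rw [Chebyshev.psi_eq_log_lcmUpto] at h1
    have hp : (0 : ℝ) < Nat.lcmUpto m := by exact_mod_cast Nat.lcmUpto_pos m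
    rw [← Real.exp_log hp, ← Real.exp_nat_mul]
    apply Real.exp_le_exp.2
    linarith

set_option maxHeartbeats 1000000 in
theorem main_pos (α : ℝ) (hα : 0 < α) (h : Liouville α) : Transcendental ℚ (Real.exp α) := by
  intro halg
  obtain ⟨B, d, hB1, hB⟩ := alg_lower _ halg
  obtain ⟨lam, hlam1, hlam⟩ := lcm_bound
  have hE1 : 1 ≤ Real.exp α := Real.one_le_exp hα.le
  -- choice of D
  obtain ⟨D, hD⟩ := exists_nat_ge (2 * (lam ^ (d + 1) * 2 ^ d * Real.exp α * α * B))
  have hS : lam ^ (D * (d + 1)) * (2 ^ (D + 1)) ^ d * Real.exp α * (α / (D + 1)) ^ (D + 1) * B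
      ≤ 1 / 2 := by
    calc lam ^ (D * (d + 1)) * (2 ^ (D + 1)) ^ d * Real.exp α * (α / (D + 1)) ^ (D + 1) * B
        ≤ lam ^ ((D + 1) * (d + 1)) * (2 ^ (D + 1)) ^ d * Real.exp α ^ (D + 1) *
          (α / (D + 1)) ^ (D + 1) * B ^ (D + 1) := by
          gcongr
          · omega
          · exact le_self_pow₀ hE1 (by omega)
          · exact le_self_pow₀ hB1 (by omega)
      _ = ((lam ^ (d + 1) * 2 ^ d * Real.exp α * α * B) / (D + 1)) ^ (D + 1) := by
          rw [mul_comm (D + 1) (d + 1), pow_mul lam, ← pow_mul 2, mul_comm (D + 1) d, pow_mul 2]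
          simp only [← mul_pow]
          congr 1
          ring
      _ ≤ (1 / 2) ^ (D + 1) := by
          refine pow_le_pow_left₀ (by positivity) ?_ _
          rw [div_le_iff₀ (by positivity)]
          linarith
      _ ≤ 1 / 2 := pow_le_of_le_one (by norm_num) (by norm_num) (by omega)
  set S := lam ^ (D * (d + 1)) * (2 ^ (D + 1)) ^ d * Real.exp α * (α / (D + 1)) ^ (D + 1) * B
    with hSdef
  have hS0 : 0 ≤ S := by positivity
  -- constants
  set C1 : ℝ := 2 * D.factorial * α ^ D *
    (D.factorial * (D + 1).factorial * (α + 2) ^ D) ^ d with hC1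
  obtain ⟨c0, hc0⟩ := pow_unbounded_of_one_lt C1 (by norm_num : (1 : ℝ) < 2)
  set c : ℕ := D * (d + 1) + c0 with hc
  set κ : ℝ := α / 3 ^ D with hκ
  have hκ0 : 0 < κ := by positivity
  set W : ℝ := 2 ^ (D + 1) * Real.exp α / κ ^ (D + 1) with hW
  set C2 : ℝ := 2 * (D + 1).factorial * (D * (α + 2) ^ D) / κ ^ D with hC2
  have hW0 : 0 < W := by positivity
  have hC20 : 0 ≤ C2 := by positivity
  obtain ⟨n, hn⟩ := pow_unbounded_of_one_lt (W ^ c * max C2 1) (by norm_num : (1 : ℝ) < 2)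
  obtain ⟨p, q, hq, -, hpq⟩ := h (2 * n)
  have hq0 : (0 : ℝ) < q := by exact_mod_cast (by omega : 0 < q)
  have hq1 : (1 : ℝ) ≤ q := by exact_mod_cast hq.le
  obtain ⟨l, hl1, hl2, hl3⟩ : ∃ l : ℕ, 1 ≤ l ∧ (q : ℝ) ≤ 2 ^ l ∧ (2 : ℝ) ^ l ≤ q ^ 2 := by
    obtain ⟨Q, rfl⟩ := Int.eq_ofNat_of_zero_le (by omega : 0 ≤ q)
    have hQ : 2 ≤ Q := by omega
    refine ⟨Nat.log 2 Q + 1, by omega, ?_, ?_⟩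
    · exact_mod_cast (Nat.lt_pow_succ_log_self (by norm_num) Q).le
    · have h1 := Nat.pow_log_le_self 2 (by omega : Q ≠ 0)
      have : 2 ^ (Nat.log 2 Q + 1) ≤ Q ^ 2 := by
        rw [pow_succ, pow_two]
        exact Nat.mul_le_mul h1 hQ
      exact_mod_cast this
  set ε : ℝ := 1 / (q : ℝ) ^ (2 * n) with hε
  have hε1 : ε ≤ 1 := by
    rw [hε]
    exact (div_le_one (by positivity)).2 (one_le_pow₀ hq1)
  have hεn : ε * (2 ^ l) ^ n ≤ 1 := by
    rw [hε, one_div, inv_mul_le_iff₀ (by positivity), mul_one, pow_mul]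
    gcongr
  set m : ℕ := c * l with hm
  obtain ⟨L, hL0, hLd, hLb⟩ := hlam m
  obtain ⟨Q, hQ1, hQ2⟩ := approx α hα D m L hL0 hLd p q hq ε hε1 hpq.le
  set T : ℝ := (q : ℝ) ^ D * D.factorial * (L : ℝ) ^ D with hT
  have hT0 : 0 < T := by positivity
  have hL1 : (1 : ℝ) ≤ L := by exact_mod_cast hL0
  have hf1 : ∀ a : ℕ, (1 : ℝ) ≤ a.factorial := fun a => by
    exact_mod_cast Nat.succ_le_of_lt (Nat.factorial_pos a)
  have hT1 : 1 ≤ T :=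
    one_le_mul_of_one_le_of_one_le (one_le_mul_of_one_le_of_one_le (one_le_pow₀ hq1) (hf1 D))
      (one_le_pow₀ hL1)
  set F := convF m D α with hF
  have hFlow : κ ^ D * (κ ^ (D + 1)) ^ m ≤ F := by
    refine le_trans (le_of_eq ?_) (convF_lower m D α hα)
    rw [← hκ, ← pow_mul, ← pow_add]
    congr 1
    ring
  have hF0 : 0 < F := lt_of_lt_of_le (by positivity) hFlow
  have hFup := convF_upper m D α hα
  rw [← hF] at hFup
  -- the error
  have herr : ((2 : ℝ) ^ m) ^ (D + 1) * (D + 1).factorial *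
          (D * (α + 2) ^ D * ε * Real.exp α ^ m) ≤ F / 2 := by
    have hWm : W ^ m * C2 * ε ≤ 1 := by
      have hε0 : 0 ≤ ε := by positivity
      calc W ^ m * C2 * ε ≤ W ^ m * (max C2 1) ^ l * ε := by
            gcongr
            exact (le_max_left C2 1).trans (le_self_pow₀ (le_max_right C2 1) (by omega))
        _ = (W ^ c * max C2 1) ^ l * ε := by rw [hm, mul_pow, pow_mul]
        _ ≤ (2 ^ n) ^ l * ε := by gcongr
        _ = ε * (2 ^ l) ^ n := by rw [← pow_mul, ← pow_mul, mul_comm n l, mul_comm]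
        _ ≤ 1 := hεn
    have e : ((2 : ℝ) ^ m) ^ (D + 1) * (D + 1).factorial *
          (D * (α + 2) ^ D * ε * Real.exp α ^ m) =
          (W ^ m * C2 * ε) * (κ ^ D * (κ ^ (D + 1)) ^ m) / 2 := by
      rw [hW, hC2, div_pow, mul_pow, ← pow_mul 2 m, mul_comm m, pow_mul 2]
      field_simp
    rw [e]
    have : (W ^ m * C2 * ε) * (κ ^ D * (κ ^ (D + 1)) ^ m) ≤ 1 * F := by
      gcongr
    linarith
  set ξ := ∑ k ∈ Finset.range (m + 1), (Q k : ℝ) * Real.exp α ^ k with hξ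
  have hQ3 : |ξ - T * F| ≤ T * (F / 2) := hQ2.trans (by gcongr)
  have hQ4 := abs_le.1 hQ3
  have hTF : 0 < T * F := by positivity
  have hξ0 : 0 < ξ := by linarith
  have hξup : ξ ≤ 2 * (T * F) := by linarith
  set H := T * (((2 : ℝ) ^ m) ^ (D + 1) * (D + 1).factorial * (α + 2) ^ D) with hH
  have hH1 : 1 ≤ H := by
    refine one_le_mul_of_one_le_of_one_le hT1 (one_le_mul_of_one_le_of_one_le
      (one_le_mul_of_one_le_of_one_le ?_ (hf1 _)) (one_le_pow₀ (by linarith)))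
    exact one_le_pow₀ (one_le_pow₀ (by norm_num))
  have key := hB m Q H hH1 hQ1 hξ0.ne'
  rw [← hξ, abs_of_pos hξ0] at key
  have hTb : T ≤ (q : ℝ) ^ D * D.factorial * (lam ^ m) ^ D := by
    rw [hT]; gcongr
  have hfin : ξ * H ^ d * B ^ m ≤ C1 * q ^ (D * (d + 1)) * S ^ m := by
    set T' := (q : ℝ) ^ D * D.factorial * (lam ^ m) ^ D with hT'
    calc ξ * H ^ d * B ^ m ≤ (2 * (T' * (Real.exp α ^ m * ((α / (D + 1)) ^ (D + 1)) ^ m * α ^ D)))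
          * (T' * (((2 : ℝ) ^ m) ^ (D + 1) * (D + 1).factorial * (α + 2) ^ D)) ^ d * B ^ m := by
          have : ξ ≤ 2 * (T' * (Real.exp α ^ m * ((α / (D + 1)) ^ (D + 1)) ^ m * α ^ D)) :=
            hξup.trans (by gcongr)
          have h2 : H ≤ T' * (((2 : ℝ) ^ m) ^ (D + 1) * (D + 1).factorial * (α + 2) ^ D) := by
            rw [hH]; gcongr
          gcongr
      _ = C1 * q ^ (D * (d + 1)) * S ^ m := by
          rw [hC1, hSdef, hT']
          simp only [mul_pow, div_pow, ← pow_mul]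
          ring
  have hq' : (q : ℝ) ^ (D * (d + 1)) ≤ 2 ^ (l * (D * (d + 1))) := by
    rw [pow_mul 2 l]; gcongr
  have : C1 * q ^ (D * (d + 1)) * S ^ m < 1 := by
    calc C1 * q ^ (D * (d + 1)) * S ^ m ≤ C1 * 2 ^ (l * (D * (d + 1))) * (1 / 2) ^ m := by
          have : 0 ≤ C1 := by positivity
          gcongr
      _ < 2 ^ c0 * 2 ^ (l * (D * (d + 1))) * (1 / 2) ^ m := by gcongr
      _ ≤ 2 ^ (l * c0) * 2 ^ (l * (D * (d + 1))) * (1 / 2) ^ m := by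
          gcongr
          · norm_num
          · exact Nat.le_mul_of_pos_left _ hl1
      _ = 1 := by
          rw [← pow_add, ← mul_add, add_comm c0, ← hc, mul_comm l c, ← hm, ← mul_pow]
          norm_num
  linarith

theorem liouville_neg (α : ℝ) (h : Liouville α) : Liouville (-α) := by
  intro n
  obtain ⟨a, b, hb, hne, hlt⟩ := h n
  refine ⟨-a, b, hb, ?_, ?_⟩
  · intro h
    apply hne
    push_cast at h
    rw [neg_div] at h
    linarith
  · push_cast
    rw [neg_div, neg_sub_neg, abs_sub_comm]
    exact hlt

theorem liouville_exp_transcendental (α : ℝ) (h : Liouville α) :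
    Transcendental ℚ (Real.exp α) := by
  rcases lt_trichotomy α 0 with h0 | h0 | h0
  · have := main_pos (-α) (by linarith) (liouville_neg α h)
    intro halg
    apply this
    rw [Real.exp_neg]
    exact halg.inv
  · exact absurd h0 h.irrational.ne_zero
  · exact main_pos α h0 h
end

section
/- If α is a Liouville number with α > 0, then the natural logarithm log α is transcendental. -/
namespace LLT

open scoped Nat
open Complex Polynomial

noncomputable def P (f : ℂ[X]) (s : ℂ) :=
  exp s * f.sumIDeriv.eval 0 - f.sumIDeriv.eval s

theorem P_eq_integral_exp_mul_eval (f : ℂ[X]) (s : ℂ) :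
    P f s = exp s * (s * ∫ x in 0..1, exp (-(x • s)) * f.eval (x • s)) := by
  rw [LindemannWeierstrass.integral_exp_mul_eval, mul_add, mul_neg, exp_neg, mul_inv_cancel_left₀ (exp_ne_zero s),
    neg_add_eq_sub, P]

theorem P_le_aux (f : ℕ → ℂ[X]) (s : ℂ) (c : ℝ)
    (hc : ∀ p : ℕ, ∀ x ∈ Set.Ioc (0 : ℝ) 1, ‖(f p).eval (x • s)‖ ≤ c ^ p) :
    ∃ c' ≥ 0, ∀ p : ℕ,
      ‖P (f p) s‖ ≤
        Real.exp s.re * (Real.exp ‖s‖ * c' ^ p * ‖s‖) := by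
  refine ⟨|c|, abs_nonneg _, fun p => ?_⟩
  rw [P_eq_integral_exp_mul_eval (f p) s, mul_comm s, norm_mul, norm_mul, norm_exp]
  gcongr
  rw [intervalIntegral.integral_of_le zero_le_one, ← mul_one (_ * _)]
  convert! MeasureTheory.norm_setIntegral_le_of_norm_le_const _ _
  · rw [Real.volume_real_Ioc_of_le zero_le_one, sub_zero]
  · rw [Real.volume_Ioc, sub_zero]; exact ENNReal.ofReal_lt_top
  intro x hx
  rw [norm_mul, norm_exp]
  gcongr
  · simp only [Set.mem_Ioc] at hx
    apply (re_le_norm _).trans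
    rw [norm_neg, norm_smul, Real.norm_of_nonneg hx.1.le]
    exact mul_le_of_le_one_left (norm_nonneg _) hx.2
  · rw [← abs_pow]
    exact (hc p x hx).trans (le_abs_self _)

theorem P_le (f : ℕ → ℂ[X]) (s : ℂ) (c : ℝ)
    (hc : ∀ p : ℕ, ∀ x ∈ Set.Ioc (0 : ℝ) 1, ‖(f p).eval (x • s)‖ ≤ c ^ p) :
    ∃ c' ≥ 0, ∀ p ≠ 0, ‖P (f p) s‖ ≤ c' ^ p := by
  obtain ⟨c', hc', h'⟩ := P_le_aux f s c hc; clear c hc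
  let c₁ := max (Real.exp s.re) 1
  let c₂ := max (Real.exp ‖s‖) 1
  let c₃ := max ‖s‖ 1
  use c₁ * (c₂ * c' * c₃), by positivity
  intro p hp
  refine (h' p).trans ?_
  simp_rw [mul_pow]
  have le_max_one_pow {x : ℝ} : x ≤ max x 1 ^ p :=
    (max_cases x 1).elim (fun h ↦ h.1.symm ▸ le_self_pow₀ h.2 hp)
      fun h ↦ by rw [h.1, one_pow]; exact h.2.le
  gcongr <;> exact le_max_one_pow

theorem exp_polynomial_approx_aux (f : ℤ[X]) (s : ℂ) :
    ∃ c ≥ 0,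
      ∀ p ≠ 0, ‖P (map (algebraMap ℤ ℂ) (X ^ (p - 1) * f ^ p)) s‖ ≤ c ^ p := by
  have : Bornology.IsBounded
      ((fun x : ℝ ↦ max (x * ‖s‖) 1 * ‖aeval (x * s) f‖) '' Set.Ioc 0 1) := by
    have h :
      (fun x : ℝ ↦ max (x * ‖s‖) 1 * ‖aeval (x * s) f‖) '' Set.Ioc 0 1 ⊆
        (fun x : ℝ ↦ max (x * ‖s‖) 1 * ‖aeval (x * s) f‖) '' Set.Icc 0 1 :=
      Set.image_mono Set.Ioc_subset_Icc_self
    refine (IsCompact.image isCompact_Icc ?_).isBounded.subset h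
    fun_prop
  obtain ⟨c, h⟩ := this.exists_norm_le
  simp_rw [Real.norm_eq_abs] at h
  refine P_le _ s c (fun p x hx => ?_)
  specialize h (max (x * ‖s‖) 1 * ‖aeval (x * s) f‖) (Set.mem_image_of_mem _ hx)
  grw [← h]
  simp_rw [Polynomial.map_mul, Polynomial.map_pow, map_X, eval_mul, eval_pow, eval_X, norm_mul,
    Complex.norm_pow, real_smul, norm_mul, norm_real, ← eval₂_eq_eval_map, ← aeval_def, abs_mul,
    abs_norm, mul_pow, Real.norm_of_nonneg hx.1.le]
  refine mul_le_mul_of_nonneg_right ?_ (pow_nonneg (norm_nonneg _) _)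
  rw [← mul_pow, abs_of_nonneg (by positivity), max_def]
  split_ifs with hx1
  · rw [one_pow]
    exact pow_le_one₀ (mul_nonneg hx.1.le (norm_nonneg _)) hx1
  · push Not at hx1
    exact pow_le_pow_right₀ hx1.le (Nat.sub_le _ _)


theorem coeff_mul_bound (f g : ℤ[X]) (M : ℤ) (hM : 0 ≤ M) (hg : ∀ i, |g.coeff i| ≤ M) (i : ℕ) :
    |(f * g).coeff i| ≤ (∑ j ∈ f.support, |f.coeff j|) * M := by
  rw [coeff_mul, Finset.Nat.sum_antidiagonal_eq_sum_range_succ_mk]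
  refine (Finset.abs_sum_le_sum_abs _ _).trans ?_
  have : ∀ k ∈ Finset.range i.succ, |f.coeff k * g.coeff (i - k)| ≤ |f.coeff k| * M := by
    intro k _
    rw [abs_mul]
    exact mul_le_mul_of_nonneg_left (hg _) (abs_nonneg _)
  refine (Finset.sum_le_sum this).trans ?_
  rw [← Finset.sum_mul]
  refine mul_le_mul_of_nonneg_right ?_ hM
  rw [← Finset.sum_filter_add_sum_filter_not (Finset.range i.succ) (fun k => k ∈ f.support)]
  have h0 : ∑ x ∈ Finset.range i.succ with x ∉ f.support, |f.coeff x| = 0 := by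
    refine Finset.sum_eq_zero fun x hx => ?_
    simpa using (Finset.mem_filter.mp hx).2
  rw [h0, add_zero]
  refine Finset.sum_le_sum_of_subset_of_nonneg ?_ (fun _ _ _ => abs_nonneg _)
  intro x hx
  exact (Finset.mem_filter.mp hx).2

theorem coeff_pow_bound (f : ℤ[X]) (p : ℕ) (i : ℕ) :
    |(f ^ p).coeff i| ≤ (∑ j ∈ f.support, |f.coeff j|) ^ p := by
  induction p generalizing i with
  | zero => 
    simp only [pow_zero, coeff_one]
    split_ifs <;> simp
  | succ p ih =>
    rw [pow_succ', pow_succ']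
    exact coeff_mul_bound f _ _ (pow_nonneg (Finset.sum_nonneg fun _ _ => abs_nonneg _) _) ih i

theorem eval_sumIDeriv_bound (f : ℤ[X]) (p : ℕ) (hp : 0 < p) :
    |eval 0 (sumIDeriv (X ^ (p - 1) * f ^ p))| ≤
      ((p * (f.natDegree + 1))! : ℤ) * (∑ j ∈ f.support, |f.coeff j|) ^ p := by
  set L := ∑ j ∈ f.support, |f.coeff j|
  have hL : 0 ≤ L := Finset.sum_nonneg fun _ _ => abs_nonneg _
  have hdeg : (X ^ (p - 1) * f ^ p).natDegree < p * (f.natDegree + 1) := by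
    refine lt_of_le_of_lt natDegree_mul_le ?_
    rw [natDegree_X_pow]
    have := natDegree_pow_le (p := f) (n := p)
    rw [mul_add, mul_one]
    omega
  rw [sumIDeriv_apply_of_lt hdeg, eval_finsetSum]
  refine (Finset.abs_sum_le_sum_abs _ _).trans ?_
  have key : ∀ i ∈ Finset.range (p * (f.natDegree + 1)),
      |eval 0 (derivative^[i] (X ^ (p - 1) * f ^ p))| ≤
        ((p * (f.natDegree + 1) - 1)! : ℤ) * L ^ p := by
    intro i hi
    rw [← coeff_zero_eq_eval_zero, coeff_iterate_derivative]
    simp only [zero_add, Nat.descFactorial_self, nsmul_eq_mul, abs_mul, Nat.abs_cast]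
    have h1 : (i ! : ℤ) ≤ ((p * (f.natDegree + 1) - 1)! : ℤ) := by
      have := Finset.mem_range.mp hi
      exact_mod_cast Nat.factorial_le (by omega)
    have h2 : |(X ^ (p - 1) * f ^ p).coeff i| ≤ L ^ p := by
      rw [coeff_X_pow_mul']
      split_ifs
      · exact coeff_pow_bound f p _
      · simpa using pow_nonneg hL p
    exact mul_le_mul h1 h2 (abs_nonneg _) (by positivity)
  refine (Finset.sum_le_sum key).trans ?_
  rw [Finset.sum_const, Finset.card_range, nsmul_eq_mul, ← mul_assoc]
  have : p * (f.natDegree + 1) ≠ 0 := by positivity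
  rw [← Nat.mul_factorial_pred this]
  push_cast
  exact le_rfl

theorem hermite (f : ℤ[X]) (hf : f.eval 0 ≠ 0) :
    ∃ c : ℝ, 1 ≤ c ∧
      ∀ p > (eval 0 f).natAbs, p.Prime →
        ∃ n : ℤ, ¬ (p : ℤ) ∣ n ∧ (|n| : ℝ) ≤ c ^ p * (p : ℝ) ^ ((f.natDegree + 1) * p) ∧
        ∃ gp : ℤ[X], gp.natDegree ≤ p * f.natDegree ∧
          ∀ r : ℂ, aeval r f = 0 →
            ‖n * exp r - p * aeval r gp‖ ≤ c ^ p / (p - 1)! := by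
  have hf0 : f ≠ 0 := by rintro rfl; simp at hf
  choose c' c'0 Pp'_le using exp_polynomial_approx_aux f
  set L : ℤ := ∑ j ∈ f.support, |f.coeff j| with hLdef
  have hL : 0 ≤ L := Finset.sum_nonneg fun _ _ => abs_nonneg _
  set κ : ℕ := f.natDegree + 1 with hκ
  set C1 : ℝ := ∑ r ∈ (f.aroots ℂ).toFinset, c' r with hC1
  have hC1n : 0 ≤ C1 := Finset.sum_nonneg fun r _ => c'0 r
  have hLr : (0 : ℝ) ≤ L := by exact_mod_cast hL
  have hb : 0 ≤ (κ : ℝ) ^ κ * L := by positivity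
  refine ⟨1 + C1 + (κ : ℝ) ^ κ * L, by linarith, ?_⟩
  intro p p_gt prime_p
  obtain ⟨gp', -, h'⟩ := eval_sumIDeriv_of_pos (X ^ (p - 1) * f ^ p) prime_p.pos
  specialize h' 0 (by rw [C_0, sub_zero])
  refine ⟨f.eval 0 ^ p + p * gp'.eval 0, ?_, ?_, ?_⟩
  · rw [dvd_add_left (dvd_mul_right _ _)]
    contrapose! p_gt with h
    exact Nat.le_of_dvd (Int.natAbs_pos.mpr hf) (Int.natCast_dvd.mp (Int.Prime.dvd_pow' prime_p h))
  · have hb1 := eval_sumIDeriv_bound f p prime_p.pos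
    rw [h'] at hb1
    have e : (p - 1)! • eval 0 (f ^ p) + p ! • eval 0 gp' =
        ((p - 1)! : ℤ) * (f.eval 0 ^ p + p * gp'.eval 0) := by
      rw [← Nat.mul_factorial_pred prime_p.ne_zero]
      simp
      ring
    rw [e, abs_mul, Nat.abs_cast] at hb1
    have h1 : |f.eval 0 ^ p + p * gp'.eval 0| ≤ ((p * κ)! : ℤ) * L ^ p := by
      refine le_trans ?_ hb1
      refine le_mul_of_one_le_left (abs_nonneg _) ?_
      exact_mod_cast Nat.factorial_pos _
    have h2 : ((|f.eval 0 ^ p + p * gp'.eval 0| : ℤ) : ℝ) ≤ ((p * κ)! : ℝ) * (L : ℝ) ^ p := by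
      exact_mod_cast h1
    have h3 : ((p * κ)! : ℝ) ≤ ((p : ℝ) * κ) ^ (p * κ) := by
      exact_mod_cast Nat.factorial_le_pow (p * κ)
    push_cast at h2 ⊢
    refine h2.trans ?_
    calc ((p * κ)! : ℝ) * (L : ℝ) ^ p ≤ ((p : ℝ) * κ) ^ (p * κ) * (L : ℝ) ^ p := by gcongr
      _ = ((κ : ℝ) ^ κ * L) ^ p * (p : ℝ) ^ (κ * p) := by
        rw [mul_pow, mul_pow, mul_comm p κ, pow_mul (κ : ℝ)]; ring
      _ ≤ _ := by gcongr; linarith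
  obtain ⟨gp, gp'_le, h⟩ := aeval_sumIDeriv ℂ (X ^ (p - 1) * f ^ p) p
  refine ⟨gp, ?_, ?_⟩
  · refine gp'_le.trans ((tsub_le_tsub_right natDegree_mul_le p).trans ?_)
    rw [natDegree_X_pow, natDegree_pow]
    omega
  intro r hr0
  have hr : r ∈ f.aroots ℂ := by
    rw [mem_aroots]; exact ⟨hf0, hr0⟩
  specialize h r _
  · rw [mem_roots'] at hr
    rw [Polynomial.map_mul, f.map_pow]
    exact dvd_mul_of_dvd_right (pow_dvd_pow_of_dvd (dvd_iff_isRoot.mpr hr.2) _) _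
  rw [nsmul_eq_mul] at h
  have :
      (↑(eval 0 f ^ p + p * eval 0 gp') * cexp r - p * (aeval r) gp) * (p - 1)! =
      ((eval 0 f ^ p * cexp r) * (p - 1)! +
        ↑(p * (p - 1)!) * (eval 0 gp' * cexp r - (aeval r) gp)) := by
    push_cast; ring
  rw [le_div_iff₀ (Nat.cast_pos.mpr (Nat.factorial_pos _) : (0 : ℝ) < _), ← norm_natCast,
    ← norm_mul, this, Nat.mul_factorial_pred prime_p.ne_zero, mul_sub, ← h]
  have :
      ↑(eval 0 f) ^ p * cexp r * ↑(p - 1)! +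
        (↑p ! * (↑(eval 0 gp') * cexp r) - (aeval r) (sumIDeriv (X ^ (p - 1) * f ^ p))) =
      ((p - 1)! • ↑(eval 0 (f ^ p)) + p ! • ↑(eval 0 gp') : ℤ) * cexp r -
        (aeval r) (sumIDeriv (X ^ (p - 1) * f ^ p)) := by
    simp; ring
  rw [this, ← h', mul_comm, ← eq_intCast (algebraMap ℤ ℂ),
    ← aeval_algebraMap_apply_eq_algebraMap_eval, map_zero,
    aeval_sumIDeriv_eq_eval, aeval_sumIDeriv_eq_eval, ← P]
  refine (Pp'_le r p prime_p.ne_zero).trans (pow_le_pow_left₀ (c'0 r) ?_ _)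
  have : c' r ≤ C1 := Finset.single_le_sum (f := c') (fun r _ => c'0 r) (by simpa using hr)
  linarith

set_option linter.unusedSectionVars false
section alg

variable {L : Type*} [Field L] [Algebra ℚ L] [FiniteDimensional ℚ L]

/-- sum of the conjugates of `x` indexed by `S` -/
noncomputable def bS (x : L) (S : Finset (L ≃ₐ[ℚ] L)) : L := ∑ σ ∈ S, σ x

/-- coefficient attached to a subset -/
noncomputable def cS (a b : ℤ) (S : Finset (L ≃ₐ[ℚ] L)) : ℤ :=
  b ^ S.card * (-a) ^ (Fintype.card (L ≃ₐ[ℚ] L) - S.card)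

open Classical in
theorem bS_image (x : L) (τ : L ≃ₐ[ℚ] L) (S : Finset (L ≃ₐ[ℚ] L)) :
    bS x (S.image (fun σ => τ * σ)) = τ (bS x S) := by
  unfold bS
  rw [Finset.sum_image (fun _ _ _ _ h => mul_left_cancel h), map_sum]
  rfl

open Classical in
theorem cS_image (a b : ℤ) (τ : L ≃ₐ[ℚ] L) (S : Finset (L ≃ₐ[ℚ] L)) :
    cS a b (S.image (fun σ => τ * σ)) = cS a b S := by
  unfold cS
  rw [Finset.card_image_of_injective _ (mul_right_injective τ)]

open Classical in
/-- translation of subsets as a permutation -/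
noncomputable def trS (τ : L ≃ₐ[ℚ] L) : Finset (L ≃ₐ[ℚ] L) ≃ Finset (L ≃ₐ[ℚ] L) where
  toFun S := S.image (fun σ => τ * σ)
  invFun S := S.image (fun σ => τ⁻¹ * σ)
  left_inv S := by
    ext σ
    simp
  right_inv S := by
    ext σ
    simp

theorem bS_trS (x : L) (τ : L ≃ₐ[ℚ] L) (S : Finset (L ≃ₐ[ℚ] L)) :
    bS x (trS τ S) = τ (bS x S) := bS_image x τ S

theorem cS_trS (a b : ℤ) (τ : L ≃ₐ[ℚ] L) (S : Finset (L ≃ₐ[ℚ] L)) :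
    cS a b (trS τ S) = cS a b S := cS_image a b τ S

theorem exists_functional (ι : L →+* ℂ) (x : L) (hx : x ≠ 0) :
    ∃ fn : L →+ ℝ, ∀ σ : L ≃ₐ[ℚ] L, fn (σ x) ≠ 0 := by
  classical
  obtain ⟨t, ht⟩ := Infinite.exists_notMem_finset
    (Finset.univ.image (fun σ : L ≃ₐ[ℚ] L => -(ι (σ x)).re / (ι (σ x)).im))
  let fn : L →+ ℝ := (Complex.reAddGroupHom + (AddMonoidHom.mulLeft t).comp Complex.imAddGroupHom).comp
    ι.toAddMonoidHom
  refine ⟨fn, fun σ h => ?_⟩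
  have h' : (ι (σ x)).re + t * (ι (σ x)).im = 0 := h
  have hne : ι (σ x) ≠ 0 := by simpa using hx
  by_cases him : (ι (σ x)).im = 0
  · rw [him] at h'
    apply hne
    apply Complex.ext <;> simp_all
  · apply ht
    simp only [Finset.mem_image, Finset.mem_univ, true_and]
    refine ⟨σ, ?_⟩
    field_simp
    linarith

open Classical in
theorem exists_T (ι : L →+* ℂ) (x : L) (hx : x ≠ 0) (p : ℕ) (hp : p.Prime) (a b : ℤ)
    (hab : IsCoprime a b) :
    ∃ T : Finset (L ≃ₐ[ℚ] L), ¬ (p : ℤ) ∣ ∑ S with bS x S = bS x T, cS a b S := by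
  have hpp : Prime (p : ℤ) := Nat.prime_iff_prime_int.mp hp
  have hnot : ¬ ((p : ℤ) ∣ a ∧ (p : ℤ) ∣ b) := fun h =>
    hpp.not_isUnit (hab.isUnit_of_dvd' h.1 h.2)
  have split : ∀ T : Finset (L ≃ₐ[ℚ] L), ¬ (p : ℤ) ∣ cS a b T →
      (∀ S, bS x S = bS x T → S ≠ T → (p : ℤ) ∣ cS a b S) →
      ¬ (p : ℤ) ∣ ∑ S with bS x S = bS x T, cS a b S := by
    intro T h1 h2 h3
    rw [← Finset.add_sum_erase _ _ (a := T) (by simp)] at h3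
    refine h1 ((dvd_add_left (Finset.dvd_sum ?_)).mp h3)
    intro S hS
    simp only [Finset.mem_erase, Finset.mem_filter, Finset.mem_univ, true_and] at hS
    exact h2 S hS.2 hS.1
  by_cases hb : (p : ℤ) ∣ b
  · refine ⟨∅, split ∅ ?_ ?_⟩
    · intro h
      simp only [cS, Finset.card_empty, pow_zero, one_mul] at h
      have := hpp.dvd_of_dvd_pow h
      exact hnot ⟨(dvd_neg.mp this), hb⟩
    · intro S _ hS
      refine Dvd.dvd.mul_right (dvd_pow hb ?_) _
      rw [Finset.card_ne_zero]
      exact Finset.nonempty_iff_ne_empty.mpr hS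
  by_cases ha : (p : ℤ) ∣ a
  · refine ⟨Finset.univ, split _ ?_ ?_⟩
    · intro h
      simp only [cS, Finset.card_univ, tsub_self, pow_zero, mul_one] at h
      exact hb (hpp.dvd_of_dvd_pow h)
    · intro S _ hS
      refine Dvd.dvd.mul_left (dvd_pow (dvd_neg.mpr ha) ?_) _
      have := (Finset.card_lt_iff_ne_univ S).mpr hS
      omega
  · obtain ⟨fn, hfn⟩ := exists_functional ι x hx
    refine ⟨Finset.univ.filter (fun σ => 0 < fn (σ x)), split _ ?_ ?_⟩
    · intro h
      rcases hpp.dvd_or_dvd h with h | h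
      · exact hb (hpp.dvd_of_dvd_pow h)
      · exact ha (dvd_neg.mp (hpp.dvd_of_dvd_pow h))
    · intro S hS hne
      exfalso
      apply hne
      have h1 := congrArg fn hS
      simp only [bS, map_sum] at h1
      -- compare the two sums termwise
      have e1 : ∑ σ ∈ S, fn (σ x) = ∑ σ, if σ ∈ S then fn (σ x) else 0 := by simp
      rw [e1, Finset.sum_filter] at h1
      have hle : ∀ σ ∈ (Finset.univ : Finset (L ≃ₐ[ℚ] L)), (if σ ∈ S then fn (σ x) else 0) ≤
          (if 0 < fn (σ x) then fn (σ x) else 0) := by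
        intro σ _
        split_ifs <;> linarith
      have heq := (Finset.sum_eq_sum_iff_of_le hle).mp h1
      ext σ
      have h2 := heq σ (Finset.mem_univ _)
      have h3 := hfn σ
      simp only [Finset.mem_filter, Finset.mem_univ, true_and]
      split_ifs at h2 <;> simp_all

open Classical in
theorem A0_eq (x : L) (a b : ℤ) (T : Finset (L ≃ₐ[ℚ] L)) :
    ∑ τ : L ≃ₐ[ℚ] L, ∑ S with bS x S - τ (bS x T) = 0, cS a b S =
      Fintype.card (L ≃ₐ[ℚ] L) * ∑ S with bS x S = bS x T, cS a b S := by
  have : ∀ τ : L ≃ₐ[ℚ] L, ∑ S with bS x S - τ (bS x T) = 0, cS a b S =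
      ∑ S with bS x S = bS x T, cS a b S := by
    intro τ
    rw [Finset.sum_filter, Finset.sum_filter, ← Equiv.sum_comp (trS τ)]
    refine Finset.sum_congr rfl fun S _ => ?_
    simp only [bS_trS, cS_trS, sub_eq_zero, EmbeddingLike.apply_eq_iff_eq]
  simp [this]

theorem integral_aeval (y : L) (b0 : ℤ) (h : IsIntegral ℤ (b0 * y)) (g : ℤ[X]) (m : ℕ)
    (hm : g.natDegree ≤ m) : IsIntegral ℤ ((b0 : L) ^ m * aeval y g) := by
  rw [aeval_eq_sum_range' (Nat.lt_succ_of_le hm), Finset.mul_sum]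
  refine IsIntegral.sum _ fun i hi => ?_
  have hi' : i ≤ m := Nat.lt_succ_iff.mp (Finset.mem_range.mp hi)
  have : (b0 : L) ^ m * g.coeff i • y ^ i =
      ((b0 ^ (m - i) * g.coeff i : ℤ) : L) * (b0 * y) ^ i := by
    rw [zsmul_eq_mul, mul_pow]
    push_cast
    nth_rewrite 1 [← Nat.sub_add_cancel hi']
    rw [pow_add]; ring
  rw [this]
  exact IsIntegral.mul isIntegral_algebraMap (h.pow i)

theorem integral_bS (x : L) (b0 : ℤ) (h : IsIntegral ℤ (b0 * x)) (S : Finset (L ≃ₐ[ℚ] L)) :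
    IsIntegral ℤ (b0 * bS x S) := by
  unfold bS
  rw [Finset.mul_sum]
  refine IsIntegral.sum _ fun σ _ => ?_
  have := map_isIntegral_int σ h
  simpa using this

open Classical in
theorem exists_int [IsGalois ℚ L] (x : L) (b0 : ℤ) (h : IsIntegral ℤ (b0 * x)) (g : ℤ[X]) (m : ℕ)
    (hm : g.natDegree ≤ m) (a b : ℤ) (T : Finset (L ≃ₐ[ℚ] L)) :
    ∃ y : ℤ, (b0 : L) ^ m * ∑ τ : L ≃ₐ[ℚ] L, ∑ S with ¬ bS x S - τ (bS x T) = 0,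
      (cS a b S : L) * aeval (bS x S - τ (bS x T)) g = y := by
  set Y := (b0 : L) ^ m * ∑ τ : L ≃ₐ[ℚ] L, ∑ S with ¬ bS x S - τ (bS x T) = 0,
      (cS a b S : L) * aeval (bS x S - τ (bS x T)) g with hY
  have hint : IsIntegral ℤ Y := by
    rw [hY, Finset.mul_sum]
    refine IsIntegral.sum _ fun τ _ => ?_
    rw [Finset.mul_sum]
    refine IsIntegral.sum _ fun S _ => ?_
    rw [mul_left_comm]
    refine IsIntegral.mul isIntegral_algebraMap (integral_aeval _ b0 ?_ g m hm)
    rw [mul_sub]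
    refine (integral_bS x b0 h S).sub ?_
    have := map_isIntegral_int τ (integral_bS x b0 h T)
    simpa using this
  have hfix : ∀ ρ : L ≃ₐ[ℚ] L, ρ Y = Y := by
    intro ρ
    rw [hY, map_mul, map_pow, map_intCast, map_sum]
    congr 1
    conv_rhs => rw [← Equiv.sum_comp (Equiv.mulLeft ρ)]
    refine Finset.sum_congr rfl fun τ _ => ?_
    rw [map_sum, Finset.sum_filter, Finset.sum_filter]
    conv_rhs => rw [← Equiv.sum_comp (trS ρ)]
    refine Finset.sum_congr rfl fun S _ => ?_
    have e : bS x (trS ρ S) - (Equiv.mulLeft ρ τ) (bS x T) = ρ (bS x S - τ (bS x T)) := by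
      rw [bS_trS, map_sub]; rfl
    rw [e, cS_trS, map_mul, map_intCast]
    have e2 : ρ (aeval (bS x S - τ (bS x T)) g) = aeval (ρ (bS x S - τ (bS x T))) g :=
      (aeval_algHom_apply (ρ : L →+* L).toIntAlgHom _ g).symm
    rw [e2]
    simp only [EmbeddingLike.map_eq_zero_iff]
  have hbot : Y ∈ (⊥ : IntermediateField ℚ L) := (IsGalois.mem_bot_iff_fixed Y).mpr hfix
  obtain ⟨r, hr⟩ := IntermediateField.mem_bot.mp hbot
  have hr' : IsIntegral ℤ r := by
    rw [← hr] at hint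
    exact (isIntegral_algebraMap_iff (algebraMap ℚ L).injective).mp hint
  obtain ⟨y, hy⟩ := IsIntegrallyClosed.isIntegral_iff.mp hr'
  refine ⟨y, ?_⟩
  rw [← hr, ← hy]
  simp

open Classical in
theorem expand (ι : L →+* ℂ) (x : L) (a b : ℤ) (T : Finset (L ≃ₐ[ℚ] L)) :
    (∏ σ : L ≃ₐ[ℚ] L, ((b : ℂ) * exp (ι (σ x)) - a)) *
      (∑ τ : L ≃ₐ[ℚ] L, exp (-ι (τ (bS x T)))) =
    ∑ τ : L ≃ₐ[ℚ] L, ∑ S, (cS a b S : ℂ) * exp (ι (bS x S - τ (bS x T))) := by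
  have h1 : ∏ σ : L ≃ₐ[ℚ] L, ((b : ℂ) * exp (ι (σ x)) - a) =
      ∑ S, (cS a b S : ℂ) * exp (ι (bS x S)) := by
    simp only [sub_eq_add_neg]
    rw [Finset.prod_add, Finset.powerset_univ]
    refine Finset.sum_congr rfl fun S _ => ?_
    rw [Finset.prod_mul_distrib, Finset.prod_const, Finset.prod_const, ← exp_sum, bS, map_sum,
      ← Finset.compl_eq_univ_sdiff, Finset.card_compl, cS]
    push_cast
    ring
  rw [h1, Finset.mul_sum]
  refine Finset.sum_congr rfl fun τ _ => ?_
  rw [Finset.sum_mul]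
  refine Finset.sum_congr rfl fun S _ => ?_
  rw [map_sub, sub_eq_add_neg, exp_add, mul_assoc]

theorem exists_poly (Γ : Finset L) (h0 : ∀ y ∈ Γ, y ≠ 0) :
    ∃ f : ℤ[X], eval 0 f ≠ 0 ∧ ∀ y ∈ Γ, aeval y f = 0 := by
  classical
  induction Γ using Finset.induction_on with
  | empty => exact ⟨1, by simp, by simp⟩
  | insert y s hy ih =>
    obtain ⟨f, hf, hfs⟩ := ih fun z hz => h0 z (Finset.mem_insert_of_mem hz)
    have hyalg : IsAlgebraic ℤ y :=
      (IsFractionRing.isAlgebraic_iff ℤ ℚ L).mpr (Algebra.IsAlgebraic.isAlgebraic y)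
    obtain ⟨g, hg0, hg⟩ := hyalg.exists_nonzero_coeff_and_aeval_eq_zero
      (mem_nonZeroDivisors_of_ne_zero (h0 y (Finset.mem_insert_self _ _)))
    refine ⟨g * f, ?_, ?_⟩
    · rw [eval_mul, ← coeff_zero_eq_eval_zero g]
      exact mul_ne_zero hg0 hf
    · intro z hz
      rw [map_mul]
      rcases Finset.mem_insert.mp hz with rfl | hz
      · rw [hg, zero_mul]
      · rw [hfs z hz, mul_zero]

end alg
section core

variable {L : Type*} [Field L] [Algebra ℚ L] [FiniteDimensional ℚ L]

theorem cS_bound (a b : ℤ) (Q : ℝ) (ha : |(a : ℝ)| ≤ Q) (hb : |(b : ℝ)| ≤ Q)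
    (S : Finset (L ≃ₐ[ℚ] L)) : ‖(cS a b S : ℂ)‖ ≤ Q ^ Fintype.card (L ≃ₐ[ℚ] L) := by
  have hS : S.card ≤ Fintype.card (L ≃ₐ[ℚ] L) := Finset.card_le_univ S
  have hQ : 0 ≤ Q := (abs_nonneg _).trans ha
  unfold cS
  push_cast
  rw [norm_mul, norm_pow, norm_pow, norm_neg, Complex.norm_intCast, Complex.norm_intCast]
  calc |(b : ℝ)| ^ S.card * |(a : ℝ)| ^ (Fintype.card (L ≃ₐ[ℚ] L) - S.card)
      ≤ Q ^ S.card * Q ^ (Fintype.card (L ≃ₐ[ℚ] L) - S.card) := by gcongr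
    _ = _ := by rw [← pow_add, Nat.add_sub_cancel' hS]

theorem prod_bound (ι : L →+* ℂ) (x : L) (a b : ℤ) (Q : ℝ) (hQ : 1 ≤ Q)
    (ha : |(a : ℝ)| ≤ Q) (hb : |(b : ℝ)| ≤ Q) :
    ‖∏ σ : L ≃ₐ[ℚ] L, ((b : ℂ) * exp (ι (σ x)) - a)‖ ≤
      ‖(b : ℂ) * exp (ι x) - a‖ *
        (Q * (1 + ∑ σ : L ≃ₐ[ℚ] L, ‖exp (ι (σ x))‖)) ^ Fintype.card (L ≃ₐ[ℚ] L) := by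
  classical
  set M := ∑ σ : L ≃ₐ[ℚ] L, ‖exp (ι (σ x))‖ with hM
  have hM0 : 0 ≤ M := Finset.sum_nonneg fun _ _ => norm_nonneg _
  rw [norm_prod, ← Finset.mul_prod_erase _ _ (Finset.mem_univ (1 : L ≃ₐ[ℚ] L))]
  simp only [AlgEquiv.one_apply]
  refine mul_le_mul_of_nonneg_left ?_ (norm_nonneg _)
  have h1 : 1 ≤ Q * (1 + M) := by nlinarith
  calc _ ≤ ∏ σ ∈ Finset.univ.erase (1 : L ≃ₐ[ℚ] L), Q * (1 + M) := by
        refine Finset.prod_le_prod (fun _ _ => norm_nonneg _) fun σ _ => ?_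
        have h2 : ‖exp (ι (σ x))‖ ≤ M := Finset.single_le_sum
          (f := fun σ : L ≃ₐ[ℚ] L => ‖exp (ι (σ x))‖) (fun _ _ => norm_nonneg _) (Finset.mem_univ σ)
        calc _ ≤ ‖(b : ℂ) * exp (ι (σ x))‖ + ‖(a : ℂ)‖ := norm_sub_le _ _
          _ = |(b : ℝ)| * ‖exp (ι (σ x))‖ + |(a : ℝ)| := by
            rw [norm_mul, Complex.norm_intCast, Complex.norm_intCast]
          _ ≤ Q * M + Q := by gcongr
          _ = _ := by ring
    _ = (Q * (1 + M)) ^ (Finset.univ.erase (1 : L ≃ₐ[ℚ] L)).card := by rw [Finset.prod_const]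
    _ ≤ _ := pow_le_pow_right₀ h1 (Finset.card_le_univ _)

theorem core [IsGalois ℚ L] (ι : L →+* ℂ) (x : L) (hx : x ≠ 0) :
    ∃ B : ℝ, 1 ≤ B ∧ ∃ κ D P0 : ℕ, ∀ p : ℕ, p.Prime → P0 < p → ∀ (a b : ℤ) (Q : ℝ), 1 ≤ Q →
      IsCoprime a b → |(a : ℝ)| ≤ Q → |(b : ℝ)| ≤ Q →
      1 ≤ B ^ p * Q ^ D * ((p : ℝ) ^ (κ * p) * ‖(b : ℂ) * exp (ι x) - a‖ + 1 / (p - 1)!) := by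
  classical
  -- the finite set of exponents and the polynomial
  obtain ⟨f, hf0, hf⟩ := exists_poly
    ((Finset.univ.image (fun t : Finset (L ≃ₐ[ℚ] L) × (L ≃ₐ[ℚ] L) × Finset (L ≃ₐ[ℚ] L) =>
      bS x t.1 - t.2.1 (bS x t.2.2))).erase 0) (fun y hy => (Finset.mem_erase.mp hy).1)
  have hroot : ∀ S T (τ : L ≃ₐ[ℚ] L), bS x S - τ (bS x T) ≠ 0 →
      aeval (ι (bS x S - τ (bS x T))) f = 0 := by
    intro S T τ h
    have h1 := hf (bS x S - τ (bS x T)) (Finset.mem_erase.mpr ⟨h, Finset.mem_image.mpr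
      ⟨(S, τ, T), Finset.mem_univ _, rfl⟩⟩)
    have h2 := aeval_algHom_apply ι.toIntAlgHom (bS x S - τ (bS x T)) f
    rw [h1, map_zero] at h2
    exact h2
  obtain ⟨c, hc1, hc⟩ := hermite f hf0
  have hxalg : IsAlgebraic ℤ x :=
    (IsFractionRing.isAlgebraic_iff ℤ ℚ L).mpr (Algebra.IsAlgebraic.isAlgebraic x)
  obtain ⟨b0, hb0, hb0x⟩ := hxalg.exists_integral_multiple
  rw [zsmul_eq_mul] at hb0x
  set D := Fintype.card (L ≃ₐ[ℚ] L) with hD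
  have hDpos : 0 < D := Fintype.card_pos
  set M := ∑ σ : L ≃ₐ[ℚ] L, ‖exp (ι (σ x))‖ with hM
  have hM0 : 0 ≤ M := Finset.sum_nonneg fun _ _ => norm_nonneg _
  set K := ∑ T : Finset (L ≃ₐ[ℚ] L), ∑ τ : L ≃ₐ[ℚ] L, ‖exp (-ι (τ (bS x T)))‖ with hK
  have hK0 : 0 ≤ K := Finset.sum_nonneg fun _ _ => Finset.sum_nonneg fun _ _ => norm_nonneg _
  set W : ℝ := 1 + (1 + M) ^ D * K + D * 2 ^ D with hW
  have hW1 : 1 ≤ W := by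
    have : 0 ≤ (1 + M) ^ D * K := by positivity
    have : (0 : ℝ) ≤ D * 2 ^ D := by positivity
    linarith
  have hb0r : (1 : ℝ) ≤ |(b0 : ℝ)| := by exact_mod_cast Int.one_le_abs hb0
  have hb0d : 1 ≤ |(b0 : ℝ)| ^ f.natDegree := one_le_pow₀ hb0r
  refine ⟨|(b0 : ℝ)| ^ f.natDegree * c * W, ?_, f.natDegree + 1, D,
    (eval 0 f).natAbs + b0.natAbs + D, ?_⟩
  · exact one_le_mul_of_one_le_of_one_le (one_le_mul_of_one_le_of_one_le hb0d hc1) hW1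
  intro p hp hpP a b Q hQ hab haQ hbQ
  have hpp : Prime (p : ℤ) := Nat.prime_iff_prime_int.mp hp
  obtain ⟨N, hpN, hNle, g, hgdeg, hg⟩ := hc p (by omega) hp
  obtain ⟨T, hT⟩ := exists_T ι x hx p hp a b hab
  obtain ⟨y, hy⟩ := exists_int x b0 hb0x g (p * f.natDegree) hgdeg a b T
  set err : ℝ := c ^ p / (p - 1)! with herr
  have herr0 : 0 ≤ err := by positivity
  set A0 : ℤ := ∑ τ : L ≃ₐ[ℚ] L, ∑ S with bS x S - τ (bS x T) = 0, cS a b S with hA0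
  set m := p * f.natDegree with hm
  -- the integer
  set z : ℤ := b0 ^ m * N * A0 + p * y with hz
  have hzne : z ≠ 0 := by
    intro h
    have h1 : (p : ℤ) ∣ b0 ^ m * N * A0 := by
      rw [← dvd_add_left (dvd_mul_right (p : ℤ) y), ← hz, h]
      exact dvd_zero _
    rcases hpp.dvd_or_dvd h1 with h1 | h1
    · rcases hpp.dvd_or_dvd h1 with h1 | h1
      · have h2 := hpp.dvd_of_dvd_pow h1
        have h3 := Nat.le_of_dvd (Int.natAbs_pos.mpr hb0) (Int.natCast_dvd.mp h2)
        omega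
      · exact hpN h1
    · rw [hA0, A0_eq] at h1
      rcases hpp.dvd_or_dvd h1 with h1 | h1
      · have h3 := Nat.le_of_dvd hDpos (Int.natCast_dvd_natCast.mp h1)
        omega
      · exact hT h1
  have hz1 : (1 : ℝ) ≤ ‖(z : ℂ)‖ := by
    rw [Complex.norm_intCast]
    exact_mod_cast Int.one_le_abs hzne
  set J : ℂ := ∑ τ : L ≃ₐ[ℚ] L, ∑ S, (cS a b S : ℂ) *
    (if bS x S - τ (bS x T) = 0 then (N : ℂ) else p * aeval (ι (bS x S - τ (bS x T))) g) with hJ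
  have hzJ : (z : ℂ) = (b0 : ℂ) ^ m * J := by
    have h1 : J = (N : ℂ) * A0 + p * ι (∑ τ : L ≃ₐ[ℚ] L, ∑ S with ¬ bS x S - τ (bS x T) = 0,
        (cS a b S : L) * aeval (bS x S - τ (bS x T)) g) := by
      rw [hJ, hA0, map_sum]
      push_cast
      rw [Finset.mul_sum, Finset.mul_sum, ← Finset.sum_add_distrib]
      refine Finset.sum_congr rfl fun τ _ => ?_
      rw [← Finset.sum_filter_add_sum_filter_not Finset.univ (fun S => bS x S - τ (bS x T) = 0)]
      rw [map_sum, Finset.mul_sum, Finset.mul_sum]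
      congr 1
      · refine Finset.sum_congr rfl fun S hS => ?_
        rw [if_pos (Finset.mem_filter.mp hS).2, mul_comm]
      · refine Finset.sum_congr rfl fun S hS => ?_
        rw [if_neg (Finset.mem_filter.mp hS).2, map_mul, map_intCast]
        have h2 : aeval (ι (bS x S - τ (bS x T))) g = ι (aeval (bS x S - τ (bS x T)) g) :=
          aeval_algHom_apply ι.toIntAlgHom (bS x S - τ (bS x T)) g
        rw [h2]; ring
    have h2 := congrArg ι hy
    rw [map_mul, map_pow, map_intCast, map_intCast] at h2
    rw [h1, hz]
    push_cast
    rw [← h2]; ring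
  set E : ℂ := (∏ σ : L ≃ₐ[ℚ] L, ((b : ℂ) * exp (ι (σ x)) - a)) *
      (∑ τ : L ≃ₐ[ℚ] L, exp (-ι (τ (bS x T)))) with hE
  have hEle : ‖E‖ ≤ ‖(b : ℂ) * exp (ι x) - a‖ * (Q * (1 + M)) ^ D * K := by
    rw [hE, norm_mul]
    refine mul_le_mul (prod_bound ι x a b Q hQ haQ hbQ) ?_ (norm_nonneg _) (by positivity)
    refine (norm_sum_le _ _).trans ?_
    exact Finset.single_le_sum (f := fun T : Finset (L ≃ₐ[ℚ] L) =>
      ∑ τ : L ≃ₐ[ℚ] L, ‖exp (-ι (τ (bS x T)))‖)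
      (fun _ _ => Finset.sum_nonneg fun _ _ => norm_nonneg _) (Finset.mem_univ T)
  have hNEJ : ‖(N : ℂ) * E - J‖ ≤ D * 2 ^ D * Q ^ D * err := by
    rw [hE, expand, hJ, Finset.mul_sum, ← Finset.sum_sub_distrib]
    refine (norm_sum_le _ _).trans ?_
    have h1 : ∀ τ ∈ (Finset.univ : Finset (L ≃ₐ[ℚ] L)),
        ‖(N : ℂ) * ∑ S, (cS a b S : ℂ) * exp (ι (bS x S - τ (bS x T))) -
          ∑ S, (cS a b S : ℂ) * (if bS x S - τ (bS x T) = 0 then (N : ℂ) else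
            p * aeval (ι (bS x S - τ (bS x T))) g)‖ ≤ 2 ^ D * (Q ^ D * err) := by
      intro τ _
      rw [Finset.mul_sum, ← Finset.sum_sub_distrib]
      refine (norm_sum_le _ _).trans ?_
      have h2 : ∀ S ∈ (Finset.univ : Finset (Finset (L ≃ₐ[ℚ] L))),
          ‖(N : ℂ) * ((cS a b S : ℂ) * exp (ι (bS x S - τ (bS x T)))) -
            (cS a b S : ℂ) * (if bS x S - τ (bS x T) = 0 then (N : ℂ) else
              p * aeval (ι (bS x S - τ (bS x T))) g)‖ ≤ Q ^ D * err := by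
        intro S _
        have e : (N : ℂ) * ((cS a b S : ℂ) * exp (ι (bS x S - τ (bS x T)))) -
            (cS a b S : ℂ) * (if bS x S - τ (bS x T) = 0 then (N : ℂ) else
              p * aeval (ι (bS x S - τ (bS x T))) g) =
            (cS a b S : ℂ) * (N * exp (ι (bS x S - τ (bS x T))) -
              (if bS x S - τ (bS x T) = 0 then (N : ℂ) else
              p * aeval (ι (bS x S - τ (bS x T))) g)) := by ring
        rw [e, norm_mul]
        refine mul_le_mul (cS_bound a b Q haQ hbQ S) ?_ (norm_nonneg _) (by positivity)
        split_ifs with h0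
        · rw [h0]; simpa using herr0
        · exact hg _ (hroot S T τ h0)
      refine (Finset.sum_le_sum h2).trans ?_
      rw [Finset.sum_const, Finset.card_univ, Fintype.card_finset, nsmul_eq_mul]
      push_cast
      exact le_rfl
    refine (Finset.sum_le_sum h1).trans ?_
    rw [Finset.sum_const, Finset.card_univ, nsmul_eq_mul]
    apply le_of_eq
    ring
  set δ := ‖(b : ℂ) * exp (ι x) - a‖ with hδ
  have hδ0 : 0 ≤ δ := norm_nonneg _
  have hJle : ‖J‖ ≤ c ^ p * (p : ℝ) ^ ((f.natDegree + 1) * p) * (δ * (Q * (1 + M)) ^ D * K) +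
      D * 2 ^ D * Q ^ D * err := by
    have h1 : J = N * E - (N * E - J) := by ring
    rw [h1]
    refine (norm_sub_le _ _).trans (add_le_add ?_ hNEJ)
    rw [norm_mul, Complex.norm_intCast]
    exact mul_le_mul hNle hEle (norm_nonneg _) (by positivity)
  have hU : ‖(b0 : ℂ) ^ m‖ = (|(b0 : ℝ)| ^ f.natDegree) ^ p := by
    rw [norm_pow, Complex.norm_intCast, hm, mul_comm, pow_mul]
  rw [hzJ, norm_mul, hU] at hz1
  refine hz1.trans ?_
  have hWp : W ≤ W ^ p := le_self_pow₀ hW1 hp.ne_zero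
  set u := (|(b0 : ℝ)| ^ f.natDegree) ^ p with hu
  have hu0 : 0 ≤ u := by positivity
  have hQD : 0 ≤ Q ^ D := by positivity
  have hW_a : (1 + M) ^ D * K ≤ W := by
    have : (0 : ℝ) ≤ D * 2 ^ D := by positivity
    linarith
  have hW_b : (D : ℝ) * 2 ^ D ≤ W := by
    have : 0 ≤ (1 + M) ^ D * K := by positivity
    linarith
  have hcp : 0 ≤ c ^ p := by positivity
  have hpk : 0 ≤ (p : ℝ) ^ ((f.natDegree + 1) * p) := by positivity
  calc u * ‖J‖ ≤ u * (c ^ p * (p : ℝ) ^ ((f.natDegree + 1) * p) * (δ * (Q * (1 + M)) ^ D * K) +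
      D * 2 ^ D * Q ^ D * err) := by gcongr
    _ = u * (c ^ p * Q ^ D * ((p : ℝ) ^ ((f.natDegree + 1) * p) * δ * ((1 + M) ^ D * K) +
        (1 / (p - 1)!) * (D * 2 ^ D))) := by
      rw [herr, mul_pow]; ring
    _ ≤ u * (c ^ p * Q ^ D * ((p : ℝ) ^ ((f.natDegree + 1) * p) * δ * W ^ p +
        (1 / (p - 1)!) * W ^ p)) := by
      gcongr
      · exact hW_a.trans hWp
      · exact hW_b.trans hWp
    _ = _ := by rw [mul_pow, mul_pow, hu]; ring

end core
theorem ev_fact (A c : ℝ) : ∀ᶠ n : ℕ in Filter.atTop, A * c ^ n ≤ (n ! : ℝ) := by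
  have h := (FloorSemiring.tendsto_pow_div_factorial_atTop c).const_mul A
  rw [mul_zero] at h
  filter_upwards [h.eventually (gt_mem_nhds one_pos)] with n hn
  have hpos : (0 : ℝ) < n ! := by exact_mod_cast Nat.factorial_pos n
  rw [← mul_div_assoc, div_lt_one hpos] at hn
  exact hn.le

theorem ev_pow : ∀ᶠ s : ℕ in Filter.atTop,
    (4 * ((s + 1 : ℕ) : ℝ)) ^ (s + 1) ≤ (s ! : ℝ) ^ 2 := by
  filter_upwards [ev_fact (8 * Real.exp 1) (8 * Real.exp 1)] with s hs
  have h1 := Real.pow_div_factorial_le_exp ((s + 1 : ℕ) : ℝ) (by positivity) (s + 1)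
  have hpos : (0 : ℝ) < (s + 1)! := by exact_mod_cast Nat.factorial_pos _
  rw [div_le_iff₀ hpos] at h1
  have h2 : Real.exp ((s + 1 : ℕ) : ℝ) = Real.exp 1 ^ (s + 1) := by
    rw [← Real.exp_nat_mul, mul_one]
  rw [h2, Nat.factorial_succ] at h1
  have h3 : ((s + 1 : ℕ) : ℝ) ≤ 2 ^ (s + 1) := by
    exact_mod_cast (Nat.lt_two_pow_self (n := s + 1)).le
  have hs0 : (0 : ℝ) ≤ s ! := by positivity
  have he := Real.exp_pos 1
  calc (4 * ((s + 1 : ℕ) : ℝ)) ^ (s + 1) = 4 ^ (s + 1) * ((s + 1 : ℕ) : ℝ) ^ (s + 1) := mul_pow _ _ _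
    _ ≤ 4 ^ (s + 1) * (Real.exp 1 ^ (s + 1) * (((s + 1) * s ! : ℕ) : ℝ)) := by gcongr
    _ = 4 ^ (s + 1) * (Real.exp 1 ^ (s + 1) * (((s + 1 : ℕ) : ℝ) * s !)) := by push_cast; ring
    _ ≤ 4 ^ (s + 1) * (Real.exp 1 ^ (s + 1) * (2 ^ (s + 1) * s !)) := by gcongr
    _ = (8 * Real.exp 1 * (8 * Real.exp 1) ^ s) * s ! := by
      rw [← pow_succ', mul_pow, show (8 : ℝ) = 4 * 2 by norm_num, mul_pow]; ring
    _ ≤ s ! * s ! := by gcongr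
    _ = _ := by ring

theorem exists_prime (B : ℝ) (hB : 1 ≤ B) (κ E P0 : ℕ) (hE : 1 ≤ E) :
    ∀ᶠ q : ℕ in Filter.atTop, ∃ p : ℕ, p.Prime ∧ P0 < p ∧
      B ^ p * (q : ℝ) ^ E * (1 / (p - 1)!) ≤ 1 / 2 ∧
      B ^ p * (p : ℝ) ^ (κ * p) ≤ (q : ℝ) ^ (E + 8 * E * κ) := by
  obtain ⟨s0, hs0⟩ := Filter.eventually_atTop.mp
    ((ev_fact (2 * B ^ 4) (B ^ 4)).and (ev_pow.and (Filter.eventually_ge_atTop P0)))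
  filter_upwards [Filter.eventually_ge_atTop ((s0 + 1)!)] with q hq
  have hex : ∃ m : ℕ, q ^ E < m ! := ⟨q ^ E + 1, Nat.lt_of_lt_of_le (Nat.lt_succ_self _)
    (Nat.self_le_factorial _)⟩
  have hq1 : 1 ≤ q := (Nat.factorial_pos _).trans_le hq
  classical
  set m := Nat.find hex with hm
  have hm1 : q ^ E < m ! := Nat.find_spec hex
  have hms : s0 + 1 < m := by
    by_contra hcon
    have h1 : m ! ≤ (s0 + 1)! := Nat.factorial_le (by omega)
    have h2 : q ≤ q ^ E := Nat.le_self_pow (by omega) q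
    omega
  obtain ⟨s, hs⟩ : ∃ s, m = s + 1 := ⟨m - 1, by omega⟩
  have hsq : s ! ≤ q ^ E := by
    have := Nat.find_min hex (m := s) (by omega)
    omega
  obtain ⟨h1, h2, h3⟩ := hs0 s (by omega)
  obtain ⟨p, hp, hp1, hp2⟩ := Nat.exists_prime_lt_and_le_two_mul (2 * m) (by omega)
  have hp3 : p ≤ 4 * (s + 1) := by omega
  have hsq' : (s ! : ℝ) ≤ (q : ℝ) ^ E := by exact_mod_cast hsq
  have hB4 : 2 * B ^ (4 * (s + 1)) ≤ (s ! : ℝ) := by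
    refine le_trans (le_of_eq ?_) h1
    rw [pow_mul B 4 (s + 1), pow_succ']; ring
  have hB0 : 0 ≤ B ^ (4 * (s + 1)) := by positivity
  have hBp : B ^ p ≤ B ^ (4 * (s + 1)) := pow_le_pow_right₀ hB hp3
  refine ⟨p, hp, by omega, ?_, ?_⟩
  · have hf1 : m ! * m ! ≤ (p - 1)! := by
      have ha : m ! * m ! ≤ (m + m)! :=
        Nat.le_of_dvd (Nat.factorial_pos _) (Nat.factorial_mul_factorial_dvd_factorial_add m m)
      exact ha.trans (Nat.factorial_le (by omega))
    have hf2 : (m ! : ℝ) * m ! ≤ ((p - 1)! : ℝ) := by exact_mod_cast hf1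
    have hm2 : (q : ℝ) ^ E ≤ m ! := by exact_mod_cast hm1.le
    have hm3 : (s ! : ℝ) ≤ m ! := by exact_mod_cast Nat.factorial_le (by omega)
    have hpos : (0 : ℝ) < (p - 1)! := by exact_mod_cast Nat.factorial_pos _
    rw [mul_one_div, div_le_iff₀ hpos]
    have hm4 : (0 : ℝ) ≤ m ! := by positivity
    calc B ^ p * (q : ℝ) ^ E ≤ (1 / 2 * m !) * m ! := by
          refine mul_le_mul ?_ hm2 (by positivity) (by positivity)
          linarith
      _ ≤ _ := by linarith
  · have hq0 : (1 : ℝ) ≤ q := by exact_mod_cast hq1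
    have hp1' : (1 : ℝ) ≤ p := by exact_mod_cast hp.one_le
    have hpr : (p : ℝ) ≤ 4 * ((s + 1 : ℕ) : ℝ) := by exact_mod_cast hp3
    have hpp : (p : ℝ) ^ (κ * p) ≤ ((q : ℝ) ^ E) ^ (8 * κ) := by
      calc (p : ℝ) ^ (κ * p) ≤ (p : ℝ) ^ (κ * (4 * (s + 1))) :=
            pow_le_pow_right₀ hp1' (Nat.mul_le_mul_left _ hp3)
        _ ≤ (4 * ((s + 1 : ℕ) : ℝ)) ^ (κ * (4 * (s + 1))) := by gcongr
        _ = ((4 * ((s + 1 : ℕ) : ℝ)) ^ (s + 1)) ^ (4 * κ) := by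
          rw [← pow_mul]; congr 1; ring
        _ ≤ ((s ! : ℝ) ^ 2) ^ (4 * κ) := by gcongr
        _ = (s ! : ℝ) ^ (8 * κ) := by rw [← pow_mul]; congr 1; ring
        _ ≤ _ := by gcongr
    calc B ^ p * (p : ℝ) ^ (κ * p) ≤ (q : ℝ) ^ E * ((q : ℝ) ^ E) ^ (8 * κ) := by
          refine mul_le_mul ?_ hpp (by positivity) (by positivity)
          linarith
      _ = _ := by rw [← pow_mul, ← pow_add]; congr 1; ring

theorem final (α : ℝ) (hpos : 0 < α) (h : Liouville α) (B : ℝ) (hB : 1 ≤ B) (κ D P0 : ℕ)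
    (H : ∀ p : ℕ, p.Prime → P0 < p → ∀ (a b : ℤ) (Q : ℝ), 1 ≤ Q →
      IsCoprime a b → |(a : ℝ)| ≤ Q → |(b : ℝ)| ≤ Q →
      1 ≤ B ^ p * Q ^ D * ((p : ℝ) ^ (κ * p) * |(b : ℝ) * α - a| + 1 / (p - 1)!)) : False := by
  set E := 2 * D + 1 with hE
  obtain ⟨q, ⟨⟨a, -, ha⟩, ⟨p, hp, hpP, h1, h2⟩, hq3, hqα⟩⟩ :=
    ((h.frequently_exists_num (E + 8 * E * κ + E + 1)).and_eventually
      ((exists_prime B hB κ E P0 (by omega)).and ((Filter.eventually_ge_atTop 3).and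
        (Filter.eventually_ge_atTop ⌈α + 1⌉₊)))).exists
  have hq3r : (3 : ℝ) ≤ q := by exact_mod_cast hq3
  have hqα' : α + 1 ≤ q := (Nat.le_ceil _).trans (by exact_mod_cast hqα)
  have hq0 : (0 : ℝ) < q := by linarith
  set k := E + 8 * E * κ + E + 1 with hk
  set r : ℚ := (a : ℚ) / (q : ℤ) with hr
  have hqz : (q : ℤ) ≠ 0 := by omega
  have hden : (r.den : ℝ) ≤ q := by
    have := Rat.den_dvd a q
    rw [← Rat.divInt_eq_div] at hr
    rw [← hr] at this
    have h5 := Nat.le_of_dvd (by omega) (Int.natCast_dvd_natCast.mp this)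
    exact_mod_cast h5
  have hrr : (r : ℝ) = a / q := by rw [hr]; push_cast; rfl
  have hden0 : (0 : ℝ) < r.den := by exact_mod_cast r.pos
  have hnum : (r.num : ℝ) = r * r.den := by
    have := Rat.mul_den_eq_num r
    exact_mod_cast this.symm
  rw [← hrr] at ha
  have hqk : (1 : ℝ) ≤ (q : ℝ) ^ k := one_le_pow₀ (by linarith)
  have hr1 : |(r : ℝ)| ≤ α + 1 := by
    have : 1 / (q : ℝ) ^ k ≤ 1 := by rw [div_le_one (by positivity)]; exact hqk
    have h4 := abs_lt.mp (ha.trans_le this)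
    rw [abs_le]; constructor <;> linarith
  have hnum2 : |(r.num : ℝ)| ≤ (q : ℝ) ^ 2 := by
    rw [hnum, abs_mul, abs_of_pos hden0, sq]
    exact mul_le_mul (hr1.trans hqα') hden hden0.le hq0.le
  have hden2 : |((r.den : ℤ) : ℝ)| ≤ (q : ℝ) ^ 2 := by
    rw [Int.cast_natCast, abs_of_pos hden0]
    nlinarith
  have key := H p hp hpP r.num r.den ((q : ℝ) ^ 2) (by nlinarith)
    (Int.isCoprime_iff_gcd_eq_one.mpr (by simpa [Int.gcd] using! r.reduced)) hnum2 hden2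
  have hδ : |((r.den : ℤ) : ℝ) * α - r.num| ≤ q * (1 / (q : ℝ) ^ k) := by
    have e : ((r.den : ℤ) : ℝ) * α - r.num = r.den * (α - r) := by
      rw [hnum]; push_cast; ring
    rw [e, abs_mul, abs_of_pos hden0]
    exact mul_le_mul hden ha.le (abs_nonneg _) hq0.le
  have hQD : ((q : ℝ) ^ 2) ^ D * q = (q : ℝ) ^ E := by
    rw [← pow_mul, ← pow_succ]
  have hQD' : ((q : ℝ) ^ 2) ^ D ≤ (q : ℝ) ^ E := by
    rw [← pow_mul]; exact pow_le_pow_right₀ (by linarith) (by omega)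
  have t1 : B ^ p * ((q : ℝ) ^ 2) ^ D * ((p : ℝ) ^ (κ * p) * |((r.den : ℤ) : ℝ) * α - r.num|) ≤
      1 / 3 := by
    calc _ ≤ B ^ p * ((q : ℝ) ^ 2) ^ D * ((p : ℝ) ^ (κ * p) * (q * (1 / (q : ℝ) ^ k))) := by gcongr
      _ = (B ^ p * (p : ℝ) ^ (κ * p)) * (((q : ℝ) ^ 2) ^ D * q) * (1 / (q : ℝ) ^ k) := by ring
      _ ≤ (q : ℝ) ^ (E + 8 * E * κ) * (q : ℝ) ^ E * (1 / (q : ℝ) ^ k) := by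
        rw [hQD]; gcongr
      _ = 1 / q := by
        rw [hk, pow_succ _ (E + 8 * E * κ + E), pow_add _ (E + 8 * E * κ) E]; field_simp
      _ ≤ 1 / 3 := by gcongr
  have t2 : B ^ p * ((q : ℝ) ^ 2) ^ D * (1 / (p - 1)!) ≤ 1 / 2 := by
    refine le_trans ?_ h1
    gcongr
  rw [mul_add] at key
  linarith

end LLT

theorem liouville_log_transcendental (α : ℝ) (h : Liouville α) (hpos : 0 < α) :
    Transcendental ℚ (Real.log α) := by
  intro halg
  have hc : IsAlgebraic ℚ ((Real.log α : ℝ) : ℂ) := halg.algebraMap (A := ℂ)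
  have hne : ((Real.log α : ℝ) : ℂ) ≠ 0 := by
    intro h0
    have h0' : Real.log α = 0 := by exact_mod_cast h0
    have h1 : α = 1 := by
      rw [← Real.exp_log hpos, h0', Real.exp_zero]
    exact h.irrational ⟨1, by simp [h1]⟩
  let f := minpoly ℚ ((Real.log α : ℝ) : ℂ)
  have hirr : Irreducible f := minpoly.irreducible hc.isIntegral
  let L := IntermediateField.adjoin ℚ (f.rootSet ℂ)
  have hsf : f.IsSplittingField ℚ L :=
    IntermediateField.adjoin_rootSet_isSplittingField (IsAlgClosed.splits _)
  haveI : FiniteDimensional ℚ L := Polynomial.IsSplittingField.finiteDimensional L f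
  haveI : IsGalois ℚ L := IsGalois.of_separable_splitting_field hirr.separable
  have hmem : ((Real.log α : ℝ) : ℂ) ∈ L := by
    apply IntermediateField.subset_adjoin
    rw [Polynomial.mem_rootSet]
    exact ⟨hirr.ne_zero, minpoly.aeval _ _⟩
  obtain ⟨B, hB, κ, D, P0, H⟩ := LLT.core (L := L) (L.val : L →+* ℂ)
    ⟨((Real.log α : ℝ) : ℂ), hmem⟩ (by simpa [Subtype.ext_iff] using hne)
  refine LLT.final α hpos h B hB κ D P0 ?_
  intro p hp hpP a b Q hQ hab ha hb
  have := H p hp hpP a b Q hQ hab ha hb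
  have e : ‖(b : ℂ) * Complex.exp ((L.val : L →+* ℂ) ⟨((Real.log α : ℝ) : ℂ), hmem⟩) - a‖ =
      |(b : ℝ) * α - a| := by
    have e1 : (L.val : L →+* ℂ) ⟨((Real.log α : ℝ) : ℂ), hmem⟩ = ((Real.log α : ℝ) : ℂ) := rfl
    rw [e1, ← Complex.ofReal_exp, Real.exp_log hpos, ← Real.norm_eq_abs, ← Complex.norm_real]
    push_cast
    rfl
  rw [e] at this
  exact this
end

section
/- If α is a Liouville number, then sin α is transcendental. -/
namespace LSin
open Polynomial
open Finset hiding mem_antidiagonal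

/-- Product of `(X - l)^(μ l)` over `l ≤ N`. -/
noncomputable def W (μ : ℕ → ℕ) (N : ℕ) : ℂ[X] :=
  ∏ l ∈ range (N + 1), (X - C (l : ℂ)) ^ μ l

noncomputable def g (μ : ℕ → ℕ) (N k : ℕ) : ℂ[X] :=
  ∏ l ∈ (range (N + 1)).erase k, (X - C (l : ℂ)) ^ μ l

/-- Inverse of `c + X` as a power series. -/
noncomputable def e (c : ℂ) : PowerSeries ℂ := PowerSeries.mk fun i => c⁻¹ * (-c⁻¹) ^ i

noncomputable def iv (μ : ℕ → ℕ) (N k : ℕ) : PowerSeries ℂ :=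
  ∏ l ∈ (range (N + 1)).erase k, e ((k : ℂ) - l) ^ μ l

lemma e_mul (c : ℂ) (hc : c ≠ 0) : (PowerSeries.X + PowerSeries.C c) * e c = 1 := by
  ext n
  rw [add_mul, map_add, PowerSeries.coeff_C_mul]
  cases n with
  | zero => simp [e, hc]
  | succ n =>
    rw [mul_comm, PowerSeries.coeff_succ_mul_X]
    simp only [e, PowerSeries.coeff_mk, PowerSeries.coeff_one, Nat.succ_ne_zero, if_false]
    rw [mul_inv_cancel_left₀ hc, pow_succ]
    ring

lemma taylor_g_mul (μ : ℕ → ℕ) (N k : ℕ) :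
    ((taylor (k : ℂ) (g μ N k) : ℂ[X]) : PowerSeries ℂ) * iv μ N k = 1 := by
  have h1 : taylor (k : ℂ) (g μ N k) =
      ∏ l ∈ (range (N + 1)).erase k, (X + C ((k : ℂ) - l)) ^ μ l := by
    simp only [g, taylor_apply, Polynomial.prod_comp, pow_comp, sub_comp, X_comp, C_comp]
    refine Finset.prod_congr rfl fun l _ => ?_
    congr 1
    rw [C_sub]; ring
  rw [h1, iv]
  rw [← Polynomial.coeToPowerSeries.ringHom_apply, map_prod, ← Finset.prod_mul_distrib]
  refine Finset.prod_eq_one fun l hl => ?_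
  rw [map_pow, ← mul_pow, map_add]
  have := e_mul ((k : ℂ) - l) (by
    rw [sub_ne_zero]; have := (Finset.mem_erase.1 hl).1; exact_mod_cast this.symm)
  simp only [coeToPowerSeries.ringHom_apply, coe_X, coe_C]
  rw [this, one_pow]

lemma dvd_iff_taylor (k : ℂ) (n : ℕ) (p : ℂ[X]) :
    (X - C k) ^ n ∣ p ↔ ∀ j < n, (taylor k p).coeff j = 0 := by
  rw [X_sub_C_pow_dvd_iff, X_pow_dvd_iff, taylor_apply]

lemma dvd_W (μ : ℕ → ℕ) (N : ℕ) (p : ℂ[X])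
    (h : ∀ k ≤ N, (X - C (k : ℂ)) ^ μ k ∣ p) : W μ N ∣ p := by
  refine Finset.prod_dvd_of_coprime ?_ ?_
  · intro a _ b _ hab
    refine IsCoprime.pow ?_
    apply isCoprime_X_sub_C_of_isUnit_sub
    exact (sub_ne_zero.2 (by exact_mod_cast hab)).isUnit
  · intro k hk; exact h k (by simpa [Nat.lt_succ_iff] using hk)

lemma W_monic (μ : ℕ → ℕ) (N : ℕ) : (W μ N).Monic :=
  monic_prod_of_monic _ _ fun _ _ => (monic_X_sub_C _).pow _

lemma g_monic (μ : ℕ → ℕ) (N k : ℕ) : (g μ N k).Monic :=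
  monic_prod_of_monic _ _ fun _ _ => (monic_X_sub_C _).pow _

lemma W_natDegree (μ : ℕ → ℕ) (N : ℕ) : (W μ N).natDegree = ∑ l ∈ range (N + 1), μ l := by
  rw [W, natDegree_prod_of_monic _ _ fun _ _ => (monic_X_sub_C _).pow _]
  refine Finset.sum_congr rfl fun l _ => ?_
  rw [(monic_X_sub_C _).natDegree_pow, natDegree_X_sub_C, mul_one]

lemma W_eq (μ : ℕ → ℕ) (N k : ℕ) (hk : k ≤ N) :
    W μ N = (X - C (k : ℂ)) ^ μ k * g μ N k :=
  (Finset.mul_prod_erase _ _ (by simpa [Nat.lt_succ_iff] using hk)).symm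

lemma g_natDegree (μ : ℕ → ℕ) (N k : ℕ) (hk : k ≤ N) :
    μ k + (g μ N k).natDegree = (W μ N).natDegree := by
  rw [W_eq μ N k hk, ((monic_X_sub_C _).pow _).natDegree_mul (g_monic _ _ _),
    (monic_X_sub_C _).natDegree_pow, natDegree_X_sub_C, mul_one]

/-- uniqueness -/
lemma eq_zero_of_jets (μ : ℕ → ℕ) (N : ℕ) (p : ℂ[X]) (hd : p.degree < (W μ N).degree)
    (h : ∀ k ≤ N, (X - C (k : ℂ)) ^ μ k ∣ p) : p = 0 :=
  eq_zero_of_dvd_of_degree_lt (dvd_W μ N p h) hd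

noncomputable def tr (μ : ℕ → ℕ) (N : ℕ) (F : ℕ → PowerSeries ℂ) (k : ℕ) : ℂ[X] :=
  PowerSeries.trunc (μ k) (iv μ N k * F k)

/-- The Hermite interpolant. -/
noncomputable def P (μ : ℕ → ℕ) (N : ℕ) (F : ℕ → PowerSeries ℂ) : ℂ[X] :=
  ∑ k ∈ range (N + 1), g μ N k * taylor (-(k : ℂ)) (tr μ N F k)

lemma tr_deg (μ : ℕ → ℕ) (N : ℕ) (F : ℕ → PowerSeries ℂ) (k : ℕ) :
    (taylor (-(k : ℂ)) (tr μ N F k)).degree < μ k := by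
  rw [degree_taylor]; exact PowerSeries.degree_trunc_lt _ _

lemma P_degree (μ : ℕ → ℕ) (N : ℕ) (F : ℕ → PowerSeries ℂ) :
    (P μ N F).degree < (W μ N).degree := by
  rw [P]
  refine (degree_sum_le _ _).trans_lt ?_
  rw [Finset.sup_lt_iff]
  · intro k hk
    have hk' : k ≤ N := by simpa [Nat.lt_succ_iff] using hk
    have := g_natDegree μ N k hk'
    rw [degree_mul, degree_eq_natDegree (g_monic _ _ _).ne_zero,
      degree_eq_natDegree (W_monic _ _).ne_zero, ← this]
    push_cast
    rw [add_comm]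
    exact WithBot.add_lt_add_right (by simp) (tr_deg _ _ _ _)
  · rw [degree_eq_natDegree (W_monic _ _).ne_zero]; exact WithBot.bot_lt_coe _

lemma P_jets (μ : ℕ → ℕ) (N : ℕ) (F : ℕ → PowerSeries ℂ) (k : ℕ) (hk : k ≤ N) (j : ℕ)
    (hj : j < μ k) : (taylor (k : ℂ) (P μ N F)).coeff j = PowerSeries.coeff j (F k) := by
  have hk' : k ∈ range (N + 1) := by simpa [Nat.lt_succ_iff] using hk
  rw [P, ← Finset.add_sum_erase _ _ hk', map_add, coeff_add]
  have h0 : (taylor (k : ℂ) (∑ l ∈ (range (N + 1)).erase k,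
      g μ N l * taylor (-(l : ℂ)) (tr μ N F l))).coeff j = 0 := by
    refine (dvd_iff_taylor (k : ℂ) (μ k) _).1 ?_ j hj
    refine Finset.dvd_sum fun l hl => Dvd.dvd.mul_right ?_ _
    exact Finset.dvd_prod_of_mem (fun l : ℕ => (X - C (l : ℂ)) ^ μ l)
      (Finset.mem_erase.2 ⟨(Finset.mem_erase.1 hl).1.symm, hk'⟩)
  rw [h0, add_zero, taylor_mul, taylor_taylor]
  simp only [add_neg_cancel, taylor_zero]
  rw [← Polynomial.coeff_coe, Polynomial.coe_mul]
  have h1 : PowerSeries.coeff j (((taylor (k : ℂ) (g μ N k) : ℂ[X]) : PowerSeries ℂ) *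
      ((tr μ N F k : ℂ[X]) : PowerSeries ℂ)) =
      PowerSeries.coeff j (((taylor (k : ℂ) (g μ N k) : ℂ[X]) : PowerSeries ℂ) *
      (iv μ N k * F k)) := by
    rw [PowerSeries.coeff_mul, PowerSeries.coeff_mul]
    refine Finset.sum_congr rfl fun x hx => ?_
    congr 1
    rw [Polynomial.coeff_coe, tr, PowerSeries.coeff_trunc, if_pos]
    have := Finset.HasAntidiagonal.mem_antidiagonal.1 hx
    omega
  rw [h1, ← mul_assoc, taylor_g_mul, one_mul]

/-- the linear functional on jets -/
noncomputable def Lam (μ : ℕ → ℕ) (N : ℕ) (F : ℕ → PowerSeries ℂ) : ℂ :=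
  ∑ k ∈ range (N + 1), PowerSeries.coeff (μ k - 1) (iv μ N k * F k)

lemma taylor_coeff_top (r : ℂ) (f : ℂ[X]) (n : ℕ) (h : f.natDegree ≤ n) :
    (taylor r f).coeff n = f.coeff n := by
  rcases Nat.eq_or_lt_of_le h with rfl | h
  · rw [coeff_taylor_natDegree]; rfl
  · rw [coeff_eq_zero_of_natDegree_lt h, coeff_eq_zero_of_natDegree_lt (by rwa [natDegree_taylor])]

lemma P_coeff (μ : ℕ → ℕ) (hμ : ∀ k, 1 ≤ μ k) (N : ℕ) (F : ℕ → PowerSeries ℂ) :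
    (P μ N F).coeff ((W μ N).natDegree - 1) = Lam μ N F := by
  rw [P, finsetSum_coeff, Lam]
  refine Finset.sum_congr rfl fun k hk => ?_
  have hk' : k ≤ N := by simpa [Nat.lt_succ_iff] using hk
  have h1 := g_natDegree μ N k hk'
  have h2 := hμ k
  have h3 : (W μ N).natDegree - 1 = (g μ N k).natDegree + (μ k - 1) := by omega
  have h4 : (tr μ N F k).natDegree ≤ μ k - 1 := by
    have := PowerSeries.natDegree_trunc_lt (iv μ N k * F k) (μ k - 1)
    rw [Nat.sub_add_cancel h2] at this
    rw [tr]; omega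
  rw [h3, coeff_mul_add_eq_of_natDegree_le le_rfl (by rwa [natDegree_taylor]),
    (g_monic _ _ _).coeff_natDegree, one_mul, taylor_coeff_top _ _ _ h4, tr,
    PowerSeries.coeff_trunc, if_pos (by omega)]

lemma P_unique (μ : ℕ → ℕ) (N : ℕ) (F : ℕ → PowerSeries ℂ) (p : ℂ[X])
    (hd : p.degree < (W μ N).degree)
    (h : ∀ k ≤ N, ∀ j < μ k, (taylor (k : ℂ) p).coeff j = PowerSeries.coeff j (F k)) :
    p = P μ N F := by
  rw [← sub_eq_zero]
  refine eq_zero_of_jets μ N _ ((degree_sub_le _ _).trans_lt (max_lt hd (P_degree μ N F))) ?_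
  intro k hk
  rw [dvd_iff_taylor]
  intro j hj
  rw [map_sub, coeff_sub, h k hk j hj, P_jets μ N F k hk j hj, sub_self]

lemma Lam_poly (μ : ℕ → ℕ) (hμ : ∀ k, 1 ≤ μ k) (N : ℕ) (f : ℂ[X]) :
    Lam μ N (fun k => ((taylor (k : ℂ) f : ℂ[X]) : PowerSeries ℂ)) =
      (f %ₘ W μ N).coeff ((W μ N).natDegree - 1) := by
  rw [← P_coeff μ hμ]
  congr 1
  symm
  refine P_unique _ _ _ _ (degree_modByMonic_lt _ (W_monic _ _)) ?_
  intro k hk j hj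
  rw [Polynomial.coeff_coe]
  have h1 : f %ₘ W μ N = f - W μ N * (f /ₘ W μ N) := by
    rw [eq_sub_iff_add_eq, modByMonic_add_div]
  rw [h1, map_sub, coeff_sub, sub_eq_self]
  refine (dvd_iff_taylor _ (μ k) _).1 (Dvd.dvd.mul_right ?_ _) j hj
  rw [W_eq μ N k hk]; exact dvd_mul_right _ _

/-- multiplicities `m`, with one extra at `h`. -/
def mu (m h : ℕ) (k : ℕ) : ℕ := m + if k = h then 1 else 0

noncomputable def jet (β ξ : ℂ) (k : ℕ) : PowerSeries ℂ :=
  PowerSeries.mk fun j => β ^ k * (ξ ^ j / (j.factorial : ℂ))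

lemma W_mu_natDegree (m h N : ℕ) (hh : h ≤ N) : (W (mu m h) N).natDegree = m * (N + 1) + 1 := by
  rw [W_natDegree]
  simp only [mu, Finset.sum_add_distrib, Finset.sum_ite_eq', Finset.sum_const, card_range]
  rw [if_pos (by simpa [Nat.lt_succ_iff] using hh)]
  simp [mul_comm]

theorem nonvanish (m N : ℕ) (hm : 1 ≤ m) (β ξ : ℂ) (hξ : ξ ≠ 0) :
    ∃ h ≤ N, Lam (mu m h) N (jet β ξ) ≠ 0 := by
  by_contra! hcon
  set p := P (fun _ => m) N (jet β ξ) with hp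
  have hWd : (W (fun _ => m) N).natDegree = m * (N + 1) := by
    rw [W_natDegree]; simp [mul_comm]
  have hpd : p.degree < ((m * (N + 1) : ℕ) : WithBot ℕ) := by
    have := P_degree (fun _ => m) N (jet β ξ)
    rwa [degree_eq_natDegree (W_monic _ _).ne_zero, hWd] at this
  have key : ∀ h ≤ N, P (mu m h) N (jet β ξ) = p := by
    intro h hh
    have hd := P_degree (mu m h) N (jet β ξ)
    rw [degree_eq_natDegree (W_monic _ _).ne_zero] at hd
    have hc := P_coeff (mu m h) (fun k => by unfold mu; omega) N (jet β ξ)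
    rw [hcon h hh] at hc
    rw [W_mu_natDegree m h N hh] at hc hd
    refine P_unique _ _ _ _ ?_ ?_
    · rw [degree_eq_natDegree (W_monic _ _).ne_zero, hWd, degree_lt_iff_coeff_zero]
      intro i hi
      rcases Nat.eq_or_lt_of_le hi with rfl | hi
      · simpa using hc
      · exact (degree_lt_iff_coeff_zero _ _).1 hd i hi
    · intro k hk j hj
      exact P_jets (mu m h) N _ k hk j (by unfold mu; omega)
  have jets : ∀ k ≤ N, ∀ j ≤ m, (taylor (k : ℂ) p).coeff j = β ^ k * (ξ ^ j / (j.factorial : ℂ)) := by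
    intro k hk j hj
    rw [← key k hk, P_jets (mu m k) N _ k hk j (by simp [mu]; omega)]
    simp [jet]
  have hz : derivative p - C ξ * p = 0 := by
    refine eq_zero_of_jets (fun _ => m) N _ ?_ ?_
    · rw [degree_eq_natDegree (W_monic _ _).ne_zero, hWd]
      refine (degree_sub_le _ _).trans_lt (max_lt ?_ ?_)
      · exact (degree_derivative_le).trans_lt hpd
      · exact (degree_C_mul hξ).trans_lt hpd
    · intro k hk
      rw [dvd_iff_taylor]
      intro j hj
      have h1 : taylor (k : ℂ) (derivative p) = derivative (taylor (k : ℂ) p) := by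
        simp [taylor_apply, derivative_comp]
      rw [map_sub, h1, coeff_sub, coeff_derivative, taylor_mul, taylor_C, coeff_C_mul,
        jets k hk _ hj, jets k hk _ hj.le, Nat.factorial_succ,
        Nat.succ_eq_add_one, pow_succ]
      have : (j.factorial : ℂ) ≠ 0 := by exact_mod_cast j.factorial_ne_zero
      have : (j : ℂ) + 1 ≠ 0 := by exact_mod_cast j.succ_ne_zero
      push_cast
      field_simp
      ring
  have hp0 : p = 0 := by
    by_contra hne
    have h1 : (derivative p).degree < p.degree := degree_derivative_lt hne
    rw [sub_eq_zero] at hz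
    rw [hz, degree_C_mul hξ] at h1
    exact lt_irrefl _ h1
  have := jets 0 (Nat.zero_le _) 0 (Nat.zero_le _)
  simp [hp0] at this

lemma hasSum_congr_fun {f g : ℕ → ℂ} {a : ℂ} (h : ∀ i, f i = g i) : HasSum f a ↔ HasSum g a := by
  rw [funext h]

lemma mul_modByMonic_mul (a f Q : ℂ[X]) (ha : a.Monic) (hQ : Q.Monic) :
    (a * f) %ₘ (a * Q) = a * (f %ₘ Q) := by
  refine (div_modByMonic_unique (f /ₘ Q) _ (ha.mul hQ) ⟨?_, ?_⟩).2
  · conv_rhs => rw [← modByMonic_add_div f Q]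
    ring
  · rw [degree_mul, degree_mul, degree_eq_natDegree ha.ne_zero]
    exact WithBot.add_lt_add_left (by simp) (degree_modByMonic_lt _ hQ)

lemma mod_bound (B : ℝ) (hB : 0 ≤ B) (s : Multiset ℂ) (hs : ∀ a ∈ s, ‖a‖ ≤ B) (hs0 : s ≠ 0)
    (n : ℕ) : ‖(X ^ n %ₘ (s.map fun a => X - C a).prod).coeff (s.card - 1)‖ ≤
      (n.choose (s.card - 1) : ℝ) * B ^ (n - (s.card - 1)) := by
  induction s using Multiset.induction_on generalizing n with
  | empty => exact absurd rfl hs0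
  | cons a s ih =>
    have haB : ‖a‖ ≤ B := hs a (Multiset.mem_cons_self _ _)
    rcases eq_or_ne s 0 with rfl | hne
    · simp only [Multiset.map_cons, Multiset.map_zero, Multiset.prod_cons, Multiset.prod_zero,
        mul_one, modByMonic_X_sub_C_eq_C_eval, Multiset.card_cons, Multiset.card_zero, zero_add,
        Nat.sub_self, coeff_C_zero, eval_pow, eval_X, Nat.choose_zero_right, Nat.cast_one, one_mul,
        Nat.sub_zero, norm_pow]
      exact pow_le_pow_left₀ (norm_nonneg _) haB n
    have ih' := ih (fun b hb => hs b (Multiset.mem_cons_of_mem hb)) hne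
    have hmon : ((s.map fun a => X - C a).prod : ℂ[X]).Monic :=
      monic_multiset_prod_of_monic _ _ fun _ _ => monic_X_sub_C _
    have hcard : ((s.map fun a => X - C a).prod : ℂ[X]).natDegree = s.card := by
      rw [natDegree_multiset_prod_X_sub_C_eq_card]
    obtain ⟨t, ht⟩ : ∃ t, s.card = t + 1 :=
      ⟨s.card - 1, (Nat.sub_add_cancel (Multiset.card_pos.2 hne)).symm⟩
    simp only [Multiset.map_cons, Multiset.prod_cons, Multiset.card_cons]
    rw [ht] at hcard
    simp only [ht, Nat.add_sub_cancel] at ih' ⊢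
    set Q : ℂ[X] := (s.map fun a => X - C a).prod with hQ
    have hmon2 : ((X - C a) * Q).Monic := (monic_X_sub_C a).mul hmon
    induction n with
    | zero =>
      rw [pow_zero, (modByMonic_eq_self_iff hmon2).2]
      · simp [coeff_one]
      · rw [degree_one, degree_eq_natDegree hmon2.ne_zero,
          (monic_X_sub_C a).natDegree_mul hmon, natDegree_X_sub_C]
        exact_mod_cast (by omega : 0 < 1 + Q.natDegree)
    | succ n ihn =>
      have h1 : (X : ℂ[X]) ^ (n + 1) = C a * X ^ n + (X - C a) * X ^ n := by ring
      have hdeg : (X ^ n %ₘ Q).natDegree ≤ t := by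
        have := natDegree_modByMonic_lt (X ^ n) hmon (by intro h; rw [h] at hcard; simp at hcard)
        omega
      have h2 : ((X ^ (n + 1) : ℂ[X]) %ₘ ((X - C a) * Q)).coeff (t + 1) =
          a * (X ^ n %ₘ ((X - C a) * Q)).coeff (t + 1) + (X ^ n %ₘ Q).coeff t := by
        rw [h1, add_modByMonic, ← smul_eq_C_mul, smul_modByMonic,
          mul_modByMonic_mul _ _ _ (monic_X_sub_C a) hmon, coeff_add, coeff_smul, smul_eq_mul,
          sub_mul X (C a) (X ^ n %ₘ Q), coeff_sub, coeff_X_mul, coeff_C_mul,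
          coeff_eq_zero_of_natDegree_lt (by omega : (X ^ n %ₘ Q).natDegree < t + 1)]
        ring
      rw [h2]
      refine (norm_add_le _ _).trans ?_
      rw [norm_mul, Nat.choose_succ_succ, Nat.add_sub_add_right]
      push_cast
      rw [add_mul, add_comm]
      refine add_le_add (ih' n) ?_
      refine (mul_le_mul haB ihn (norm_nonneg _) hB).trans (le_of_eq ?_)
      rcases lt_or_ge n (t + 1) with hlt | hge
      · simp [Nat.choose_eq_zero_of_lt hlt]
      · rw [show n - t = (n - (t + 1)) + 1 by omega, pow_succ]; ring

lemma W_mod_bound (μ : ℕ → ℕ) (N T : ℕ) (hT : (W μ N).natDegree = T + 1) (n : ℕ) :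
    ‖(X ^ n %ₘ W μ N).coeff T‖ ≤ (n.choose T : ℝ) * (N : ℝ) ^ (n - T) := by
  have h1 := (IsAlgClosed.splits (W μ N)).eq_prod_roots_of_monic (W_monic μ N)
  have hc : (W μ N).roots.card = T + 1 := by
    rw [← (IsAlgClosed.splits (W μ N)).natDegree_eq_card_roots, hT]
  have := mod_bound N (Nat.cast_nonneg N) (W μ N).roots ?_ ?_ n
  · rw [← h1, hc] at this
    simpa using this
  · intro a ha
    have h2 := (mem_roots'.1 ha).2
    rw [IsRoot.def, W, eval_prod, Finset.prod_eq_zero_iff] at h2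
    obtain ⟨l, hl, h3⟩ := h2
    have h4 : a - l = 0 := by simpa using eq_zero_of_pow_eq_zero (by simpa using h3)
    rw [sub_eq_zero.1 h4]
    simp only [Complex.norm_natCast, Nat.cast_le]
    simpa [Nat.lt_succ_iff] using hl
  · intro h; rw [h] at hc; simp at hc

lemma hasSum_choose (ξ k : ℂ) (j : ℕ) :
    HasSum (fun n : ℕ => ξ ^ n / (n.factorial : ℂ) * (k ^ (n - j) * (n.choose j : ℂ)))
      (ξ ^ j / (j.factorial : ℂ) * Complex.exp (k * ξ)) := by
  rw [← hasSum_nat_add_iff' j, Finset.sum_eq_zero, sub_zero]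
  · have h := (NormedSpace.expSeries_div_hasSum_exp (k * ξ)).mul_left (ξ ^ j / (j.factorial : ℂ))
    rw [← Complex.exp_eq_exp_ℂ] at h
    refine (hasSum_congr_fun fun i => ?_).mpr h
    rw [Nat.add_sub_cancel, ← Nat.choose_symm_add, Nat.cast_add_choose]
    have h1 : ((i + j).factorial : ℂ) ≠ 0 := by exact_mod_cast (i + j).factorial_ne_zero
    have h2 : (i.factorial : ℂ) ≠ 0 := by exact_mod_cast i.factorial_ne_zero
    have h3 : (j.factorial : ℂ) ≠ 0 := by exact_mod_cast j.factorial_ne_zero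
    field_simp
    ring
  · intro i hi
    rw [Nat.choose_eq_zero_of_lt (Finset.mem_range.1 hi)]; simp

lemma hasSum_choose_real (ξ k : ℝ) (j : ℕ) :
    HasSum (fun n : ℕ => ξ ^ n / (n.factorial : ℝ) * (k ^ (n - j) * (n.choose j : ℝ)))
      (ξ ^ j / (j.factorial : ℝ) * Real.exp (k * ξ)) := by
  have := hasSum_choose ξ k j
  exact_mod_cast this

lemma Lam_exp_hasSum (μ : ℕ → ℕ) (hμ : ∀ k, 1 ≤ μ k) (N : ℕ) (ξ : ℂ) :
    HasSum (fun n : ℕ => ξ ^ n / (n.factorial : ℂ) *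
      (X ^ n %ₘ W μ N).coeff ((W μ N).natDegree - 1)) (Lam μ N (jet (Complex.exp ξ) ξ)) := by
  simp only [← Lam_poly μ hμ, Lam, PowerSeries.coeff_mul, Finset.mul_sum]
  refine hasSum_sum fun k _ => hasSum_sum fun x _ => ?_
  simp only [taylor_X_pow, Polynomial.coeff_coe, coeff_X_add_C_pow]
  have := (hasSum_choose ξ k x.2).mul_left (PowerSeries.coeff x.1 (iv μ N k))
  have hv : PowerSeries.coeff x.2 (jet (Complex.exp ξ) ξ k) =
      ξ ^ x.2 / (x.2.factorial : ℂ) * Complex.exp (k * ξ) := by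
    unfold jet
    rw [PowerSeries.coeff_mk, Complex.exp_nat_mul]; ring
  rw [hv]
  refine (hasSum_congr_fun fun n => ?_).mpr this
  ring

theorem Lam_exp_bound (μ : ℕ → ℕ) (hμ : ∀ k, 1 ≤ μ k) (N T : ℕ)
    (hT : (W μ N).natDegree = T + 1) (ξ : ℂ) :
    ‖Lam μ N (jet (Complex.exp ξ) ξ)‖ ≤ ‖ξ‖ ^ T / (T.factorial : ℝ) * Real.exp (N * ‖ξ‖) := by
  refine (Lam_exp_hasSum μ hμ N ξ).norm_le_of_bounded (hasSum_choose_real ‖ξ‖ N T) fun n => ?_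
  rw [hT, Nat.add_sub_cancel, norm_mul, norm_div, norm_pow, Complex.norm_natCast]
  refine mul_le_mul_of_nonneg_left ?_ (by positivity)
  rw [mul_comm]
  exact W_mod_bound μ N T hT n

lemma prod_sub (k r : ℕ) : ∏ l ∈ (range (k + r + 1)).erase k, ((k : ℂ) - l) =
    (-1) ^ r * (k.factorial * r.factorial) := by
  induction r with
  | zero =>
    rw [add_zero, Finset.range_add_one, Finset.erase_insert (by simp),
      ← Finset.prod_range_reflect, ← Finset.prod_range_add_one_eq_factorial]
    simp only [pow_zero, Nat.factorial_zero, Nat.cast_one, mul_one, one_mul]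
    push_cast
    refine Finset.prod_congr rfl fun x hx => ?_
    have := Finset.mem_range.1 hx
    rw [Nat.sub_sub, Nat.cast_sub (by omega)]
    push_cast
    ring
  | succ r ih =>
    rw [show k + (r + 1) + 1 = (k + r + 1) + 1 by ring, Finset.range_add_one,
      Finset.erase_insert_of_ne (by omega), Finset.prod_insert (by simp), ih, Nat.factorial_succ]
    push_cast
    ring

lemma fact_prod (N k : ℕ) (hk : k ≤ N) : ∃ z : ℤ, (N.factorial : ℂ) *
    ∏ l ∈ (range (N + 1)).erase k, ((k : ℂ) - l)⁻¹ = z ∧ |(z : ℝ)| ≤ 2 ^ N := by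
  obtain ⟨r, rfl⟩ := Nat.exists_eq_add_of_le hk
  refine ⟨(-1) ^ r * ((k + r).choose k : ℕ), ?_, ?_⟩
  · rw [Finset.prod_inv_distrib, prod_sub]
    push_cast
    rw [Nat.cast_add_choose]
    have h2 : (k.factorial : ℂ) ≠ 0 := by exact_mod_cast k.factorial_ne_zero
    have h3 : (r.factorial : ℂ) ≠ 0 := by exact_mod_cast r.factorial_ne_zero
    rw [mul_inv, ← inv_pow, inv_neg_one]
    field_simp
  · push_cast
    rw [abs_mul, abs_pow, abs_neg, abs_one, one_pow, one_mul, Nat.abs_cast]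
    exact_mod_cast Nat.choose_le_two_pow _ _

noncomputable def e1 (c : ℂ) : PowerSeries ℂ := PowerSeries.mk fun i => (-c⁻¹) ^ i

lemma e_eq (c : ℂ) : e c = PowerSeries.C c⁻¹ * e1 c := by
  ext i; simp [e, e1]

def Good (d : ℕ) (f : PowerSeries ℂ) : Prop :=
  ∀ i, ∃ z : ℤ, (d : ℂ) ^ i * PowerSeries.coeff i f = z

lemma good_one (d : ℕ) : Good d 1 := by
  intro i
  rw [PowerSeries.coeff_one]
  by_cases h : i = 0
  · exact ⟨1, by simp [h]⟩
  · exact ⟨0, by simp [h]⟩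

lemma good_mul (d : ℕ) (f f' : PowerSeries ℂ) (h : Good d f) (h' : Good d f') :
    Good d (f * f') := by
  intro i
  choose z hz using h
  choose z' hz' using h'
  refine ⟨∑ x ∈ Finset.HasAntidiagonal.antidiagonal i, z x.1 * z' x.2, ?_⟩
  rw [PowerSeries.coeff_mul, Finset.mul_sum]
  push_cast
  refine Finset.sum_congr rfl fun x hx => ?_
  rw [← hz, ← hz', ← Finset.HasAntidiagonal.mem_antidiagonal.1 hx, pow_add]
  ring

lemma good_pow (d : ℕ) (f : PowerSeries ℂ) (h : Good d f) (n : ℕ) : Good d (f ^ n) := by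
  induction n with
  | zero => rw [pow_zero]; exact good_one d
  | succ n ih => rw [pow_succ]; exact good_mul d _ _ ih h

lemma good_prod (d : ℕ) (s : Finset ℕ) (f : ℕ → PowerSeries ℂ) (h : ∀ l ∈ s, Good d (f l)) :
    Good d (∏ l ∈ s, f l) :=
  Finset.prod_induction _ (Good d) (fun a b ha hb => good_mul d a b ha hb) (good_one d) h

def Dom (n : ℕ) (f : PowerSeries ℂ) : Prop :=
  ∀ i, ‖PowerSeries.coeff i f‖ ≤ PowerSeries.coeff i ((PowerSeries.mk 1 : PowerSeries ℝ) ^ n)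

lemma dom_one : Dom 0 1 := by
  intro i
  rw [pow_zero, PowerSeries.coeff_one, PowerSeries.coeff_one]
  split_ifs <;> simp

lemma dom_mul (n n' : ℕ) (f f' : PowerSeries ℂ) (h : Dom n f) (h' : Dom n' f') :
    Dom (n + n') (f * f') := by
  intro i
  rw [pow_add, PowerSeries.coeff_mul, PowerSeries.coeff_mul]
  refine norm_sum_le_of_le _ fun x _ => ?_
  rw [norm_mul]
  exact mul_le_mul (h _) (h' _) (norm_nonneg _) ((norm_nonneg _).trans (h _))

lemma dom_pow (f : PowerSeries ℂ) (h : Dom 1 f) (n : ℕ) : Dom n (f ^ n) := by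
  induction n with
  | zero => rw [pow_zero]; exact dom_one
  | succ n ih => rw [pow_succ]; exact dom_mul _ _ _ _ ih h

lemma dom_prod (s : Finset ℕ) (n : ℕ → ℕ) (f : ℕ → PowerSeries ℂ) (h : ∀ l ∈ s, Dom (n l) (f l)) :
    Dom (∑ l ∈ s, n l) (∏ l ∈ s, f l) := by
  induction s using Finset.induction_on with
  | empty => simpa using dom_one
  | insert a s ha ih =>
    rw [Finset.sum_insert ha, Finset.prod_insert ha]
    exact dom_mul _ _ _ _ (h _ (by simp)) (ih fun l hl => h l (by simp [hl]))

lemma dom_bound (n : ℕ) (f : PowerSeries ℂ) (h : Dom n f) (i : ℕ) :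
    ‖PowerSeries.coeff i f‖ ≤ 2 ^ (n + i) := by
  refine (h i).trans ?_
  cases n with
  | zero =>
    rw [pow_zero, PowerSeries.coeff_one]
    split_ifs
    · exact one_le_pow₀ (by norm_num)
    · positivity
  | succ t =>
    rw [PowerSeries.mk_one_pow_eq_mk_choose_add, PowerSeries.coeff_mk]
    calc (((t + i).choose t : ℕ) : ℝ) ≤ 2 ^ (t + i) := by exact_mod_cast Nat.choose_le_two_pow _ _
      _ ≤ 2 ^ (t + 1 + i) := pow_le_pow_right₀ (by norm_num) (by omega)

lemma int_div (d : ℕ) (N k l : ℕ) (hd : ∀ l, 1 ≤ l → l ≤ N → l ∣ d) (hk : k ≤ N) (hl : l ≤ N)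
    (hkl : l ≠ k) : ∃ z : ℤ, (d : ℂ) * ((k : ℂ) - l)⁻¹ = z := by
  have h1 : ((k : ℤ) - l) ∣ d := by
    have : ((k : ℤ) - l).natAbs ∣ d := hd _ (by omega) (by omega)
    exact Int.natAbs_dvd.1 (by exact_mod_cast this)
  obtain ⟨z, hz⟩ := h1
  refine ⟨z, ?_⟩
  have h2 : (d : ℂ) = ((k : ℂ) - l) * z := by exact_mod_cast congrArg (Int.cast : ℤ → ℂ) hz
  have h3 : (k : ℂ) - l ≠ 0 := by rw [sub_ne_zero]; exact_mod_cast hkl.symm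
  rw [h2]; field_simp

lemma norm_inv_le (k l : ℕ) (hkl : l ≠ k) : ‖((k : ℂ) - l)⁻¹‖ ≤ 1 := by
  rw [norm_inv]
  refine inv_le_one_of_one_le₀ ?_
  have : ((k : ℂ) - l) = (((k : ℤ) - l : ℤ) : ℂ) := by push_cast; rfl
  rw [this, Complex.norm_intCast]
  have h : (1 : ℤ) ≤ |(k : ℤ) - l| := Int.one_le_abs (by omega)
  exact_mod_cast h

lemma good_e1 (d : ℕ) (N k l : ℕ) (hd : ∀ l, 1 ≤ l → l ≤ N → l ∣ d) (hk : k ≤ N) (hl : l ≤ N)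
    (hkl : l ≠ k) : Good d (e1 ((k : ℂ) - l)) := by
  intro i
  obtain ⟨z, hz⟩ := int_div d N k l hd hk hl hkl
  refine ⟨(-z) ^ i, ?_⟩
  rw [e1, PowerSeries.coeff_mk, ← mul_pow]
  push_cast
  rw [← hz]; ring

lemma dom_e1 (k l : ℕ) (hkl : l ≠ k) : Dom 1 (e1 ((k : ℂ) - l)) := by
  intro i
  rw [e1, PowerSeries.coeff_mk, pow_one, PowerSeries.coeff_mk, norm_pow, norm_neg]
  exact pow_le_one₀ (norm_nonneg _) (norm_inv_le k l hkl)

lemma iv_eq (μ : ℕ → ℕ) (N k : ℕ) : iv μ N k =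
    PowerSeries.C (∏ l ∈ (range (N + 1)).erase k, (((k : ℂ) - l)⁻¹) ^ μ l) *
      ∏ l ∈ (range (N + 1)).erase k, e1 ((k : ℂ) - l) ^ μ l := by
  simp only [iv, e_eq, mul_pow, Finset.prod_mul_distrib, map_prod, map_pow]

lemma const_eq (m h N k : ℕ) (hh : h ≤ N) :
    ∏ l ∈ (range (N + 1)).erase k, (((k : ℂ) - l)⁻¹) ^ mu m h l =
    (∏ l ∈ (range (N + 1)).erase k, ((k : ℂ) - l)⁻¹) ^ m *
      (if h = k then 1 else ((k : ℂ) - h)⁻¹) := by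
  simp only [mu, pow_add, Finset.prod_mul_distrib, Finset.prod_pow]
  congr 1
  simp only [pow_ite, pow_one, pow_zero]
  rw [Finset.prod_ite_eq']
  have : h ∈ range (N + 1) := by simpa [Nat.lt_succ_iff] using hh
  simp [this, ite_not]

theorem iv_coeff (m h N k d : ℕ) (hd : ∀ l, 1 ≤ l → l ≤ N → l ∣ d) (hd1 : 1 ≤ d) (hh : h ≤ N)
    (hk : k ≤ N) (i : ℕ) (hi : i ≤ m) :
    ∃ z : ℤ, (N.factorial : ℂ) ^ m * (d : ℂ) ^ (m + 1) *
      PowerSeries.coeff i (iv (mu m h) N k) = z ∧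
      |(z : ℝ)| ≤ 2 ^ (N * m) * (d : ℝ) ^ (m + 1) * 2 ^ (m * N + 1 + m) := by
  obtain ⟨z0, hz0, hz0b⟩ := fact_prod N k hk
  have hmem : ∀ l ∈ (range (N + 1)).erase k, l ≤ N ∧ l ≠ k := fun l hl => by
    have := Finset.mem_erase.1 hl
    exact ⟨by simpa [Nat.lt_succ_iff] using this.2, this.1⟩
  have hg : Good d (∏ l ∈ (range (N + 1)).erase k, e1 ((k : ℂ) - l) ^ mu m h l) :=
    good_prod _ _ _ fun l hl => good_pow _ _ (good_e1 d N k l hd hk (hmem l hl).1 (hmem l hl).2) _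
  have hD : Dom (∑ l ∈ (range (N + 1)).erase k, mu m h l)
      (∏ l ∈ (range (N + 1)).erase k, e1 ((k : ℂ) - l) ^ mu m h l) :=
    dom_prod _ _ _ fun l hl => dom_pow _ (dom_e1 k l (hmem l hl).2) _
  have hn : ∑ l ∈ (range (N + 1)).erase k, mu m h l ≤ m * N + 1 := by
    simp only [mu, Finset.sum_add_distrib, Finset.sum_const, Finset.sum_ite_eq']
    rw [Finset.card_erase_of_mem (by simpa [Nat.lt_succ_iff] using hk), card_range]
    simp only [Nat.add_sub_cancel, smul_eq_mul]
    rw [mul_comm]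
    refine Nat.add_le_add_left ?_ _
    split_ifs <;> omega
  obtain ⟨z2, hz2⟩ := hg i
  obtain ⟨z1, hz1, hz1b⟩ : ∃ z : ℤ, (d : ℂ) * (if h = k then 1 else ((k : ℂ) - h)⁻¹) = z ∧
      |(z : ℝ)| ≤ d := by
    by_cases hhk : h = k
    · exact ⟨d, by simp [hhk], by simp⟩
    · obtain ⟨z, hz⟩ := int_div d N k h hd hk hh hhk
      refine ⟨z, by simpa [hhk] using hz, ?_⟩
      rw [← Complex.norm_intCast, ← hz, norm_mul, Complex.norm_natCast]
      exact mul_le_of_le_one_right (Nat.cast_nonneg _) (norm_inv_le k h hhk)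
  have key : (N.factorial : ℂ) ^ m * (d : ℂ) ^ (m + 1) *
      PowerSeries.coeff i (iv (mu m h) N k) = (z0 : ℂ) ^ m * z1 * (d ^ (m - i) * z2) := by
    rw [iv_eq, PowerSeries.coeff_C_mul, const_eq m h N k hh, ← hz0, ← hz1, ← hz2]
    conv_lhs => rw [show m + 1 = 1 + (m - i) + i by omega]
    rw [pow_add, pow_add, mul_pow]
    ring
  refine ⟨z0 ^ m * z1 * (d ^ (m - i) * z2), by rw [key]; push_cast; rfl, ?_⟩
  have hz2b : |(z2 : ℝ)| ≤ (d : ℝ) ^ i * 2 ^ (m * N + 1 + m) := by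
    rw [← Complex.norm_intCast, ← hz2, norm_mul, norm_pow, Complex.norm_natCast]
    refine mul_le_mul_of_nonneg_left ((dom_bound _ _ hD i).trans ?_) (by positivity)
    exact pow_le_pow_right₀ (by norm_num) (by omega)
  push_cast
  rw [abs_mul, abs_mul, abs_mul, abs_pow, abs_pow, Nat.abs_cast]
  calc |(z0 : ℝ)| ^ m * |(z1 : ℝ)| * ((d : ℝ) ^ (m - i) * |(z2 : ℝ)|)
      ≤ (2 ^ N) ^ m * d * ((d : ℝ) ^ (m - i) * ((d : ℝ) ^ i * 2 ^ (m * N + 1 + m))) := by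
        gcongr
    _ = 2 ^ (N * m) * (d : ℝ) ^ (m + 1) * 2 ^ (m * N + 1 + m) := by
        conv_rhs => rw [show m + 1 = 1 + (m - i) + i by omega]
        rw [pow_add (d : ℝ), pow_add (d : ℝ), ← pow_mul]
        ring

lemma lcm_bound : ∃ c0 : ℕ, 1 ≤ c0 ∧ ∀ N : ℕ, ∃ d : ℕ, 1 ≤ d ∧ (∀ l, 1 ≤ l → l ≤ N → l ∣ d) ∧
    d ≤ c0 ^ N := by
  obtain ⟨c0, hc0⟩ := exists_nat_ge (Real.exp (Real.log 4 + 4))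
  refine ⟨c0, ?_, fun N => ⟨Nat.lcmUpto N, Nat.lcmUpto_pos N, ?_, ?_⟩⟩
  · have : (0 : ℝ) < c0 := (Real.exp_pos _).trans_le hc0
    exact_mod_cast this
  · intro l h1 h2
    exact Finset.dvd_lcm (f := id) (Finset.mem_Icc.2 ⟨h1, h2⟩)
  · have h1 := Chebyshev.psi_le_const_mul_self (x := (N : ℝ)) (Nat.cast_nonneg N)
    rw [Chebyshev.psi_eq_log_lcmUpto, Real.log_le_iff_le_exp
      (by exact_mod_cast Nat.lcmUpto_pos N), mul_comm, Real.exp_nat_mul] at h1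
    have h2 := h1.trans (pow_le_pow_left₀ (Real.exp_pos _).le hc0 N)
    exact_mod_cast h2

theorem forms : ∃ c1 : ℕ, 1 ≤ c1 ∧ ∀ m N h : ℕ, 1 ≤ m → 1 ≤ N → h ≤ N →
    ∃ (S : ℕ) (z : ℕ → ℕ → ℤ), 1 ≤ S ∧ S ≤ N.factorial ^ m * c1 ^ (m * N) ∧
      (∀ k ≤ N, ∀ j ≤ m, |(z k j : ℝ)| ≤ (c1 : ℝ) ^ (m * N)) ∧
      ∀ β ξ : ℂ, (S : ℂ) * Lam (mu m h) N (jet β ξ) =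
        ∑ k ∈ range (N + 1), ∑ j ∈ range (m + 1),
          (z k j : ℂ) * (β ^ k * (ξ ^ j / (j.factorial : ℂ))) := by
  obtain ⟨c0, hc0, hd⟩ := lcm_bound
  refine ⟨16 * c0 ^ 2, Nat.one_le_iff_ne_zero.2 (by positivity), ?_⟩
  intro m N h hm hN hh
  obtain ⟨d, hd1, hdv, hdb⟩ := hd N
  have hex : ∀ k j : ℕ, ∃ z : ℤ, k ≤ N → j ≤ m →
      ((N.factorial : ℂ) ^ m * (d : ℂ) ^ (m + 1) *
        (if j < mu m h k then PowerSeries.coeff (mu m h k - 1 - j) (iv (mu m h) N k) else 0) = z ∧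
      |(z : ℝ)| ≤ 2 ^ (N * m) * (d : ℝ) ^ (m + 1) * 2 ^ (m * N + 1 + m)) := by
    intro k j
    by_cases hk : k ≤ N
    swap
    · exact ⟨0, fun h => absurd h hk⟩
    by_cases hj : j < mu m h k
    · obtain ⟨z, hz⟩ := iv_coeff m h N k d hdv hd1 hh hk (mu m h k - 1 - j)
        (by unfold mu; split_ifs <;> omega)
      refine ⟨z, fun _ _ => ?_⟩
      rw [if_pos hj]; exact hz
    · refine ⟨0, fun _ _ => ⟨by simp [hj], ?_⟩⟩
      simp only [Int.cast_zero, abs_zero]; positivity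
  choose z hz using hex
  have hmN : m ≤ m * N := Nat.le_mul_of_pos_right _ hN
  have hNm : N ≤ m * N := Nat.le_mul_of_pos_left _ hm
  have hd2 : d ^ (m + 1) ≤ (c0 ^ 2) ^ (m * N) := by
    calc d ^ (m + 1) ≤ (c0 ^ N) ^ (m + 1) := Nat.pow_le_pow_left hdb _
      _ = c0 ^ (N * m + N) := by rw [← pow_mul]; ring_nf
      _ ≤ c0 ^ (2 * (m * N)) := Nat.pow_le_pow_right hc0 (by rw [mul_comm N m]; omega)
      _ = _ := by rw [pow_mul]
  refine ⟨N.factorial ^ m * d ^ (m + 1), z, ?_, ?_, ?_, ?_⟩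
  · exact Nat.one_le_iff_ne_zero.2 (by positivity)
  · refine Nat.mul_le_mul_left _ (hd2.trans ?_)
    exact Nat.pow_le_pow_left (Nat.le_mul_of_pos_left _ (by norm_num)) _
  · intro k hk j hj
    refine (hz k j hk hj).2.trans ?_
    have hd3 : (d : ℝ) ^ (m + 1) ≤ ((c0 : ℝ) ^ 2) ^ (m * N) := by exact_mod_cast hd2
    push_cast
    calc (2 : ℝ) ^ (N * m) * (d : ℝ) ^ (m + 1) * 2 ^ (m * N + 1 + m)
        ≤ 2 ^ (N * m) * ((c0 : ℝ) ^ 2) ^ (m * N) * 2 ^ (3 * (m * N)) := by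
          gcongr
          · norm_num
          · omega
      _ = (16 * (c0 : ℝ) ^ 2) ^ (m * N) := by
          rw [pow_mul 2 3, mul_comm N m, mul_pow, show (16 : ℝ) = 2 * 2 ^ 3 by norm_num, mul_pow]
          ring
  · intro β ξ
    rw [Lam, Finset.mul_sum]
    refine Finset.sum_congr rfl fun k hk => ?_
    have hk' : k ≤ N := by simpa [Nat.lt_succ_iff] using hk
    have hmu : 1 ≤ mu m h k := by unfold mu; omega
    have hmu2 : mu m h k ≤ m + 1 := by unfold mu; split_ifs <;> omega
    rw [mul_comm (iv _ _ _), PowerSeries.coeff_mul,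
      Finset.Nat.sum_antidiagonal_eq_sum_range_succ_mk, Nat.succ_eq_add_one,
      Nat.sub_add_cancel hmu, Finset.mul_sum]
    rw [← Finset.sum_subset (Finset.range_subset_range.2 hmu2)]
    · refine Finset.sum_congr rfl fun j hj => ?_
      have hj' := Finset.mem_range.1 hj
      rw [← (hz k j hk' (by omega)).1, if_pos hj', jet, PowerSeries.coeff_mk]
      push_cast
      ring
    · intro j hj hj2
      rw [Finset.mem_range] at hj hj2
      rw [← (hz k j hk' (by omega)).1, if_neg hj2]
      simp

/-- Liouville-type inequality. -/
theorem liouville_ineq (K : Type*) [Field K] [NumberField K] (φ : K →+* ℂ) (θ : K)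
    (hθ : IsIntegral ℤ θ) (h0 : θ ≠ 0) (H : ℝ) (hH1 : 1 ≤ H) (hH : ∀ σ : K →+* ℂ, ‖σ θ‖ ≤ H) :
    1 ≤ ‖φ θ‖ * H ^ (Module.finrank ℚ K) := by
  classical
  have h1 : (algebraMap ℚ ℂ) (Algebra.norm ℚ θ) = ∏ σ : K →ₐ[ℚ] ℂ, σ θ :=
    Algebra.norm_eq_prod_embeddings ℚ ℂ θ
  have h2 : IsIntegral ℤ (Algebra.norm ℚ θ) := Algebra.isIntegral_norm ℚ hθ
  obtain ⟨z, hz⟩ := IsIntegrallyClosed.isIntegral_iff.1 h2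
  have hz0 : z ≠ 0 := by
    rintro rfl
    have : Algebra.norm ℚ θ = 0 := by rw [← hz]; simp
    exact h0 (Algebra.norm_eq_zero_iff.1 this)
  have h3 : (1 : ℝ) ≤ ‖∏ σ : K →ₐ[ℚ] ℂ, σ θ‖ := by
    rw [← h1, ← hz]
    simp only [eq_intCast, map_intCast, Complex.norm_intCast]
    exact_mod_cast Int.one_le_abs hz0
  set φ' : K →ₐ[ℚ] ℂ := φ.toRatAlgHom with hφ'
  rw [← Finset.mul_prod_erase _ _ (Finset.mem_univ φ'), norm_mul] at h3
  refine h3.trans ?_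
  refine mul_le_mul_of_nonneg_left ?_ (norm_nonneg _)
  rw [norm_prod]
  calc ∏ σ ∈ Finset.univ.erase φ', ‖σ θ‖ ≤ ∏ σ ∈ Finset.univ.erase φ', H :=
        Finset.prod_le_prod (fun _ _ => norm_nonneg _) fun σ _ => hH σ.toRingHom
    _ = H ^ (Finset.univ.erase φ').card := by rw [Finset.prod_const]
    _ ≤ H ^ (Module.finrank ℚ K) := by
        refine pow_le_pow_right₀ hH1 ?_
        rw [← AlgHom.card ℚ K ℂ]
        exact Finset.card_le_univ _

lemma exp_diff (α x : ℝ) (k : ℕ) :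
    ‖Complex.exp (Complex.I * α) ^ k - Complex.exp (Complex.I * x) ^ k‖ ≤ k * |α - x| := by
  rw [← Complex.exp_nat_mul, ← Complex.exp_nat_mul]
  have h1 : Complex.exp (k * (Complex.I * α)) - Complex.exp (k * (Complex.I * x)) =
      Complex.exp (Complex.I * ((k * x : ℝ) : ℂ)) *
        (Complex.exp (Complex.I * ((k * (α - x) : ℝ) : ℂ)) - 1) := by
    rw [mul_sub, mul_one, ← Complex.exp_add]
    push_cast
    congr 1 <;> congr 1 <;> ring
  rw [h1, norm_mul, Complex.norm_exp_I_mul_ofReal, one_mul]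
  refine Real.norm_exp_I_mul_ofReal_sub_one_le.trans ?_
  rw [Real.norm_eq_abs, abs_mul, Nat.abs_cast]

lemma fact_ratio (m N T : ℕ) (hm : 1 ≤ m) (hN : 1 ≤ N) (hT : m * N ≤ T) :
    (N.factorial : ℝ) ^ m / (T.factorial : ℝ) ≤ (3 / m) ^ (m * N) := by
  have hm' : (0 : ℝ) < m := by exact_mod_cast hm
  have hN' : (0 : ℝ) < N := by exact_mod_cast hN
  have h1 : ((m * N : ℕ) : ℝ) ^ (m * N) / ((m * N).factorial : ℝ) ≤ 3 ^ (m * N) := by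
    refine (Real.pow_div_factorial_le_exp _ (Nat.cast_nonneg _) (m * N)).trans ?_
    rw [← mul_one ((m * N : ℕ) : ℝ), Real.exp_nat_mul]
    exact pow_le_pow_left₀ (Real.exp_pos _).le (Real.exp_one_lt_d9.le.trans (by norm_num)) _
  have h2 : ((m * N).factorial : ℝ) ≤ T.factorial := by exact_mod_cast Nat.factorial_le hT
  have h3 : (N.factorial : ℝ) ^ m ≤ (N : ℝ) ^ (m * N) := by
    rw [mul_comm m N, pow_mul]
    exact pow_le_pow_left₀ (by positivity) (by exact_mod_cast Nat.factorial_le_pow N) _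
  have h4 : (0 : ℝ) < (m * N).factorial := by exact_mod_cast Nat.factorial_pos _
  calc (N.factorial : ℝ) ^ m / (T.factorial : ℝ)
      ≤ (N : ℝ) ^ (m * N) / ((m * N).factorial : ℝ) := by gcongr
    _ = (((m * N : ℕ) : ℝ) ^ (m * N) / ((m * N).factorial : ℝ)) / (m : ℝ) ^ (m * N) := by
        push_cast; rw [mul_pow]; field_simp
    _ ≤ 3 ^ (m * N) / (m : ℝ) ^ (m * N) := by gcongr
    _ = _ := by rw [div_pow]

lemma pow_le_mN (c : ℝ) (hc : 1 ≤ c) (a n : ℕ) (h : a ≤ n) : c ^ a ≤ c ^ n :=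
  pow_le_pow_right₀ hc h

/-- The algebraic integer attached to a form. -/
noncomputable def theta {K : Type*} [Field K] (m N : ℕ) (z : ℕ → ℕ → ℤ) (b : ℕ) (p : ℤ) (q : ℕ)
    (iK βK : K) : K :=
  ∑ k ∈ range (N + 1), ∑ j ∈ range (m + 1),
    (z k j : K) * (((b : K) ^ (N - k) * ((b : K) * βK) ^ k) *
      (((m.factorial / j.factorial : ℕ) : K) * ((q : K) ^ (m - j) * ((p : K) ^ j * iK ^ j))))

lemma theta_integral {K : Type*} [Field K] (m N : ℕ) (z : ℕ → ℕ → ℤ) (b : ℕ) (p : ℤ)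
    (q : ℕ) (iK βK : K) (hi : IsIntegral ℤ iK) (hb : IsIntegral ℤ ((b : K) * βK)) :
    IsIntegral ℤ (theta m N z b p q iK βK) := by
  have hn : ∀ n : ℕ, IsIntegral ℤ (n : K) := fun n => by
    simpa using (isIntegral_algebraMap (R := ℤ) (A := K) (x := (n : ℤ)))
  have hz : ∀ n : ℤ, IsIntegral ℤ (n : K) := fun n => by
    simpa using (isIntegral_algebraMap (R := ℤ) (A := K) (x := n))
  refine IsIntegral.sum _ fun k _ => IsIntegral.sum _ fun j _ => ?_
  exact (hz _).mul ((((hn _).pow _).mul (hb.pow _)).mul ((hn _).mul (((hn _).pow _).mul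
    (((hz _).pow _).mul (hi.pow _)))))

lemma theta_map {K : Type*} [Field K] (σ : K →+* ℂ) (m N : ℕ) (z : ℕ → ℕ → ℤ) (b : ℕ) (p : ℤ)
    (q : ℕ) (hq : 1 ≤ q) (iK βK : K) :
    σ (theta m N z b p q iK βK) = (m.factorial : ℂ) * (q : ℂ) ^ m * (b : ℂ) ^ N *
      ∑ k ∈ range (N + 1), ∑ j ∈ range (m + 1),
          (z k j : ℂ) * (σ βK ^ k * ((σ iK * (p / q)) ^ j / (j.factorial : ℂ))) := by
  have hq' : (q : ℂ) ≠ 0 := by exact_mod_cast (by omega : q ≠ 0)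
  simp only [theta, map_sum, map_mul, map_pow, map_natCast, map_intCast, Finset.mul_sum]
  refine Finset.sum_congr rfl fun k hk => Finset.sum_congr rfl fun j hj => ?_
  have hk' : k ≤ N := by simpa [Nat.lt_succ_iff] using hk
  have hj' : j ≤ m := by simpa [Nat.lt_succ_iff] using hj
  have hjf : (j.factorial : ℂ) ≠ 0 := by exact_mod_cast j.factorial_ne_zero
  rw [Nat.cast_div (Nat.factorial_dvd_factorial hj') hjf]
  have e1 : (b : ℂ) ^ N = (b : ℂ) ^ (N - k) * (b : ℂ) ^ k := by rw [← pow_add]; congr 1; omega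
  have e2 : (q : ℂ) ^ m = (q : ℂ) ^ (m - j) * (q : ℂ) ^ j := by rw [← pow_add]; congr 1; omega
  rw [e1, e2, mul_pow, mul_pow, div_pow]
  field_simp

lemma sum_bound (m N : ℕ) (c1 x B : ℝ) (hB : 0 ≤ B) (hx : 1 ≤ x)
    (z : ℕ → ℕ → ℤ) (hz : ∀ k ≤ N, ∀ j ≤ m, |(z k j : ℝ)| ≤ c1) (u : ℕ → ℂ)
    (hu : ∀ k ≤ N, ‖u k‖ ≤ B) (ξ : ℂ) (hξ : ‖ξ‖ ≤ x) :
    ‖∑ k ∈ range (N + 1), ∑ j ∈ range (m + 1),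
          (z k j : ℂ) * (u k * (ξ ^ j / (j.factorial : ℂ)))‖ ≤
      ((N + 1 : ℕ) : ℝ) * (((m + 1 : ℕ) : ℝ) * (c1 * (B * x ^ m))) := by
  have : ∀ k ∈ range (N + 1), ∀ j ∈ range (m + 1),
      ‖(z k j : ℂ) * (u k * (ξ ^ j / (j.factorial : ℂ)))‖ ≤ c1 * (B * x ^ m) := by
    intro k hk j hj
    have hk' : k ≤ N := by simpa [Nat.lt_succ_iff] using hk
    have hj' : j ≤ m := by simpa [Nat.lt_succ_iff] using hj
    rw [norm_mul, norm_mul, norm_div, norm_pow, Complex.norm_natCast, Complex.norm_intCast]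
    have h1 : ‖ξ‖ ^ j / (j.factorial : ℝ) ≤ x ^ m := by
      refine (div_le_self (by positivity) (by exact_mod_cast Nat.factorial_pos j)).trans ?_
      exact (pow_le_pow_left₀ (norm_nonneg _) hξ j).trans (pow_le_pow_right₀ hx hj')
    have h2 := hz k hk' j hj'
    have h3 := hu k hk'
    have h4 : 0 ≤ c1 := (abs_nonneg _).trans h2
    exact mul_le_mul h2 (mul_le_mul h3 h1 (by positivity) hB) (by positivity) h4
  refine (norm_sum_le_of_le _ fun k hk => norm_sum_le_of_le _ fun j hj => this k hk j hj).trans ?_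
  simp [Finset.sum_const]

theorem core (K : Type*) [Field K] [NumberField K] (φ : K →+* ℂ) (iK βK : K) (α : ℝ)
    (hi : iK ^ 2 = -1) (hφi : φ iK = Complex.I) (hφβ : φ βK = Complex.exp (Complex.I * α)) :
    ∃ c2 c3 D : ℕ, 1 ≤ c2 ∧ 1 ≤ c3 ∧ ∀ m N : ℕ, 1 ≤ m → 1 ≤ N → ∀ (p : ℤ) (q : ℕ), 1 ≤ q → p ≠ 0 →
      |α - p / q| ≤ 1 →
      1 ≤ ((m.factorial : ℝ) * (q : ℝ) ^ m) ^ (D + 1) * ((c2 : ℝ) ^ (m * N)) ^ D *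
        (((c3 : ℝ) / m) ^ (m * N) + (c2 : ℝ) ^ (m * N) * |α - p / q|) := by
  obtain ⟨c1, hc1, hforms⟩ := forms
  obtain ⟨b, hb1, hb⟩ : ∃ b : ℕ, 1 ≤ b ∧ IsIntegral ℤ ((b : K) * βK) := by
    have : IsAlgebraic ℤ βK := (IsFractionRing.isAlgebraic_iff ℤ ℚ K).2 (Algebra.IsAlgebraic.isAlgebraic βK)
    obtain ⟨y, hy, hyi⟩ := this.exists_integral_multiple
    refine ⟨y.natAbs, by omega, ?_⟩
    rw [zsmul_eq_mul] at hyi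
    rcases Int.natAbs_eq y with h | h
    · rw [h] at hyi; simpa using hyi
    · rw [h] at hyi; simpa using hyi.neg
  obtain ⟨B, hB1, hB⟩ : ∃ B : ℕ, 1 ≤ B ∧ ∀ σ : K →+* ℂ, ‖σ βK‖ ≤ B := by
    obtain ⟨M, hM⟩ := (Set.finite_range fun σ : K →+* ℂ => ‖σ βK‖).bddAbove
    obtain ⟨B, hB⟩ := exists_nat_ge M
    refine ⟨B + 1, by omega, fun σ => ?_⟩
    have := hM ⟨σ, rfl⟩
    push_cast
    linarith
  obtain ⟨A, hA⟩ := exists_nat_ge (|α| + 1)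
  have hA1 : 1 ≤ A := by
    have : (1 : ℝ) ≤ A := by linarith [abs_nonneg α]
    exact_mod_cast this
  have hσi : ∀ σ : K →+* ℂ, ‖σ iK‖ = 1 := by
    intro σ
    have h1 : ‖σ iK‖ ^ 2 = 1 := by
      rw [← norm_pow, ← map_pow, hi]; simp
    exact (pow_eq_one_iff_of_nonneg (norm_nonneg _) (by norm_num)).1 h1
  have hii : IsIntegral ℤ iK := by
    refine IsIntegral.of_pow (n := 2) (by norm_num) ?_
    rw [hi]; exact isIntegral_one.neg
  set D := Module.finrank ℚ K with hD
  refine ⟨8 * c1 * b * B * A, 3 * b * c1 * A ^ 2 * 3 ^ A, D, Nat.one_le_iff_ne_zero.2 (by positivity),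
    Nat.one_le_iff_ne_zero.2 (by positivity), ?_⟩
  intro m N hm hN p q hq hp hε
  set ε := |α - p / q| with hεd
  set x : ℝ := (p : ℝ) / q with hx
  set ξ : ℂ := Complex.I * ((x : ℝ) : ℂ) with hξd
  have hq' : (0 : ℝ) < q := by exact_mod_cast hq
  have hp' : (p : ℝ) ≠ 0 := by exact_mod_cast hp
  have hx0 : x ≠ 0 := by rw [hx]; positivity
  have hxA : |x| ≤ A := by
    have h1 : |x| ≤ |α| + |α - x| := by
      have := abs_sub_abs_le_abs_sub x α
      rw [abs_sub_comm] at this; linarith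
    linarith
  have hξ0 : ξ ≠ 0 := mul_ne_zero Complex.I_ne_zero (by exact_mod_cast hx0)
  have hξn : ‖ξ‖ = |x| := by simp [hξd]
  have hxc : ((p : ℂ) / q) = ((x : ℝ) : ℂ) := by rw [hx]; push_cast; rfl
  set β := Complex.exp (Complex.I * α) with hβd
  obtain ⟨h, hh, hne⟩ := nonvanish m N hm β ξ hξ0
  obtain ⟨S, z, hS1, hSb, hzb, hform⟩ := hforms m N h hm hN hh
  set θ := theta m N z b p q iK βK with hθ
  have hφθ : φ θ = (m.factorial : ℂ) * (q : ℂ) ^ m * (b : ℂ) ^ N *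
      ((S : ℂ) * Lam (mu m h) N (jet β ξ)) := by
    rw [hθ, theta_map φ m N z b p q hq, hφi, hφβ, hxc, hform]
  have hmf : (m.factorial : ℂ) ≠ 0 := by exact_mod_cast m.factorial_ne_zero
  have hθ0 : θ ≠ 0 := by
    intro h0
    rw [h0, map_zero] at hφθ
    have hqc : (q : ℂ) ≠ 0 := by exact_mod_cast (by omega : q ≠ 0)
    have hbc : (b : ℂ) ≠ 0 := by exact_mod_cast (by omega : b ≠ 0)
    have hSc : (S : ℂ) ≠ 0 := by exact_mod_cast (by omega : S ≠ 0)
    exact (mul_ne_zero (mul_ne_zero (mul_ne_zero hmf (pow_ne_zero _ hqc)) (pow_ne_zero _ hbc))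
      (mul_ne_zero hSc hne)) hφθ.symm
  have hmN : m ≤ m * N := Nat.le_mul_of_pos_right _ hN
  have hNm : N ≤ m * N := Nat.le_mul_of_pos_left _ hm
  have hc1' : (1 : ℝ) ≤ c1 := by exact_mod_cast hc1
  have hb1' : (1 : ℝ) ≤ b := by exact_mod_cast hb1
  have hB1' : (1 : ℝ) ≤ B := by exact_mod_cast hB1
  have hA1' : (1 : ℝ) ≤ A := by exact_mod_cast hA1
  have hN2 : ((N + 1 : ℕ) : ℝ) ≤ 2 ^ (m * N) := by
    exact_mod_cast (Nat.lt_two_pow_self (n := N)).trans_le (Nat.pow_le_pow_right (by norm_num) hNm)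
  have hm2 : ((m + 1 : ℕ) : ℝ) ≤ 2 ^ (m * N) := by
    exact_mod_cast (Nat.lt_two_pow_self (n := m)).trans_le (Nat.pow_le_pow_right (by norm_num) hmN)
  have hbN : (b : ℝ) ^ N ≤ (b : ℝ) ^ (m * N) := pow_le_pow_right₀ hb1' hNm
  have hBN : (B : ℝ) ^ N ≤ (B : ℝ) ^ (m * N) := pow_le_pow_right₀ hB1' hNm
  have hAm : (A : ℝ) ^ m ≤ (A : ℝ) ^ (m * N) := pow_le_pow_right₀ hA1' hmN
  set c2 : ℕ := 8 * c1 * b * B * A with hc2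
  have hc2e : (c2 : ℝ) ^ (m * N) = 2 ^ (m * N) * 2 ^ (m * N) * 2 ^ (m * N) * (c1 : ℝ) ^ (m * N) *
      (b : ℝ) ^ (m * N) * (B : ℝ) ^ (m * N) * (A : ℝ) ^ (m * N) := by
    rw [hc2]; push_cast
    rw [show (8 : ℝ) = 2 * 2 * 2 by norm_num]; simp only [mul_pow]
  have hmq : (1 : ℝ) ≤ (m.factorial : ℝ) * (q : ℝ) ^ m := by
    have : 1 ≤ m.factorial * q ^ m := Nat.one_le_iff_ne_zero.2 (by positivity)
    exact_mod_cast this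
  have hc2one : (1 : ℝ) ≤ (c2 : ℝ) ^ (m * N) := by
    have : 1 ≤ c2 ^ (m * N) := Nat.one_le_iff_ne_zero.2 (by positivity)
    exact_mod_cast this
  have hconj : ∀ σ : K →+* ℂ, ‖σ θ‖ ≤ (m.factorial : ℝ) * (q : ℝ) ^ m * (c2 : ℝ) ^ (m * N) := by
    intro σ
    rw [hθ, theta_map σ m N z b p q hq]
    have hsb := sum_bound m N ((c1 : ℝ) ^ (m * N)) A ((B : ℝ) ^ N) (by positivity) hA1' z hzb
      (fun k => σ βK ^ k) (fun k hk => by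
        rw [norm_pow]
        exact (pow_le_pow_left₀ (norm_nonneg _) (hB σ) k).trans (pow_le_pow_right₀ hB1' hk))
      (σ iK * (p / q)) (by rw [hxc, norm_mul, hσi, one_mul, Complex.norm_real]; exact hxA)
    rw [norm_mul, norm_mul, norm_mul, norm_pow, norm_pow, Complex.norm_natCast,
      Complex.norm_natCast, Complex.norm_natCast, mul_assoc (_ * _)]
    refine mul_le_mul_of_nonneg_left ?_ (by positivity)
    calc (b : ℝ) ^ N * _ ≤ (b : ℝ) ^ (m * N) * (2 ^ (m * N) * (2 ^ (m * N) *
          ((c1 : ℝ) ^ (m * N) * ((B : ℝ) ^ (m * N) * (A : ℝ) ^ (m * N))))) := by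
          refine mul_le_mul hbN (hsb.trans ?_) (norm_nonneg _) (by positivity)
          gcongr
      _ ≤ 2 ^ (m * N) * ((b : ℝ) ^ (m * N) * (2 ^ (m * N) * (2 ^ (m * N) *
          ((c1 : ℝ) ^ (m * N) * ((B : ℝ) ^ (m * N) * (A : ℝ) ^ (m * N)))))) :=
          le_mul_of_one_le_left (by positivity) (one_le_pow₀ (by norm_num))
      _ = (c2 : ℝ) ^ (m * N) := by rw [hc2e]; ring
  have hL := liouville_ineq K φ θ (theta_integral m N z b p q iK βK hii hb) hθ0 _
    (one_le_mul_of_one_le_of_one_le hmq hc2one) hconj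
  have hsplit : (S : ℂ) * Lam (mu m h) N (jet β ξ) =
      (S : ℂ) * Lam (mu m h) N (jet (Complex.exp ξ) ξ) +
      ∑ k ∈ range (N + 1), ∑ j ∈ range (m + 1),
          (z k j : ℂ) * ((β ^ k - Complex.exp ξ ^ k) * (ξ ^ j / (j.factorial : ℂ))) := by
    rw [hform, hform, ← Finset.sum_add_distrib]
    refine Finset.sum_congr rfl fun k _ => ?_
    rw [← Finset.sum_add_distrib]
    refine Finset.sum_congr rfl fun j _ => ?_
    ring
  have hε0 : 0 ≤ ε := abs_nonneg _
  have hN0 : (0 : ℝ) ≤ N := Nat.cast_nonneg N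
  have hsecond := sum_bound m N ((c1 : ℝ) ^ (m * N)) A (N * ε) (by positivity) hA1' z hzb
      (fun k => β ^ k - Complex.exp ξ ^ k) (fun k hk => by
        refine (exp_diff α x k).trans ?_
        refine mul_le_mul_of_nonneg_right ?_ hε0
        exact_mod_cast hk) ξ (by rw [hξn]; exact hxA)
  have hfirst : ‖(S : ℂ) * Lam (mu m h) N (jet (Complex.exp ξ) ξ)‖ ≤
      (c1 : ℝ) ^ (m * N) * (3 / m) ^ (m * N) * ((A : ℝ) ^ 2) ^ (m * N) * (3 ^ A) ^ (m * N) := by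
    have h1 := Lam_exp_bound (mu m h) (fun k => by unfold mu; omega) N (m * (N + 1))
      (W_mu_natDegree m h N hh) ξ
    have h2 : (S : ℝ) ≤ (N.factorial : ℝ) ^ m * (c1 : ℝ) ^ (m * N) := by exact_mod_cast hSb
    have h3 := fact_ratio m N (m * (N + 1)) hm hN (by rw [mul_add]; omega)
    have h4 : ‖ξ‖ ^ (m * (N + 1)) ≤ ((A : ℝ) ^ 2) ^ (m * N) := by
      rw [hξn, ← pow_mul]
      refine (pow_le_pow_left₀ (abs_nonneg _) hxA _).trans (pow_le_pow_right₀ hA1' ?_)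
      rw [mul_add]; omega
    have h5 : Real.exp (N * ‖ξ‖) ≤ (3 ^ A) ^ (m * N) := by
      rw [Real.exp_nat_mul]
      have : Real.exp ‖ξ‖ ≤ 3 ^ A := by
        rw [hξn]
        refine (Real.exp_le_exp.2 hxA).trans ?_
        rw [← mul_one (A : ℝ), Real.exp_nat_mul]
        exact pow_le_pow_left₀ (Real.exp_pos _).le (Real.exp_one_lt_d9.le.trans (by norm_num)) _
      refine (pow_le_pow_left₀ (Real.exp_pos _).le this N).trans ?_
      exact pow_le_pow_right₀ (one_le_pow₀ (by norm_num)) hNm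
    rw [norm_mul, Complex.norm_natCast]
    calc (S : ℝ) * ‖Lam (mu m h) N (jet (Complex.exp ξ) ξ)‖
        ≤ ((N.factorial : ℝ) ^ m * (c1 : ℝ) ^ (m * N)) *
          (‖ξ‖ ^ (m * (N + 1)) / ((m * (N + 1)).factorial : ℝ) * Real.exp (N * ‖ξ‖)) := by
          exact mul_le_mul h2 h1 (norm_nonneg _) (by positivity)
      _ = (c1 : ℝ) ^ (m * N) * ((N.factorial : ℝ) ^ m / ((m * (N + 1)).factorial : ℝ)) *
          ‖ξ‖ ^ (m * (N + 1)) * Real.exp (N * ‖ξ‖) := by ring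
      _ ≤ _ := by gcongr
  have hup : ‖φ θ‖ ≤ (m.factorial : ℝ) * (q : ℝ) ^ m *
      ((((3 * b * c1 * A ^ 2 * 3 ^ A : ℕ) : ℝ) / m) ^ (m * N) + (c2 : ℝ) ^ (m * N) * ε) := by
    rw [hφθ, norm_mul, norm_mul, norm_mul, norm_pow, norm_pow, Complex.norm_natCast,
      Complex.norm_natCast, Complex.norm_natCast, mul_assoc (_ * _), hsplit]
    refine mul_le_mul_of_nonneg_left ?_ (by positivity)
    refine (mul_le_mul hbN (norm_add_le_of_le hfirst hsecond) (norm_nonneg _) (by positivity)).trans ?_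
    rw [mul_add]
    refine add_le_add (le_of_eq ?_) ?_
    · push_cast
      simp only [div_pow, mul_pow]
      ring
    · have hNN : (N : ℝ) ≤ 2 ^ (m * N) := le_trans (by push_cast; linarith) hN2
      calc (b : ℝ) ^ (m * N) * (((N + 1 : ℕ) : ℝ) * (((m + 1 : ℕ) : ℝ) *
            ((c1 : ℝ) ^ (m * N) * (N * ε * (A : ℝ) ^ m))))
          ≤ (b : ℝ) ^ (m * N) * (2 ^ (m * N) * (2 ^ (m * N) *
            ((c1 : ℝ) ^ (m * N) * (2 ^ (m * N) * ε * (A : ℝ) ^ (m * N))))) := by gcongr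
        _ ≤ (B : ℝ) ^ (m * N) * ((b : ℝ) ^ (m * N) * (2 ^ (m * N) * (2 ^ (m * N) *
            ((c1 : ℝ) ^ (m * N) * (2 ^ (m * N) * ε * (A : ℝ) ^ (m * N)))))) :=
            le_mul_of_one_le_left (by positivity) (one_le_pow₀ hB1')
        _ = (c2 : ℝ) ^ (m * N) * ε := by rw [hc2e]; ring
  refine hL.trans ?_
  refine (mul_le_mul_of_nonneg_right hup (by positivity)).trans (le_of_eq ?_)
  rw [mul_pow, pow_succ]
  ring

theorem not_liouville (K : Type*) [Field K] [NumberField K] (φ : K →+* ℂ) (iK βK : K) (α : ℝ)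
    (hi : iK ^ 2 = -1) (hφi : φ iK = Complex.I) (hφβ : φ βK = Complex.exp (Complex.I * α)) :
    ¬ Liouville α := by
  intro hα
  obtain ⟨c2, c3, D, hc2, hc3, hcore⟩ := core K φ iK βK α hi hφi hφβ
  have hα0 : α ≠ 0 := hα.irrational.ne_zero
  set m : ℕ := 2 * c2 ^ D * c3 with hm
  have hm1 : 1 ≤ m := Nat.one_le_iff_ne_zero.2 (by positivity)
  set E : ℕ := 2 * m * (D + 1) + (1 + 4 * (D + 1)) * c2 * m * (D + 1) with hE
  obtain ⟨A, hA⟩ := exists_nat_ge (1 / |α|)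
  obtain ⟨q, ⟨p, -, hpq⟩, hqlarge⟩ :=
    ((hα.frequently_exists_num (E + 1)).and_eventually
      (Filter.eventually_ge_atTop (2 + m + A))).exists
  have hq2 : 2 ≤ q := by omega
  have hqm : m ≤ q := by omega
  have hq0 : (0 : ℝ) < q := by exact_mod_cast (by omega : 0 < q)
  have hq1 : (1 : ℝ) ≤ q := by exact_mod_cast (by omega : 1 ≤ q)
  have hle : 1 / (q : ℝ) ^ (E + 1) ≤ 1 / q := by
    apply one_div_le_one_div_of_le hq0
    exact le_self_pow₀ hq1 (by omega)
  have hp : p ≠ 0 := by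
    rintro rfl
    simp only [Int.cast_zero, zero_div, sub_zero] at hpq
    have h1 : |α| < 1 / q := hpq.trans_le hle
    have h2 : 1 / |α| < q := by
      have : (A : ℝ) < q := by exact_mod_cast (by omega : A < q)
      linarith
    have h3 : 0 < |α| := abs_pos.2 hα0
    rw [lt_div_iff₀ hq0] at h1
    rw [div_lt_iff₀ h3] at h2
    linarith
  have hε1 : |α - p / q| ≤ 1 := (hpq.trans_le hle).le.trans (by
    rw [div_le_one hq0]; exact hq1)
  set N : ℕ := 2 * (D + 1) * (Nat.log 2 q + 1) + 1 with hN
  have hmain := hcore m N hm1 (by omega) p q (by omega) hp hε1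
  have hNlow : 2 * q ^ (2 * (D + 1)) ≤ 2 ^ N := by
    have h1 : q ≤ 2 ^ (Nat.log 2 q + 1) := (Nat.lt_pow_succ_log_self (by norm_num) q).le
    calc 2 * q ^ (2 * (D + 1)) ≤ 2 * (2 ^ (Nat.log 2 q + 1)) ^ (2 * (D + 1)) :=
          Nat.mul_le_mul_left _ (Nat.pow_le_pow_left h1 _)
      _ = 2 ^ N := by rw [hN, ← pow_mul, pow_succ]; ring
  have hNup : 2 ^ N ≤ q ^ (1 + 4 * (D + 1)) := by
    have h1 : 2 ^ (Nat.log 2 q) ≤ q := Nat.pow_log_le_self 2 (by omega)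
    calc 2 ^ N = 2 * (2 * 2 ^ (Nat.log 2 q)) ^ (2 * (D + 1)) := by
          rw [hN, ← pow_succ', ← pow_mul, pow_succ]; ring
      _ ≤ q * (q * q) ^ (2 * (D + 1)) :=
          Nat.mul_le_mul hq2 (Nat.pow_le_pow_left (Nat.mul_le_mul hq2 h1) _)
      _ = q ^ (1 + 4 * (D + 1)) := by rw [← pow_two, ← pow_mul]; ring
  have hfac : ((m.factorial : ℝ) * (q : ℝ) ^ m) ^ (D + 1) ≤ (q : ℝ) ^ (2 * m * (D + 1)) := by
    have h1 : m.factorial ≤ q ^ m := (Nat.factorial_le_pow m).trans (Nat.pow_le_pow_left hqm m)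
    have h2 : (m.factorial * q ^ m) ^ (D + 1) ≤ q ^ (2 * m * (D + 1)) := by
      calc (m.factorial * q ^ m) ^ (D + 1) ≤ (q ^ m * q ^ m) ^ (D + 1) :=
            Nat.pow_le_pow_left (Nat.mul_le_mul_right _ h1) _
        _ = _ := by rw [← pow_add, ← pow_mul, two_mul]
    exact_mod_cast h2
  have hA1 : (q : ℝ) ^ (2 * m * (D + 1)) * (((c2 : ℝ) ^ (m * N)) ^ D *
      ((c3 : ℝ) / m) ^ (m * N)) ≤ 1 / 2 := by
    have hc2' : (0 : ℝ) < c2 := by exact_mod_cast hc2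
    have hc3' : (0 : ℝ) < c3 := by exact_mod_cast hc3
    have h1 : ((c2 : ℝ) ^ (m * N)) ^ D * ((c3 : ℝ) / m) ^ (m * N) = (1 / 2) ^ (m * N) := by
      rw [← pow_mul, mul_comm (m * N) D, pow_mul, ← mul_pow]
      congr 1
      rw [hm]; push_cast; field_simp
    rw [h1]
    have h2 : (2 * (q : ℝ) ^ (2 * (D + 1))) ^ m ≤ 2 ^ (m * N) := by
      rw [mul_comm m N, pow_mul 2 N m]
      exact pow_le_pow_left₀ (by positivity) (by exact_mod_cast hNlow) m
    have h3 : (2 : ℝ) ≤ 2 ^ m := le_self_pow₀ (by norm_num) (by omega)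
    rw [mul_pow, ← pow_mul, show 2 * (D + 1) * m = 2 * m * (D + 1) by ring] at h2
    rw [one_div_pow, mul_one_div, div_le_div_iff₀ (by positivity) (by norm_num)]
    have h4 : 2 * (q : ℝ) ^ (2 * m * (D + 1)) ≤ 2 ^ m * (q : ℝ) ^ (2 * m * (D + 1)) := by gcongr
    linarith
  have hA2 : (q : ℝ) ^ (2 * m * (D + 1)) * (((c2 : ℝ) ^ (m * N)) ^ D *
      ((c2 : ℝ) ^ (m * N) * |α - p / q|)) < 1 / 2 := by
    have h1 : c2 ^ (m * N * (D + 1)) ≤ q ^ ((1 + 4 * (D + 1)) * c2 * m * (D + 1)) := by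
      calc c2 ^ (m * N * (D + 1)) ≤ (2 ^ c2) ^ (m * N * (D + 1)) :=
            Nat.pow_le_pow_left (Nat.lt_two_pow_self).le _
        _ = (2 ^ N) ^ (c2 * m * (D + 1)) := by rw [← pow_mul, ← pow_mul]; congr 1; ring
        _ ≤ (q ^ (1 + 4 * (D + 1))) ^ (c2 * m * (D + 1)) := Nat.pow_le_pow_left hNup _
        _ = _ := by rw [← pow_mul]; congr 1; ring
    have h2 : (c2 : ℝ) ^ (m * N * (D + 1)) ≤ (q : ℝ) ^ ((1 + 4 * (D + 1)) * c2 * m * (D + 1)) := by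
      exact_mod_cast h1
    have h3 : ((c2 : ℝ) ^ (m * N)) ^ D * ((c2 : ℝ) ^ (m * N) * |α - p / q|) =
        (c2 : ℝ) ^ (m * N * (D + 1)) * |α - p / q| := by
      rw [pow_mul _ (m * N), pow_succ]; ring
    rw [h3]
    calc (q : ℝ) ^ (2 * m * (D + 1)) * ((c2 : ℝ) ^ (m * N * (D + 1)) * |α - p / q|)
        ≤ (q : ℝ) ^ (2 * m * (D + 1)) *
          ((q : ℝ) ^ ((1 + 4 * (D + 1)) * c2 * m * (D + 1)) * |α - p / q|) := by gcongr
      _ = (q : ℝ) ^ E * |α - p / q| := by rw [hE, pow_add]; ring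
      _ < (q : ℝ) ^ E * (1 / (q : ℝ) ^ (E + 1)) := by gcongr
      _ = 1 / q := by rw [pow_succ]; field_simp
      _ ≤ 1 / 2 := one_div_le_one_div_of_le (by norm_num) (by exact_mod_cast hq2)
  have hfin : ((m.factorial : ℝ) * (q : ℝ) ^ m) ^ (D + 1) * ((c2 : ℝ) ^ (m * N)) ^ D *
        (((c3 : ℝ) / m) ^ (m * N) + (c2 : ℝ) ^ (m * N) * |α - p / q|) < 1 := by
    calc _ ≤ (q : ℝ) ^ (2 * m * (D + 1)) * ((c2 : ℝ) ^ (m * N)) ^ D *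
        (((c3 : ℝ) / m) ^ (m * N) + (c2 : ℝ) ^ (m * N) * |α - p / q|) := by gcongr
      _ = (q : ℝ) ^ (2 * m * (D + 1)) * (((c2 : ℝ) ^ (m * N)) ^ D * ((c3 : ℝ) / m) ^ (m * N)) +
          (q : ℝ) ^ (2 * m * (D + 1)) *
            (((c2 : ℝ) ^ (m * N)) ^ D * ((c2 : ℝ) ^ (m * N) * |α - p / q|)) := by
        rw [mul_assoc, mul_add (((c2 : ℝ) ^ (m * N)) ^ D), mul_add ((q : ℝ) ^ (2 * m * (D + 1)))]
      _ < 1 / 2 + 1 / 2 := add_lt_add_of_le_of_lt hA1 hA2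
      _ = 1 := by norm_num
  linarith

end LSin

theorem liouville_sin_transcendental (α : ℝ) (h : Liouville α) :
    Transcendental ℚ (Real.sin α) := by
  intro halg
  have hs : IsAlgebraic ℚ ((Real.sin α : ℝ) : ℂ) := halg.algebraMap (A := ℂ)
  have hI : IsAlgebraic ℚ Complex.I := by
    refine IsAlgebraic.of_pow (n := 2) (by norm_num) ?_
    rw [Complex.I_sq]; exact isAlgebraic_one.neg
  have hc : IsAlgebraic ℚ ((Real.cos α : ℝ) : ℂ) := by
    refine IsAlgebraic.of_pow (n := 2) (by norm_num) ?_
    have : ((Real.cos α : ℝ) : ℂ) ^ 2 = 1 - ((Real.sin α : ℝ) : ℂ) ^ 2 := by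
      have := Real.cos_sq' α
      exact_mod_cast this
    rw [this]; exact isAlgebraic_one.sub (hs.pow 2)
  have hβ : IsAlgebraic ℚ (Complex.exp (Complex.I * α)) := by
    rw [mul_comm, Complex.exp_mul_I, ← Complex.ofReal_cos, ← Complex.ofReal_sin]
    exact hc.add (hs.mul hI)
  let L := IntermediateField.adjoin ℚ ({Complex.I, Complex.exp (Complex.I * α)} : Set ℂ)
  haveI : FiniteDimensional ℚ L := by
    refine IntermediateField.finiteDimensional_adjoin ?_
    intro x hx
    rcases hx with rfl | hx
    · exact hI.isIntegral
    · rw [Set.mem_singleton_iff] at hx; rw [hx]; exact hβ.isIntegral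
  haveI : NumberField L := { to_charZero := inferInstance, to_finiteDimensional := inferInstance }
  refine LSin.not_liouville L (algebraMap L ℂ)
    ⟨Complex.I, IntermediateField.subset_adjoin ℚ _ (by simp)⟩
    ⟨Complex.exp (Complex.I * α), IntermediateField.subset_adjoin ℚ _ (by simp)⟩ α ?_ rfl rfl h
  apply Subtype.ext
  simp
end
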